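/- arXiv:0709.4173 — 11 statements merged into one kernel-verified Lean document; each statement's English description precedes it below -/
import Mathlib

section
/- For every complex number s such that s is not a non-positive integer, one has L(1 - s) = (2/π)^s Γ(s) sin(πs/2) L(s). -/
open Complex Real

/-- The Dirichlet beta function: the L-function of the unique nontrivial
Dirichlet character modulo 4. -/
noncomputable def dirichletBeta (s : ℂ) : ℂ :=
  DirichletCharacter.LFunction (ZMod.χ₄.ringHomComp (Int.castRingHom ℂ)) s

lemma chi_dft_aux : ZMod.dft (fun j : ZMod 4 => ((ZMod.χ₄ j : ℤ) : ℂ)) =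
    fun k => (-2 * I) * ((ZMod.χ₄ k : ℤ) : ℂ) := by
  have e1 : ZMod.stdAddChar (1 : ZMod 4) = I := by
    have h := ZMod.stdAddChar_coe (N := 4) 1
    rw [Int.cast_one] at h
    rw [h]
    refine Eq.trans ?_ Complex.exp_pi_div_two_mul_I
    congr 1
    push_cast
    ring
  have e2 : ZMod.stdAddChar (2 : ZMod 4) = -1 := by
    rw [show (2 : ZMod 4) = 1 + 1 by decide, AddChar.map_add_eq_mul, e1, I_mul_I]
  have e3 : ZMod.stdAddChar (3 : ZMod 4) = -I := by
    rw [show (3 : ZMod 4) = 2 + 1 by decide, AddChar.map_add_eq_mul, e1, e2]; ring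
  have e0 : ZMod.stdAddChar (0 : ZMod 4) = 1 := AddChar.map_zero_eq_one _
  have c0 : ZMod.χ₄ 0 = 0 := by decide
  have c1 : ZMod.χ₄ 1 = 1 := by decide
  have c2 : ZMod.χ₄ 2 = 0 := by decide
  have c3 : ZMod.χ₄ 3 = -1 := by decide
  have key : ∀ k : ZMod 4, ZMod.dft (fun j : ZMod 4 => ((ZMod.χ₄ j : ℤ) : ℂ)) k =
      ZMod.stdAddChar (-k) - ZMod.stdAddChar (-(3 * k)) := by
    intro k
    rw [ZMod.dft_apply]
    have := Fin.sum_univ_four (fun j : ZMod 4 => ZMod.stdAddChar (-(j * k)) • ((ZMod.χ₄ j : ℤ) : ℂ))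
    refine this.trans ?_
    change ZMod.stdAddChar (-((0 : ZMod 4) * k)) • ((ZMod.χ₄ 0 : ℤ) : ℂ)
      + ZMod.stdAddChar (-((1 : ZMod 4) * k)) • ((ZMod.χ₄ 1 : ℤ) : ℂ)
      + ZMod.stdAddChar (-((2 : ZMod 4) * k)) • ((ZMod.χ₄ 2 : ℤ) : ℂ)
      + ZMod.stdAddChar (-((3 : ZMod 4) * k)) • ((ZMod.χ₄ 3 : ℤ) : ℂ) = _
    rw [c0, c1, c2, c3]
    simp [sub_eq_add_neg]
  funext k
  rw [key]
  have hk : k = 0 ∨ k = 1 ∨ k = 2 ∨ k = 3 := by revert k; decide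
  rcases hk with rfl | rfl | rfl | rfl
  · rw [c0]; simp
  · rw [c1, show -(1 : ZMod 4) = 3 by decide, show -(3 * 1 : ZMod 4) = 1 by decide, e1, e3]
    push_cast; ring
  · rw [c2, show -(2 : ZMod 4) = 2 by decide, show -(3 * 2 : ZMod 4) = 2 by decide]; simp
  · rw [c3, show -(3 : ZMod 4) = 1 by decide, show -(3 * 3 : ZMod 4) = 3 by decide, e1, e3]
    push_cast; ring

/-- The Dirichlet L-function scales. -/
lemma LFunction_const_mul_aux (a : ℂ) (Φ : ZMod 4 → ℂ) (s : ℂ) :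
    ZMod.LFunction (fun k => a * Φ k) s = a * ZMod.LFunction Φ s := by
  simp only [ZMod.LFunction, mul_assoc, ← Finset.mul_sum]
  ring

/-- For every complex number `s` that is not a non-positive integer,
`L(1 - s) = (2/π)^s Γ(s) sin(πs/2) L(s)`. -/
theorem beta_one_sub_eq (s : ℂ) (hs : ∀ n : ℕ, s ≠ -n) :
    dirichletBeta (1 - s) =
      (2 / (π : ℂ)) ^ s * Complex.Gamma s * Complex.sin (π * s / 2) * dirichletBeta s := by
  have hb : ∀ t, dirichletBeta t = ZMod.LFunction (fun j : ZMod 4 => ((ZMod.χ₄ j : ℤ) : ℂ)) t :=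
    fun t => rfl
  have hneg : (fun x : ZMod 4 => ((ZMod.χ₄ (-x) : ℤ) : ℂ)) =
      fun x => (-1) * ((ZMod.χ₄ x : ℤ) : ℂ) := by
    funext x
    have : ZMod.χ₄ (-x) = - ZMod.χ₄ x := by revert x; decide
    rw [this]; push_cast; ring
  have h0 : ((ZMod.χ₄ (0 : ZMod 4) : ℤ) : ℂ) = 0 := by
    rw [show ZMod.χ₄ 0 = 0 by decide]; simp
  have h := ZMod.LFunction_one_sub (fun j : ZMod 4 => ((ZMod.χ₄ j : ℤ) : ℂ)) hs (Or.inl h0)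
  rw [hneg, ZMod.dft_const_mul, chi_dft_aux, LFunction_const_mul_aux, LFunction_const_mul_aux,
    LFunction_const_mul_aux] at h
  rw [hb, hb, h]
  have hpi : (π : ℂ) ≠ 0 := by exact_mod_cast Real.pi_ne_zero
  have hpow : ((4 : ℕ) : ℂ) ^ (s - 1) * (2 * (π : ℂ)) ^ (-s) * 4 = (2 / (π : ℂ)) ^ s := by
    have h4 : ((4 : ℕ) : ℂ) = ((2 * π : ℝ) : ℂ) * ((2 / π : ℝ) : ℂ) := by
      push_cast; field_simp; norm_num
    rw [Complex.cpow_sub _ _ (by norm_num), Complex.cpow_one, Complex.cpow_neg, h4,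
      Complex.mul_cpow_ofReal_nonneg (by positivity) (by positivity), ← h4]
    have hne : (2 * (π : ℂ)) ^ s ≠ 0 := by
      rw [Ne, Complex.cpow_eq_zero_iff]; simp [hpi]
    push_cast
    field_simp
  rw [← hpow, Complex.sin, show -(π * s / 2 : ℂ) * I = -π * I * s / 2 by ring,
    show (π * s / 2 : ℂ) * I = π * I * s / 2 by ring]
  ring
end

section
/- For every complex number s that is not an integer, one has Γ(s) π^{-s} ζ(s) L(s) = Γ(1-s) π^{-(1-s)} ζ(1-s) L(1-s); that is, the function A(s) = Γ(s) π^{-s} ζ(s) L(s) satisfies the functional equation A(s) = A(1-s). -/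
open Complex Real

open ZMod in
lemma beta_std_one : ZMod.stdAddChar (N := 4) 1 = I := by
  have := ZMod.stdAddChar_coe (N := 4) 1
  rw [Int.cast_one] at this
  rw [this]
  have : (2 * (π : ℂ) * I * ((1 : ℤ) : ℂ) / ((4 : ℕ) : ℂ)) = π / 2 * I := by push_cast; ring
  rw [this, Complex.exp_pi_div_two_mul_I]

noncomputable def chiC (j : ZMod 4) : ℂ := (ZMod.χ₄.ringHomComp (Int.castRingHom ℂ)) j

lemma chiC_vals : chiC 0 = 0 ∧ chiC 1 = 1 ∧ chiC 2 = 0 ∧ chiC 3 = -1 := by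
  have h0 : ZMod.χ₄ 0 = 0 := by decide
  have h1 : ZMod.χ₄ 1 = 1 := by decide
  have h2 : ZMod.χ₄ 2 = 0 := by decide
  have h3 : ZMod.χ₄ 3 = -1 := by decide
  refine ⟨?_, ?_, ?_, ?_⟩ <;> simp only [chiC, MulChar.ringHomComp_apply, h0, h1, h2, h3] <;> simp

lemma chiC_odd : chiC.Odd := by
  obtain ⟨h0, h1, h2, h3⟩ := chiC_vals
  intro j
  have hj : j = 0 ∨ j = 1 ∨ j = 2 ∨ j = 3 := by revert j; decide
  have e0 : -(0 : ZMod 4) = 0 := by decide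
  have e1 : -(1 : ZMod 4) = 3 := by decide
  have e2 : -(2 : ZMod 4) = 2 := by decide
  have e3 : -(3 : ZMod 4) = 1 := by decide
  rcases hj with rfl | rfl | rfl | rfl
  · rw [e0, h0]; simp
  · rw [e1, h1, h3]
  · rw [e2, h2]; simp
  · rw [e3, h1, h3]; simp

lemma chiC_dft : ZMod.dft chiC = fun j => (-2 * I) * chiC j := by
  obtain ⟨h0, h1, h2, h3⟩ := chiC_vals
  have s1 := beta_std_one
  have s0 : ZMod.stdAddChar (N := 4) 0 = 1 := AddChar.map_zero_eq_one _
  have s2 : ZMod.stdAddChar (N := 4) 2 = -1 := by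
    rw [show (2 : ZMod 4) = 1 + 1 by decide, AddChar.map_add_eq_mul, s1, I_mul_I]
  have s3 : ZMod.stdAddChar (N := 4) 3 = -I := by
    rw [show (3 : ZMod 4) = 2 + 1 by decide, AddChar.map_add_eq_mul, s1, s2, neg_one_mul]
  funext k
  rw [ZMod.dft_apply]
  have hu : (Finset.univ : Finset (ZMod 4)) = {0, 1, 2, 3} := by decide
  rw [hu, Finset.sum_insert (by decide), Finset.sum_insert (by decide),
    Finset.sum_insert (by decide), Finset.sum_singleton, h0, h1, h2, h3]
  have hk : k = 0 ∨ k = 1 ∨ k = 2 ∨ k = 3 := by revert k; decide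
  rcases hk with rfl | rfl | rfl | rfl
  · rw [h0, show -((1 : ZMod 4) * 0) = 0 by decide, show -((3 : ZMod 4) * 0) = 0 by decide, s0]
    simp
  · rw [h1, show -((1 : ZMod 4) * 1) = 3 by decide, show -((3 : ZMod 4) * 1) = 1 by decide, s1, s3]
    simp; ring
  · rw [h2, show -((1 : ZMod 4) * 2) = 2 by decide, show -((3 : ZMod 4) * 2) = 2 by decide, s2]
    simp
  · rw [h3, show -((1 : ZMod 4) * 3) = 1 by decide, show -((3 : ZMod 4) * 3) = 3 by decide, s1, s3]
    simp; ring

lemma beta_completed (s : ℂ) : ZMod.completedLFunction chiC (1 - s) =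
    (4 : ℂ) ^ (s - 1) * 2 * ZMod.completedLFunction chiC s := by
  rw [ZMod.completedLFunction_one_sub_odd chiC_odd, chiC_dft, ZMod.completedLFunction_const_mul]
  push_cast
  linear_combination (-2 * (4 : ℂ) ^ (s - 1) * ZMod.completedLFunction chiC s) * I_sq

/-- The product in terms of completed functions. -/
lemma A_eq (s : ℂ) (hs : ∀ n : ℤ, s ≠ n) :
    Complex.Gamma s * (π : ℂ) ^ (-s) * riemannZeta s * dirichletBeta s =
      (2 : ℂ) ^ s / 2 * completedRiemannZeta s * ZMod.completedLFunction chiC s := by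
  have hb : dirichletBeta s = ZMod.LFunction chiC s := rfl
  have h0 : s ≠ 0 := by simpa using hs 0
  have hG : Complex.Gamma s ≠ 0 := Complex.Gamma_ne_zero fun m => by simpa using hs (-m)
  have hp : (π : ℂ) ^ (-s) ≠ 0 := by simp [Complex.cpow_eq_zero_iff, Real.pi_ne_zero]
  have h2 : (2 : ℂ) ^ s ≠ 0 := by simp [Complex.cpow_eq_zero_iff]
  have hm : ((2 : ℂ) * π) ^ (-s) = ((2 : ℂ) ^ s)⁻¹ * (π : ℂ) ^ (-s) := by
    rw [← Complex.cpow_neg]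
    have := Complex.mul_cpow_ofReal_nonneg (a := 2) (b := π) (by norm_num) Real.pi_pos.le (-s)
    simpa using this
  rw [hb, ZMod.LFunction_eq_completed_div_gammaFactor_odd chiC_odd, riemannZeta_def_of_ne_zero h0]
  have key := Gammaℝ_mul_Gammaℝ_add_one s
  rw [Gammaℂ_def, hm] at key
  have hne : Gammaℝ s * Gammaℝ (s + 1) ≠ 0 := by
    rw [key]
    exact mul_ne_zero (mul_ne_zero two_ne_zero (mul_ne_zero (inv_ne_zero h2) hp)) hG
  have hA : Gammaℝ s ≠ 0 := left_ne_zero_of_mul hne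
  have hB : Gammaℝ (s + 1) ≠ 0 := right_ne_zero_of_mul hne
  have key' : Complex.Gamma s * (π : ℂ) ^ (-s) =
      (2 : ℂ) ^ s / 2 * (Gammaℝ s * Gammaℝ (s + 1)) := by
    rw [key]; field_simp
  rw [key']
  field_simp

/-- For every complex number `s` that is not an integer, the function
`A(s) = Γ(s) π^{-s} ζ(s) L(s)` satisfies `A(s) = A(1 - s)`. -/
theorem A_functional_equation (s : ℂ) (hs : ∀ n : ℤ, s ≠ n) :
    Complex.Gamma s * (π : ℂ) ^ (-s) * riemannZeta s * dirichletBeta s =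
      Complex.Gamma (1 - s) * (π : ℂ) ^ (-(1 - s)) * riemannZeta (1 - s) *
        dirichletBeta (1 - s) := by
  have hs' : ∀ n : ℤ, 1 - s ≠ n := fun n h => hs (1 - n) (by push_cast; linear_combination -h)
  rw [A_eq s hs, A_eq (1 - s) hs', completedRiemannZeta_one_sub, beta_completed]
  have h2 : (2 : ℂ) ^ s ≠ 0 := by simp [Complex.cpow_eq_zero_iff]
  have h4 : (4 : ℂ) ^ s = (2 : ℂ) ^ s * (2 : ℂ) ^ s := by
    have := Complex.mul_cpow_ofReal_nonneg (a := 2) (b := 2) (by norm_num) (by norm_num) s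
    norm_num at this
    exact this
  rw [Complex.cpow_sub _ _ (by norm_num : (2 : ℂ) ≠ 0),
    Complex.cpow_sub _ _ (by norm_num : (4 : ℂ) ≠ 0), h4, Complex.cpow_one, Complex.cpow_one]
  field_simp
  ring
end

section
/- For every complex number s with Re(s) > 0, one has Γ(s) L(s) = ∫_0^∞ t^{s-1} / (e^t + e^{-t}) dt. -/
open Complex Real MeasureTheory

/-- The kernel `1 / (e^t + e^{-t})`. -/
noncomputable def betaKernel (t : ℝ) : ℂ := ((Real.exp t + Real.exp (-t) : ℝ) : ℂ)⁻¹

/-- The complex-valued quadratic character modulo 4. -/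
noncomputable def betaChar : DirichletCharacter ℂ 4 := ZMod.χ₄.ringHomComp (Int.castRingHom ℂ)

lemma betaChar_odd (n : ℕ) : betaChar ((2 * n + 1 : ℕ) : ZMod 4) = (-1) ^ n := by
  have h := ZMod.χ₄_eq_neg_one_pow (n := 2 * n + 1) (by omega)
  have h2 : (2 * n + 1) / 2 = n := by omega
  rw [h2] at h
  simp only [betaChar, MulChar.ringHomComp_apply]
  rw [h]
  simp

lemma betaChar_even (n : ℕ) (hn : n % 2 = 0) : betaChar (n : ZMod 4) = 0 := by
  have h := ZMod.χ₄_nat_eq_if_mod_four n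
  rw [if_pos hn] at h
  simp only [betaChar, MulChar.ringHomComp_apply]
  rw [h]
  simp

lemma betaChar_ne_one : betaChar ≠ 1 := by
  intro h
  have h3 := betaChar_odd 1
  rw [h, MulChar.one_apply (by decide)] at h3
  norm_num at h3

lemma betaKernel_hasSum (t : ℝ) (ht : 0 < t) :
    HasSum (fun n : ℕ ↦ betaChar (n : ZMod 4) * (Real.exp (-(n : ℝ) * t) : ℂ)) (betaKernel t) := by
  have hinj : Function.Injective (fun n : ℕ ↦ 2 * n + 1) := fun a b h ↦ by
    simp only at h
    omega
  rw [← hinj.hasSum_iff]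
  · have hlt : Real.exp (-2 * t) < 1 := by
      rw [Real.exp_lt_one_iff]
      linarith
    have hg := hasSum_geometric_of_abs_lt_one (r := -Real.exp (-2 * t))
      (by rw [abs_neg, abs_of_pos (Real.exp_pos _)]; exact hlt)
    have hg2 := (hg.mul_left (Real.exp (-t)))
    have hg3 := Complex.hasSum_ofReal.mpr hg2
    have e1 : ((Real.exp (-t) * (1 - -Real.exp (-2 * t))⁻¹ : ℝ) : ℂ) = betaKernel t := by
      unfold betaKernel
      rw [← Complex.ofReal_inv]
      congr 1
      have h1 : Real.exp (-2 * t) = Real.exp (-t) * Real.exp (-t) := by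
        rw [← Real.exp_add]; ring_nf
      have h2 : Real.exp t * Real.exp (-t) = 1 := by
        rw [← Real.exp_add]; simp
      have h3 := Real.exp_pos t
      have h4 := Real.exp_pos (-t)
      rw [h1]
      have h5 : (1 - -(Real.exp (-t) * Real.exp (-t))) ≠ 0 := by
        have : 0 < Real.exp (-t) * Real.exp (-t) := by positivity
        linarith
      have h6 : Real.exp t + Real.exp (-t) ≠ 0 := by positivity
      rw [← div_eq_mul_inv, div_eq_iff h5, inv_mul_eq_div, eq_div_iff h6]
      linear_combination h2
    rw [e1] at hg3
    refine hg3.congr_fun fun n ↦ ?_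
    simp only [Function.comp_apply]
    rw [betaChar_odd]
    have e2 : Real.exp (-((2 * n + 1 : ℕ) : ℝ) * t) = Real.exp (-t) * Real.exp (-2 * t) ^ n := by
      rw [← Real.exp_nat_mul, ← Real.exp_add]
      congr 1
      push_cast
      ring
    rw [e2, neg_pow (Real.exp (-2 * t))]
    push_cast
    ring
  · intro n hn
    rw [betaChar_even n, zero_mul]
    by_contra h
    exact hn ⟨n / 2, by simp only; omega⟩

lemma gamma_mul_beta_of_one_lt (s : ℂ) (hs : 1 < s.re) :
    Complex.Gamma s * DirichletCharacter.LFunction betaChar s = mellin betaKernel s := by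
  have hs0 : s ≠ 0 := by
    rintro rfl
    norm_num at hs
  have H := hasSum_mellin (a := fun n : ℕ ↦ betaChar (n : ZMod 4)) (p := fun n ↦ (n : ℝ))
    (F := betaKernel) (s := s) (fun n ↦ ?_) (by linarith)
    (fun t ht ↦ betaKernel_hasSum t ht) ?_
  · have hL := (DirichletCharacter.LSeriesSummable_of_one_lt_re betaChar hs).LSeriesHasSum
    rw [DirichletCharacter.LFunction_eq_LSeries betaChar hs]
    refine HasSum.unique ?_ H
    refine (HasSum.mul_left (Complex.Gamma s) hL).congr_fun fun n ↦ ?_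
    rw [LSeries.term_of_ne_zero' hs0]
    push_cast
    ring
  · rcases Nat.eq_zero_or_pos n with rfl | h
    · left; exact betaChar_even 0 rfl
    · right; exact_mod_cast h
  · refine Summable.of_nonneg_of_le (fun n ↦ by positivity) (fun n ↦ ?_)
      (Real.summable_one_div_nat_rpow.mpr hs)
    gcongr
    exact betaChar.norm_le_one _

lemma betaKernel_continuous : Continuous betaKernel := by
  unfold betaKernel
  refine Continuous.inv₀ (by fun_prop) fun t ↦ ?_
  have : 0 < Real.exp t + Real.exp (-t) := by positivity
  exact_mod_cast this.ne'

lemma mellin_betaKernel_differentiableAt (s : ℂ) (hs : 0 < s.re) :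
    DifferentiableAt ℂ (mellin betaKernel) s := by
  refine mellin_differentiableAt_of_isBigO_rpow_exp (a := 1) (b := 0) one_pos
    (betaKernel_continuous.locallyIntegrable.locallyIntegrableOn _) ?_ ?_ hs
  · refine Asymptotics.IsBigO.of_bound 1 (Filter.Eventually.of_forall fun t ↦ ?_)
    unfold betaKernel
    rw [norm_inv, Complex.norm_real, Real.norm_of_nonneg (by positivity),
      Real.norm_of_nonneg (by positivity), one_mul, neg_mul, one_mul, Real.exp_neg]
    gcongr
    have := Real.exp_pos t
    simp only [le_add_iff_nonneg_right]
    positivity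
  · simp only [neg_zero, Real.rpow_zero]
    exact ((betaKernel_continuous.tendsto 0).mono_left nhdsWithin_le_nhds).isBigO_one ℝ

/-- For `Re(s) > 0`, `Γ(s) L(s) = ∫_0^∞ t^{s-1} / (e^t + e^{-t}) dt`. -/
theorem gamma_mul_beta_integral (s : ℂ) (hs : 0 < s.re) :
    Complex.Gamma s * dirichletBeta s =
      ∫ t in Set.Ioi (0 : ℝ), (t : ℂ) ^ (s - 1) / (Real.exp t + Real.exp (-t)) := by
  have hopen : IsOpen {z : ℂ | 0 < z.re} := isOpen_lt continuous_const Complex.continuous_re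
  have hpc : IsPreconnected {z : ℂ | 0 < z.re} := (convex_halfSpace_re_gt 0).isPreconnected
  have key : Set.EqOn (fun z ↦ Complex.Gamma z * DirichletCharacter.LFunction betaChar z)
      (mellin betaKernel) {z : ℂ | 0 < z.re} := by
    refine AnalyticOnNhd.eqOn_of_preconnected_of_eventuallyEq (𝕜 := ℂ) (z₀ := 2) ?_ ?_ hpc
      (by simp) ?_
    · refine DifferentiableOn.analyticOnNhd (fun z hz ↦ ?_) hopen
      refine (DifferentiableAt.mul (Complex.differentiableAt_Gamma z fun m h ↦ ?_)
        (DirichletCharacter.differentiable_LFunction betaChar_ne_one z)).differentiableWithinAt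
      rw [h] at hz
      simp only [Set.mem_ofPred_eq, Complex.neg_re, Complex.natCast_re] at hz
      have : (0 : ℝ) ≤ m := Nat.cast_nonneg m
      linarith
    · exact DifferentiableOn.analyticOnNhd (fun z hz ↦
        (mellin_betaKernel_differentiableAt z hz).differentiableWithinAt) hopen
    · refine Filter.eventually_of_mem ((isOpen_lt continuous_const
        Complex.continuous_re).mem_nhds (by simp : (1 : ℝ) < (2 : ℂ).re)) fun z hz ↦ ?_
      exact gamma_mul_beta_of_one_lt z hz
  refine (key hs).trans ?_
  simp only [mellin, betaKernel, smul_eq_mul, div_eq_mul_inv, Complex.ofReal_add]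
end

section
/- For every integer m ≥ 2, writing η(m, x) = Σ_{n=1}^∞ (-1)^{n-1} x^n / n^m and η(1-m, x) = Σ_{n=1}^∞ (-1)^{n-1} n^{m-1} x^n for 0 < x < 1, the limit of η(1-m, x) / η(m, x) as x → 1^- exists and equals -((2^m - 1) / (π^m (2^{m-1} - 1))) · (m-1)! · cos(πm/2) if m is even, and equals 0 if m is odd. -/
open Real Filter Topology

/-- `η(m, x) = Σ_{n=1}^∞ (-1)^{n-1} x^n / n^m`. -/
noncomputable def etaPow (m : ℕ) (x : ℝ) : ℝ :=
  ∑' n : ℕ, (-1 : ℝ) ^ n * x ^ (n + 1) / ((n : ℝ) + 1) ^ m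

/-- `η(1-m, x) = Σ_{n=1}^∞ (-1)^{n-1} n^{m-1} x^n`. -/
noncomputable def etaPowNeg (m : ℕ) (x : ℝ) : ℝ :=
  ∑' n : ℕ, (-1 : ℝ) ^ n * ((n : ℝ) + 1) ^ (m - 1) * x ^ (n + 1)

open Polynomial in
/-- The power series with polynomial coefficients. -/
noncomputable def polySum (p : ℝ[X]) (r : ℝ) : ℝ := ∑' n : ℕ, p.eval (n : ℝ) * r ^ n

open Polynomial in
lemma polySum_summable (p : ℝ[X]) {r : ℝ} (hr : |r| < 1) :
    Summable (fun n : ℕ => p.eval (n : ℝ) * r ^ n) := by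
  induction p using Polynomial.induction_on' with
  | add p q hp hq => simpa [add_mul] using hp.add hq
  | monomial k a =>
    simpa [mul_assoc] using
      (summable_pow_mul_geometric_of_norm_lt_one (R := ℝ) k (r := r) (by simpa using hr)).mul_left a

open Polynomial in
lemma polySum_add (p q : ℝ[X]) {r : ℝ} (hr : |r| < 1) :
    polySum (p + q) r = polySum p r + polySum q r := by
  unfold polySum
  rw [← (polySum_summable p hr).tsum_add (polySum_summable q hr)]
  simp [add_mul]

open Polynomial in
lemma polySum_shift (p : ℝ[X]) {r : ℝ} (hr : |r| < 1) :
    r * polySum (taylor 1 p) r = polySum p r - p.eval 0 := by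
  unfold polySum
  rw [(polySum_summable p hr).tsum_eq_zero_add, ← tsum_mul_left]
  simp only [taylor_eval, pow_zero, mul_one, Nat.cast_zero, add_sub_cancel_left]
  congr 1
  ext n
  push_cast
  ring

lemma ev_abs : ∀ᶠ x : ℝ in 𝓝[Set.Ioo (0 : ℝ) 1] 1, |(-x)| < 1 := by
  filter_upwards [self_mem_nhdsWithin] with x hx
  rw [abs_neg, abs_of_pos hx.1]; exact hx.2

lemma tendsto_x : Tendsto (fun x : ℝ => x) (𝓝[Set.Ioo (0 : ℝ) 1] 1) (𝓝 1) :=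
  tendsto_nhdsWithin_of_tendsto_nhds tendsto_id

open Polynomial in
lemma polySum_lim (d : ℕ) : ∀ p : ℝ[X], p.degree < d →
    ∃ L, Tendsto (fun x : ℝ => polySum p (-x)) (𝓝[Set.Ioo (0 : ℝ) 1] 1) (𝓝 L) := by
  induction d with
  | zero =>
    intro p hp
    have : p = 0 := by simpa using hp
    subst this
    exact ⟨0, by simp [polySum]⟩
  | succ d ih =>
    intro p hp
    by_cases h0 : p = 0
    · subst h0
      exact ⟨0, by simp [polySum]⟩
    have hdeg : (taylor 1 p - p).degree < p.degree := by
      have h1 : (taylor 1 p).degree = p.degree := by simp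
      rw [← h1]
      apply degree_sub_lt_left h1
      · simpa using h0
      · simp
    obtain ⟨L, hL⟩ := ih (taylor 1 p - p) (by
      rw [degree_eq_natDegree h0] at hp hdeg
      refine lt_of_lt_of_le hdeg ?_
      have : p.natDegree < d + 1 := by exact_mod_cast hp
      exact_mod_cast Nat.lt_succ_iff.mp this)
    refine ⟨(p.eval 0 + (-1) * L) / (1 + 1), ?_⟩
    have ht : Tendsto (fun x : ℝ => (p.eval 0 + (-x) * polySum (taylor 1 p - p) (-x)) / (1 + x))
        (𝓝[Set.Ioo (0 : ℝ) 1] 1) (𝓝 ((p.eval 0 + (-1) * L) / (1 + 1))) :=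
      (tendsto_const_nhds.add (tendsto_x.neg.mul hL)).div (tendsto_const_nhds.add tendsto_x)
        (by norm_num)
    refine ht.congr' ?_
    filter_upwards [ev_abs, self_mem_nhdsWithin] with x hx hx'
    have h1 := polySum_shift p hx
    have h2 := polySum_add (taylor 1 p - p) p hx
    rw [sub_add_cancel] at h2
    rw [h2] at h1
    have : (1 + x) ≠ 0 := by linarith [hx'.1]
    rw [div_eq_iff this]
    linarith

open Polynomial in
lemma polySum_val (q : ℝ[X]) :
    Tendsto (fun x : ℝ => polySum (taylor 1 q + q) (-x)) (𝓝[Set.Ioo (0 : ℝ) 1] 1)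
      (𝓝 (q.eval 0)) := by
  obtain ⟨L, hL⟩ := polySum_lim (q.natDegree + 1) q (by
    exact_mod_cast lt_of_le_of_lt degree_le_natDegree (by exact_mod_cast Nat.lt_succ_self _))
  have ht : Tendsto (fun x : ℝ => (q.eval 0 + (x - 1) * polySum q (-x)) / x)
      (𝓝[Set.Ioo (0 : ℝ) 1] 1) (𝓝 ((q.eval 0 + (1 - 1) * L) / 1)) :=
    (tendsto_const_nhds.add ((tendsto_x.sub tendsto_const_nhds).mul hL)).div tendsto_x
        (by norm_num)
  simp only [sub_self, zero_mul, add_zero, div_one] at ht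
  refine ht.congr' ?_
  filter_upwards [ev_abs, self_mem_nhdsWithin] with x hx hx'
  rw [polySum_add _ _ hx]
  have h1 := polySum_shift q hx
  rw [div_eq_iff hx'.1.ne']
  linarith

lemma bernoulliFun_add_one' (n : ℕ) (y : ℝ) :
    bernoulliFun n (1 + y) = bernoulliFun n y + n * y ^ (n - 1) := by
  have := congr_arg (fun p => Polynomial.aeval y p) (Polynomial.bernoulli_comp_one_add_X n)
  simpa [bernoulliFun, Polynomial.aeval_comp] using this

open Polynomial in
lemma exists_euler (n : ℕ) (hn : n ≠ 0) : ∃ q : ℝ[X], taylor 1 q + q = X ^ (n - 1) ∧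
    q.eval 0 = (1 - 2 ^ n) * (_root_.bernoulli n : ℝ) / n := by
  let P : ℝ[X] := (Polynomial.bernoulli n).map (algebraMap ℚ ℝ)
  have hP : ∀ y, P.eval y = bernoulliFun n y := fun y => rfl
  have hn' : (n : ℝ) ≠ 0 := by exact_mod_cast hn
  refine ⟨C (1 / (n : ℝ)) * (P - C (2 ^ n) * P.comp (C (1 / 2) * X)), ?_, ?_⟩
  · apply Polynomial.funext
    intro y
    have h := bernoulliFun_mul n two_ne_zero (y / 2)
    have h2 := bernoulliFun_add_one' n y
    simp only [Finset.sum_range_succ, Finset.sum_range_zero] at h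
    push_cast at h
    rw [show (2 : ℝ) * (y / 2) = y by ring, show y / 2 + 0 / 2 = 1 / 2 * y by ring,
      show y / 2 + 1 / 2 = 1 / 2 * (1 + y) by ring] at h
    simp only [eval_add, taylor_eval, eval_mul, eval_C, eval_sub, eval_comp, eval_X, eval_pow, hP]
    rw [add_comm y 1, h2]
    field_simp
    field_simp at h
    linear_combination h
  · simp only [eval_mul, eval_C, eval_sub, eval_comp, eval_X, hP, mul_zero, bernoulliFun_eval_zero]
    ring

lemma neg_lim (m : ℕ) (hm : 2 ≤ m) :
    Tendsto (fun x : ℝ => etaPowNeg m x) (𝓝[Set.Ioo (0 : ℝ) 1] 1)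
      (𝓝 ((2 ^ m - 1) * bernoulli m / m)) := by
  obtain ⟨q, hq, hq0⟩ := exists_euler m (by omega)
  have h := (polySum_val q).neg
  rw [hq, hq0] at h
  rw [show ((2 : ℝ) ^ m - 1) * bernoulli m / m = -((1 - 2 ^ m) * bernoulli m / m) by ring]
  refine h.congr' ?_
  filter_upwards [ev_abs] with x hx
  unfold polySum etaPowNeg
  rw [(polySum_summable _ hx).tsum_eq_zero_add]
  have : m - 1 ≠ 0 := by omega
  simp only [Polynomial.eval_pow, Polynomial.eval_X, Nat.cast_zero, zero_pow this, zero_mul,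
    zero_add, ← tsum_neg]
  congr 1
  ext n
  push_cast
  rw [neg_pow x, pow_succ (-1 : ℝ)]
  ring

lemma summ (m : ℕ) (hm : 2 ≤ m) : Summable (fun n : ℕ => 1 / ((n : ℝ) + 1) ^ m) := by
  have := (summable_nat_add_iff 1).mpr (Real.summable_one_div_nat_pow.mpr (show 1 < m by omega))
  simpa using this

lemma pos_lim (m : ℕ) (hm : 2 ≤ m) :
    Tendsto (fun x : ℝ => etaPow m x) (𝓝[Set.Ioo (0 : ℝ) 1] 1)
      (𝓝 (∑' n : ℕ, (-1 : ℝ) ^ n / ((n : ℝ) + 1) ^ m)) := by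
  unfold etaPow
  apply tendsto_tsum_of_dominated_convergence (summ m hm)
  · intro n
    have : Tendsto (fun x : ℝ => (-1 : ℝ) ^ n * x ^ (n + 1) / ((n : ℝ) + 1) ^ m)
      (𝓝[Set.Ioo (0 : ℝ) 1] 1) (𝓝 ((-1 : ℝ) ^ n * 1 ^ (n + 1) / ((n : ℝ) + 1) ^ m)) :=
      (tendsto_const_nhds.mul (tendsto_x.pow _)).div_const _
    simpa using this
  · filter_upwards [self_mem_nhdsWithin] with x hx n
    rw [norm_div, norm_mul, norm_pow, norm_pow, norm_pow]
    have : ‖(n : ℝ) + 1‖ = n + 1 := by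
      rw [Real.norm_eq_abs, abs_of_pos (by positivity)]
    rw [this]
    have hx1 : ‖x‖ ≤ 1 := by
      rw [Real.norm_eq_abs, abs_of_pos hx.1]; exact hx.2.le
    gcongr
    simpa using pow_le_one₀ (norm_nonneg x) hx1

lemma eta_zeta (m : ℕ) (hm : 2 ≤ m) :
    ∑' n : ℕ, (-1 : ℝ) ^ n / ((n : ℝ) + 1) ^ m =
      (1 - 2 / 2 ^ m) * ∑' n : ℕ, 1 / ((n : ℝ) + 1) ^ m := by
  have hs := summ m hm
  have he : Summable (fun k : ℕ => 1 / (((2 * k : ℕ) : ℝ) + 1) ^ m) :=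
    hs.comp_injective (mul_right_injective₀ (two_ne_zero' ℕ))
  have ho : Summable (fun k : ℕ => 1 / (((2 * k + 1 : ℕ) : ℝ) + 1) ^ m) :=
    hs.comp_injective ((add_left_injective 1).comp (mul_right_injective₀ (two_ne_zero' ℕ)))
  have h1 := tsum_even_add_odd (f := fun n : ℕ => 1 / ((n : ℝ) + 1) ^ m) he ho
  have h2 := tsum_even_add_odd (f := fun n : ℕ => (-1 : ℝ) ^ n / ((n : ℝ) + 1) ^ m)
    (by simpa [pow_mul] using he) (by simpa [pow_add, pow_mul, neg_div] using ho.neg)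
  have h3 : ∑' k : ℕ, 1 / (((2 * k + 1 : ℕ) : ℝ) + 1) ^ m =
      1 / 2 ^ m * ∑' n : ℕ, 1 / ((n : ℝ) + 1) ^ m := by
    rw [← tsum_mul_left]
    congr 1
    ext k
    push_cast
    rw [show (2 * (k : ℝ) + 1 + 1) = 2 * (k + 1) by ring, mul_pow]
    field_simp
  have h4 : ∑' k : ℕ, (-1 : ℝ) ^ (2 * k) / (((2 * k : ℕ) : ℝ) + 1) ^ m =
      ∑' k : ℕ, 1 / (((2 * k : ℕ) : ℝ) + 1) ^ m := by simp [pow_mul]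
  have h5 : ∑' k : ℕ, (-1 : ℝ) ^ (2 * k + 1) / (((2 * k + 1 : ℕ) : ℝ) + 1) ^ m =
      - ∑' k : ℕ, 1 / (((2 * k + 1 : ℕ) : ℝ) + 1) ^ m := by
    rw [← tsum_neg]; simp [pow_add, pow_mul, neg_div]
  rw [h4, h5, h3] at h2
  rw [h3] at h1
  rw [← h2]
  linear_combination h1

lemma zeta_pos (m : ℕ) (hm : 2 ≤ m) : 0 < ∑' n : ℕ, 1 / ((n : ℝ) + 1) ^ m :=
  (summ m hm).tsum_pos (fun n => by positivity) 0 (by norm_num)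

lemma two_lt (m : ℕ) (hm : 2 ≤ m) : (2 : ℝ) < 2 ^ m := by
  calc (2 : ℝ) = 2 ^ 1 := by norm_num
    _ < 2 ^ m := pow_lt_pow_right₀ (by norm_num) (by omega)

lemma eta_ne (m : ℕ) (hm : 2 ≤ m) :
    ∑' n : ℕ, (-1 : ℝ) ^ n / ((n : ℝ) + 1) ^ m ≠ 0 := by
  rw [eta_zeta m hm]
  have h := two_lt m hm
  have : 2 / (2 : ℝ) ^ m < 1 := by rw [div_lt_one (by positivity)]; exact h
  exact mul_ne_zero (by linarith) (zeta_pos m hm).ne'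

/-- Euler's limit: for every integer `m ≥ 2`, the limit of `η(1-m, x) / η(m, x)` as
`x → 1⁻` exists and equals `-((2^m - 1)/(π^m (2^{m-1} - 1))) (m-1)! cos(πm/2)` if `m`
is even, and `0` if `m` is odd. -/
theorem euler_limit (m : ℕ) (hm : 2 ≤ m) :
    Tendsto (fun x : ℝ => etaPowNeg m x / etaPow m x) (𝓝[Set.Ioo (0 : ℝ) 1] 1)
      (𝓝 (if Even m then
            -((2 ^ m - 1) / (π ^ m * (2 ^ (m - 1) - 1))) * (Nat.factorial (m - 1)) *
              Real.cos (π * m / 2)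
          else 0)) := by
  have h := (neg_lim m hm).div (pos_lim m hm) (eta_ne m hm)
  refine (congr_arg (fun L => Tendsto (fun x : ℝ => etaPowNeg m x / etaPow m x)
    (𝓝[Set.Ioo (0 : ℝ) 1] 1) (𝓝 L)) ?_).mpr h
  have hne := eta_ne m hm
  split_ifs with he
  · rw [eq_div_iff hne]
    obtain ⟨k, rfl⟩ := he.exists_two_nsmul
    simp only [smul_eq_mul] at *
    have hk : k ≠ 0 := by omega
    have hz : ∑' n : ℕ, 1 / ((n : ℝ) + 1) ^ (2 * k) = (-1 : ℝ) ^ (k + 1) * (2 : ℝ) ^ (2 * k - 1)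
        * π ^ (2 * k) * bernoulli (2 * k) / (2 * k).factorial := by
      rw [← (hasSum_zeta_nat hk).tsum_eq, (hasSum_zeta_nat hk).summable.tsum_eq_zero_add]
      simp [hk]
    rw [eta_zeta _ hm, hz]
    have hc : Real.cos (π * ((2 * k : ℕ) : ℝ) / 2) = (-1) ^ k := by
      rw [← Real.cos_nat_mul_pi]; congr 1; push_cast; ring
    rw [hc]
    obtain ⟨j, hj⟩ : ∃ j, 2 * k = j + 1 := ⟨2 * k - 1, by omega⟩
    have h2 := two_lt _ hm
    have hs : ((-1 : ℝ) ^ k) * (-1) ^ k = 1 := by rw [← mul_pow]; simp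
    rw [pow_succ (-1 : ℝ) k]
    generalize (-1 : ℝ) ^ k = s at *
    rw [hj] at *
    simp only [Nat.add_sub_cancel, Nat.factorial_succ] at *
    rw [pow_succ (2 : ℝ) j] at *
    have h3 : (2 : ℝ) ^ j - 1 ≠ 0 := by linarith
    have h4 : (j.factorial : ℝ) ≠ 0 := by positivity
    have h5 : (j : ℝ) + 1 ≠ 0 := by positivity
    have := Real.pi_ne_zero
    push_cast
    field_simp
    have hs2 : s ^ 2 = 1 := by rw [sq, hs]
    simp only [hs2]
    ring
  · rw [bernoulli_eq_zero_of_odd (Nat.not_even_iff_odd.mp he) (by omega)]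
    simp
end

section
/- For every real s with 0 < s < 1, with f(x) = Σ_{n=0}^∞ sin((2n+1)x)/(2n+1), the improper integral ∫_0^∞ f(x) x^{s-1} dx exists (as the limit of ∫_0^T f(x) x^{s-1} dx as T → ∞) and equals Γ(s) sin(πs/2) (1 - 2^{-s-1}) ζ(s+1). -/
open Real Filter Topology MeasureTheory intervalIntegral

lemma abs_sin_odd (x : ℝ) (n : ℕ) : |Real.sin ((2 * n + 1) * x)| ≤ (2 * n + 1) * |Real.sin x| := by
  have key : ∀ m : ℕ, |Real.sin (m * x)| ≤ m * |Real.sin x| := by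
    intro m
    induction m with
    | zero => simp
    | succ k ih =>
      push_cast
      rw [add_mul, one_mul, Real.sin_add]
      have h1 := abs_add_le (Real.sin (k * x) * Real.cos x) (Real.cos (k * x) * Real.sin x)
      rw [abs_mul, abs_mul] at h1
      have h2 : |Real.sin (k * x)| * |Real.cos x| ≤ |Real.sin (k * x)| :=
        mul_le_of_le_one_right (abs_nonneg _) (Real.abs_cos_le_one x)
      have h3 : |Real.cos (k * x)| * |Real.sin x| ≤ |Real.sin x| :=
        mul_le_of_le_one_left (abs_nonneg _) (Real.abs_cos_le_one _)
      linarith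
  have := key (2 * n + 1)
  push_cast at this
  exact this

lemma tail_bound (x : ℝ) (M k : ℕ) :
    |(∑ n ∈ Finset.range k, 2 * Real.sin x * (Real.sin ((2 * ((M + n : ℕ) : ℝ) + 1) * x) / (2 * ((M + n : ℕ) : ℝ) + 1)))
      + Real.cos (2 * ((M + k : ℕ) : ℝ) * x) / (2 * ((M + k : ℕ) : ℝ) + 1)|
      ≤ 2 / (2 * (M : ℝ) + 1) - 1 / (2 * ((M + k : ℕ) : ℝ) + 1) := by
  induction k with
  | zero =>
    simp only [Finset.range_zero, Finset.sum_empty, zero_add, add_zero]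
    rw [abs_div, abs_of_pos (by positivity : (0:ℝ) < 2 * (M:ℝ) + 1), ← sub_div]
    gcongr
    have := Real.abs_cos_le_one (2 * M * x)
    linarith
  | succ k ih =>
    rw [Finset.sum_range_succ]
    set A := ∑ n ∈ Finset.range k, 2 * Real.sin x * (Real.sin ((2 * ((M + n : ℕ) : ℝ) + 1) * x) / (2 * ((M + n : ℕ) : ℝ) + 1))
    set m : ℝ := ((M + k : ℕ) : ℝ) with hm
    have hm0 : 0 ≤ m := by positivity
    have e : ((M + (k + 1) : ℕ) : ℝ) = m + 1 := by rw [hm]; push_cast; ring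
    rw [e]
    have trig : 2 * Real.sin x * Real.sin ((2 * m + 1) * x) = Real.cos (2 * m * x) - Real.cos (2 * (m + 1) * x) := by
      rw [show 2 * m * x = (2 * m + 1) * x - x by ring, show 2 * (m + 1) * x = (2 * m + 1) * x + x by ring,
        Real.cos_sub, Real.cos_add]
      ring
    have hle : 1 / (2 * (m + 1) + 1) ≤ 1 / (2 * m + 1) := by gcongr; linarith
    have hc := Real.abs_cos_le_one (2 * (m + 1) * x)
    have e2 : A + 2 * Real.sin x * (Real.sin ((2 * m + 1) * x) / (2 * m + 1)) + Real.cos (2 * (m + 1) * x) / (2 * (m + 1) + 1)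
        = (A + Real.cos (2 * m * x) / (2 * m + 1)) + Real.cos (2 * (m + 1) * x) * (1 / (2 * (m + 1) + 1) - 1 / (2 * m + 1)) := by
      rw [mul_div_assoc', trig]; ring
    rw [e2]
    refine (abs_add_le _ _).trans ?_
    rw [abs_mul, abs_of_nonpos (sub_nonpos.2 hle)]
    have : |Real.cos (2 * (m + 1) * x)| * -(1 / (2 * (m + 1) + 1) - 1 / (2 * m + 1)) ≤ -(1 / (2 * (m + 1) + 1) - 1 / (2 * m + 1)) :=
      mul_le_of_le_one_left (by linarith) hc
    linarith

lemma partial_bound (x : ℝ) (N : ℕ) :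
    |∑ n ∈ Finset.range N, Real.sin ((2 * n + 1) * x) / (2 * n + 1)| ≤ 3 := by
  have hterm : ∀ n : ℕ, |Real.sin ((2 * n + 1) * x) / (2 * n + 1)| ≤ |Real.sin x| := by
    intro n
    rw [abs_div, abs_of_pos (by positivity : (0:ℝ) < 2 * (n:ℝ) + 1), div_le_iff₀ (by positivity)]
    have := abs_sin_odd x n
    linarith
  have hhead : ∀ M : ℕ, |∑ n ∈ Finset.range M, Real.sin ((2 * n + 1) * x) / (2 * n + 1)| ≤ M * |Real.sin x| := by
    intro M
    refine (Finset.abs_sum_le_sum_abs _ _).trans ?_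
    refine (Finset.sum_le_sum (fun n _ => hterm n)).trans ?_
    simp
  rcases eq_or_ne (Real.sin x) 0 with h0 | h0
  · have := hhead N
    rw [h0] at this
    simp only [abs_zero, mul_zero] at this
    linarith
  have hσ : 0 < |Real.sin x| := abs_pos.2 h0
  set M := ⌈1 / |Real.sin x|⌉₊ with hM
  have hM1 : 1 / |Real.sin x| ≤ M := Nat.le_ceil _
  have hM2 : (M : ℝ) < 1 / |Real.sin x| + 1 := Nat.ceil_lt_add_one (by positivity)
  have hMσ : M * |Real.sin x| ≤ 2 := by
    have : (M : ℝ) * |Real.sin x| ≤ (1 / |Real.sin x| + 1) * |Real.sin x| := by gcongr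
    have e : (1 / |Real.sin x| + 1) * |Real.sin x| = 1 + |Real.sin x| := by field_simp
    have := Real.abs_sin_le_one x
    linarith
  rcases le_total N M with h | h
  · refine (hhead N).trans ?_
    have : (N : ℝ) * |Real.sin x| ≤ M * |Real.sin x| := by gcongr
    linarith
  obtain ⟨k, rfl⟩ := Nat.exists_eq_add_of_le h
  rw [Finset.sum_range_add]
  refine (abs_add_le _ _).trans ?_
  have h1 := (hhead M).trans hMσ
  have h2 := tail_bound x M k
  rw [← Finset.mul_sum] at h2
  set B := ∑ n ∈ Finset.range k, (Real.sin ((2 * ((M + n : ℕ) : ℝ) + 1) * x) / (2 * ((M + n : ℕ) : ℝ) + 1))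
  set c := Real.cos (2 * ((M + k : ℕ) : ℝ) * x) / (2 * ((M + k : ℕ) : ℝ) + 1) with hc
  have hc' : |c| ≤ 1 / (2 * ((M + k : ℕ) : ℝ) + 1) := by
    rw [hc, abs_div, abs_of_pos (by positivity : (0:ℝ) < 2 * ((M + k : ℕ) : ℝ) + 1)]
    gcongr
    exact Real.abs_cos_le_one _
  have h3 : |2 * Real.sin x * B| ≤ 2 / (2 * (M : ℝ) + 1) := by
    have := abs_sub (2 * Real.sin x * B + c) c
    rw [add_sub_cancel_right] at this
    linarith
  rw [abs_mul, abs_mul, abs_two, le_div_iff₀ (by positivity)] at h3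
  have h4 : 1 ≤ M * |Real.sin x| := by rwa [div_le_iff₀ hσ] at hM1
  have hB : |B| ≤ 1 := by
    have hB0 := abs_nonneg B
    nlinarith [mul_nonneg hσ.le hB0]
  linarith

lemma odd_sum (s : ℝ) (hs0 : 0 < s) :
    ((∑' n : ℕ, (2 * (n:ℝ) + 1) ^ (-1 - s) : ℝ) : ℂ) = (1 - (2 : ℂ) ^ (-(s : ℂ) - 1)) * riemannZeta (s + 1) := by
  have hre : 1 < ((s : ℂ) + 1).re := by simp [hs0]
  have hz := zeta_eq_tsum_one_div_nat_cpow hre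
  have hsum : Summable (fun n : ℕ => 1 / (n : ℂ) ^ ((s : ℂ) + 1)) := Complex.summable_one_div_nat_cpow.2 hre
  have i1 : Function.Injective (fun n : ℕ => 2 * n) := fun a b h => by simpa using h
  have i2 : Function.Injective (fun n : ℕ => 2 * n + 1) := fun a b h => by simpa using h
  have := tsum_even_add_odd (f := fun n : ℕ => 1 / (n : ℂ) ^ ((s : ℂ) + 1)) (hsum.comp_injective i1) (hsum.comp_injective i2)
  have ev : ∀ n : ℕ, 1 / ((2 * n : ℕ) : ℂ) ^ ((s : ℂ) + 1) = (2 : ℂ) ^ (-(s : ℂ) - 1) * (1 / (n : ℂ) ^ ((s : ℂ) + 1)) := by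
    intro n
    rw [Nat.cast_mul, Complex.natCast_mul_natCast_cpow, show -(s:ℂ) - 1 = -((s:ℂ) + 1) by ring, Complex.cpow_neg]
    push_cast
    rw [one_div, one_div, mul_inv]
  simp_rw [ev] at this
  rw [tsum_mul_left, ← hz] at this
  have od : ((∑' n : ℕ, (2 * (n:ℝ) + 1) ^ (-1 - s) : ℝ) : ℂ) = ∑' n : ℕ, 1 / ((2 * n + 1 : ℕ) : ℂ) ^ ((s : ℂ) + 1) := by
    rw [Complex.ofReal_tsum]
    refine tsum_congr fun n => ?_
    rw [Complex.ofReal_cpow (by positivity)]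
    rw [one_div, ← Complex.cpow_neg]
    push_cast
    congr 1
    ring
  rw [od]
  linear_combination this

lemma int_rpow_exp (s b : ℝ) (hs : 0 < s) (hb : 0 < b) :
    IntegrableOn (fun t : ℝ => t ^ (s - 1) * Real.exp (-(b * t))) (Set.Ioi 0) := by
  have := integrableOn_rpow_mul_exp_neg_mul_rpow (p := 1) (s := s - 1) (b := b) (by linarith) one_pos hb
  simpa using this

lemma meas_cexp (s : ℝ) (r : ℂ) :
    AEStronglyMeasurable (fun t : ℝ => ((t ^ (s - 1) : ℝ) : ℂ) * Complex.exp (-(r * t)))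
      (volume.restrict (Set.Ioi 0)) := by
  refine Measurable.aestronglyMeasurable ?_
  fun_prop

lemma norm_cexp_term (s : ℝ) (r : ℂ) (t : ℝ) (ht : 0 < t) :
    ‖((t ^ (s - 1) : ℝ) : ℂ) * Complex.exp (-(r * t))‖ = t ^ (s - 1) * Real.exp (-(r.re * t)) := by
  rw [norm_mul, Complex.norm_real, Complex.norm_exp, Real.norm_of_nonneg (by positivity)]
  simp

lemma int_cexp (s : ℝ) (r : ℂ) (hs : 0 < s) (hr : 0 < r.re) :
    IntegrableOn (fun t : ℝ => ((t ^ (s - 1) : ℝ) : ℂ) * Complex.exp (-(r * t))) (Set.Ioi 0) := by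
  refine (int_rpow_exp s r.re hs hr).mono' (meas_cexp s r) ?_
  filter_upwards [ae_restrict_mem measurableSet_Ioi] with t ht
  exact (norm_cexp_term s r t ht).le

lemma gamma_complex (s : ℝ) (r : ℂ) (hs : 0 < s) (hr : 0 < r.re) :
    ∫ t in Set.Ioi (0:ℝ), ((t ^ (s - 1) : ℝ) : ℂ) * Complex.exp (-(r * t)) = (1 / r) ^ (s : ℂ) * Complex.Gamma s := by
  let U : Set ℂ := {z | 0 < z.re}
  have hU : IsOpen U := isOpen_lt continuous_const Complex.continuous_re
  have hconv : Convex ℝ U := convex_halfSpace_re_gt 0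
  have h1 : DifferentiableOn ℂ (fun r : ℂ => ∫ t in Set.Ioi (0:ℝ), ((t ^ (s - 1) : ℝ) : ℂ) * Complex.exp (-(r * t))) U := by
    intro z hz
    have hz' : 0 < z.re := hz
    refine DifferentiableAt.differentiableWithinAt ?_
    have hnb : {w : ℂ | z.re / 2 < w.re} ∈ 𝓝 z :=
      (isOpen_lt continuous_const Complex.continuous_re).mem_nhds (by simp; linarith)
    refine (hasDerivAt_integral_of_dominated_loc_of_deriv_le (bound := fun t : ℝ => t ^ ((s + 1) - 1) * Real.exp (-(z.re / 2 * t)))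
      (F' := fun r t => -((((t ^ ((s + 1) - 1) : ℝ) : ℂ)) * Complex.exp (-(r * t))))
      hnb (Eventually.of_forall fun w => meas_cexp s w) (int_cexp s z hs hz') (meas_cexp (s + 1) z).neg ?_
      (int_rpow_exp (s + 1) (z.re / 2) (by linarith) (by linarith)) ?_).2.differentiableAt
    · filter_upwards [ae_restrict_mem measurableSet_Ioi] with t ht w hw
      have ht' : 0 < t := ht
      have hw' : z.re / 2 < w.re := hw
      rw [norm_neg, norm_cexp_term _ _ _ ht]
      gcongr
    · filter_upwards [ae_restrict_mem measurableSet_Ioi] with t ht w hw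
      have ht' : 0 < t := ht
      have hd : HasDerivAt (fun r : ℂ => -(r * t)) (-(t:ℂ)) w := by
        exact (((hasDerivAt_id w).mul_const (t:ℂ)).fun_neg).congr_deriv (by simp)
      have := (hd.cexp).const_mul (((t ^ (s - 1) : ℝ) : ℂ))
      refine this.congr_deriv ?_
      rw [show s + 1 - 1 = (s - 1) + 1 by ring, Real.rpow_add_one ht'.ne']
      push_cast
      ring
  have h2 : DifferentiableOn ℂ (fun r : ℂ => (1 / r) ^ (s : ℂ) * Complex.Gamma s) U := by
    intro z hz
    have hz' : 0 < z.re := hz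
    have hz0 : z ≠ 0 := fun h => by simp [h] at hz'
    refine DifferentiableAt.differentiableWithinAt ?_
    refine DifferentiableAt.mul_const ?_ _
    refine DifferentiableAt.cpow_const (by fun_prop (disch := assumption)) ?_
    left
    rw [one_div, Complex.inv_re]
    exact div_pos hz' (Complex.normSq_pos.2 hz0)
  have hfr : ∃ᶠ z in 𝓝[≠] (1:ℂ), ∫ t in Set.Ioi (0:ℝ), ((t ^ (s - 1) : ℝ) : ℂ) * Complex.exp (-(z * t)) = (1 / z) ^ (s : ℂ) * Complex.Gamma s := by
    have ht : Tendsto (fun x : ℝ => (x : ℂ)) (𝓝[>] 1) (𝓝[≠] (1:ℂ)) := by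
      refine tendsto_nhdsWithin_iff.2 ⟨?_, ?_⟩
      · exact (Complex.continuous_ofReal.tendsto' 1 1 (by simp)).mono_left nhdsWithin_le_nhds
      · filter_upwards [self_mem_nhdsWithin] with x hx
        have : (1:ℝ) < x := hx
        simp only [Set.mem_compl_iff, Set.mem_singleton_iff]
        exact_mod_cast this.ne'
    refine ht.frequently (Eventually.frequently ?_)
    filter_upwards [self_mem_nhdsWithin] with x hx
    have hx' : (1:ℝ) < x := hx
    rw [← Complex.integral_cpow_mul_exp_neg_mul_Ioi (a := (s:ℂ)) (r := x) (by simpa using hs) (by linarith)]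
    refine setIntegral_congr_fun measurableSet_Ioi fun t ht => ?_
    have ht' : (0:ℝ) < t := ht
    rw [Complex.ofReal_cpow ht'.le]
    push_cast
    rfl
  exact (h1.analyticOnNhd hU).eqOn_of_preconnected_of_frequently_eq (h2.analyticOnNhd hU) hconv.isPreconnected
    (show (1:ℂ) ∈ U by simp [U]) hfr hr

lemma int_sin (s ε : ℝ) (hs : 0 < s) (he : 0 < ε) :
    IntegrableOn (fun t : ℝ => Real.sin t * Real.exp (-(ε * t)) * t ^ (s - 1)) (Set.Ioi 0) := by
  refine (int_rpow_exp s ε hs he).mono' (Measurable.aestronglyMeasurable (by fun_prop)) ?_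
  filter_upwards [ae_restrict_mem measurableSet_Ioi] with t ht
  have ht' : (0:ℝ) < t := ht
  rw [norm_mul, norm_mul, Real.norm_of_nonneg (by positivity : 0 ≤ t ^ (s-1)), Real.norm_of_nonneg (Real.exp_pos _).le, mul_assoc, mul_comm (t ^ (s-1))]
  exact mul_le_of_le_one_left (by positivity) (Real.abs_sin_le_one t)

lemma abel_lim (s : ℝ) (hs : 0 < s) :
    Tendsto (fun ε : ℝ => ∫ t in Set.Ioi (0:ℝ), Real.sin t * Real.exp (-(ε * t)) * t ^ (s - 1)) (𝓝[>] 0)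
      (𝓝 (Real.Gamma s * Real.sin (π * s / 2))) := by
  have h1 : Tendsto (fun ε : ℝ => ((1 / ((ε : ℂ) - Complex.I)) ^ (s : ℂ) * Complex.Gamma s).im) (𝓝[>] 0)
      (𝓝 (Real.Gamma s * Real.sin (π * s / 2))) := by
    have hI : (1 : ℂ) / (((0:ℝ) : ℂ) - Complex.I) = Complex.I := by simp
    have hc : ContinuousAt (fun ε : ℝ => ((1 / ((ε : ℂ) - Complex.I)) ^ (s : ℂ) * Complex.Gamma s).im) 0 := by
      refine Complex.continuous_im.continuousAt.comp ?_
      refine ContinuousAt.mul ?_ continuousAt_const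
      refine ContinuousAt.cpow ?_ continuousAt_const ?_
      · refine ContinuousAt.div continuousAt_const (by fun_prop) (by simp)
      · rw [hI]; simp [Complex.mem_slitPlane_iff]
    have := hc.tendsto.mono_left (nhdsWithin_le_nhds (s := Set.Ioi 0))
    convert this using 2
    rw [hI, Complex.cpow_def_of_ne_zero Complex.I_ne_zero, Complex.log_I, Complex.Gamma_ofReal,
      show (π : ℂ) / 2 * Complex.I * s = ((π * s / 2 : ℝ) : ℂ) * Complex.I by push_cast; ring,
      Complex.im_mul_ofReal, Complex.exp_ofReal_mul_I_im, mul_comm]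
  refine h1.congr' ?_
  filter_upwards [self_mem_nhdsWithin] with ε he
  have he' : (0:ℝ) < ε := he
  have hr : 0 < ((ε : ℂ) - Complex.I).re := by simpa using he'
  rw [← gamma_complex s _ hs hr]
  have := integral_im (𝕜 := ℂ) (int_cexp s _ hs hr)
  simp only [RCLike.im_to_complex] at this
  rw [← this]
  refine setIntegral_congr_fun measurableSet_Ioi fun t ht => ?_
  rw [Complex.im_ofReal_mul, show -(((ε:ℂ) - Complex.I) * t) = ((-(ε * t) : ℝ) : ℂ) + (t : ℂ) * Complex.I by push_cast; ring,
    Complex.exp_add, ← Complex.ofReal_exp, Complex.im_ofReal_mul, Complex.exp_ofReal_mul_I_im]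
  ring

lemma one_sub_cos_bounds (u : ℝ) : 0 ≤ 1 - Real.cos u ∧ 1 - Real.cos u ≤ u ^ 2 / 2 ∧ 1 - Real.cos u ≤ 2 := by
  have h1 := Real.cos_le_one u
  have h2 := Real.neg_one_le_cos u
  have h3 := Real.one_sub_sq_div_two_le_cos (x := u)
  exact ⟨by linarith, by linarith, by linarith⟩

lemma int_cos (s : ℝ) (hs0 : 0 < s) (hs1 : s < 1) :
    IntegrableOn (fun u : ℝ => (1 - Real.cos u) * u ^ (s - 2)) (Set.Ioi 0) := by
  have hm : Measurable (fun u : ℝ => (1 - Real.cos u) * u ^ (s - 2)) := by fun_prop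
  rw [← Set.Ioc_union_Ioi_eq_Ioi (zero_le_one (α := ℝ))]
  refine IntegrableOn.union ?_ ?_
  · have : IntegrableOn (fun _ : ℝ => (1:ℝ)) (Set.Ioc 0 1) := integrableOn_const (by simp)
    refine this.mono' hm.aestronglyMeasurable ?_
    filter_upwards [ae_restrict_mem measurableSet_Ioc] with u hu
    obtain ⟨h1, h2, h3⟩ := one_sub_cos_bounds u
    have hu0 : 0 < u := hu.1
    have hp : 0 ≤ u ^ (s - 2) := by positivity
    rw [Real.norm_of_nonneg (mul_nonneg h1 hp)]
    have e : u ^ 2 * u ^ (s - 2) = u ^ s := by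
      rw [← Real.rpow_natCast, ← Real.rpow_add hu0]; congr 1; push_cast; ring
    have : u ^ s ≤ 1 := Real.rpow_le_one hu0.le hu.2 hs0.le
    have : (1 - Real.cos u) * u ^ (s - 2) ≤ u ^ 2 / 2 * u ^ (s - 2) := by gcongr
    have : 0 ≤ u ^ s := by positivity
    linarith
  · have : IntegrableOn (fun u : ℝ => 2 * u ^ (s - 2)) (Set.Ioi 1) :=
      (integrableOn_Ioi_rpow_of_lt (by linarith) one_pos).const_mul 2
    refine this.mono' hm.aestronglyMeasurable ?_
    filter_upwards [ae_restrict_mem measurableSet_Ioi] with u hu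
    obtain ⟨h1, h2, h3⟩ := one_sub_cos_bounds u
    have hu0 : 0 < u := one_pos.trans hu
    have hp : 0 ≤ u ^ (s - 2) := by positivity
    rw [Real.norm_of_nonneg (mul_nonneg h1 hp)]
    gcongr

lemma bdry_deriv (s ε u : ℝ) (hu : 0 < u) :
    HasDerivAt (fun u : ℝ => (1 - Real.cos u) * Real.exp (-(ε * u)) * u ^ (s - 1))
      (Real.sin u * Real.exp (-(ε * u)) * u ^ (s - 1) - ε * ((1 - Real.cos u) * Real.exp (-(ε * u)) * u ^ (s - 1))
        - (1 - s) * ((1 - Real.cos u) * Real.exp (-(ε * u)) * u ^ (s - 2))) u := by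
  have h1 : HasDerivAt (fun u : ℝ => 1 - Real.cos u) (Real.sin u) u := by
    exact ((Real.hasDerivAt_cos u).const_sub 1).congr_deriv (by simp)
  have h2 : HasDerivAt (fun u : ℝ => Real.exp (-(ε * u))) (Real.exp (-(ε * u)) * (-ε)) u := by
    have : HasDerivAt (fun u : ℝ => -(ε * u)) (-ε) u := (((hasDerivAt_id u).const_mul ε).fun_neg).congr_deriv (by simp)
    exact this.exp
  have h3 := Real.hasDerivAt_rpow_const (x := u) (p := s - 1) (Or.inl hu.ne')
  refine ((h1.mul h2).mul h3).congr_deriv ?_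
  rw [show s - 1 - 1 = s - 2 by ring]
  simp only [Pi.mul_apply]
  ring

lemma bdry_bound (s ε u : ℝ) (he : 0 ≤ ε) (hu : 0 ≤ u) :
    |(1 - Real.cos u) * Real.exp (-(ε * u)) * u ^ (s - 1)| ≤ (1 - Real.cos u) * u ^ (s - 1) := by
  obtain ⟨h1, h2, h3⟩ := one_sub_cos_bounds u
  have hp : 0 ≤ u ^ (s - 1) := Real.rpow_nonneg hu _
  rw [abs_of_nonneg (by positivity)]
  gcongr
  refine mul_le_of_le_one_right h1 (Real.exp_le_one_iff.2 ?_)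
  have := mul_nonneg he hu
  linarith

lemma bdry_zero (s ε : ℝ) (hs0 : 0 < s) (he : 0 ≤ ε) :
    ContinuousWithinAt (fun u : ℝ => (1 - Real.cos u) * Real.exp (-(ε * u)) * u ^ (s - 1)) (Set.Ici 0) 0 := by
  unfold ContinuousWithinAt
  simp only [Real.cos_zero, sub_self, zero_mul]
  have hlim : Tendsto (fun u : ℝ => u ^ (s + 1) / 2) (𝓝[≥] 0) (𝓝 0) := by
    have : ContinuousAt (fun u : ℝ => u ^ (s + 1) / 2) 0 :=
      (Real.continuousAt_rpow_const 0 (s + 1) (Or.inr (by linarith))).div_const 2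
    have h := this.tendsto
    rw [Real.zero_rpow (by linarith), zero_div] at h
    exact h.mono_left nhdsWithin_le_nhds
  refine squeeze_zero_norm' ?_ hlim
  filter_upwards [self_mem_nhdsWithin] with u hu
  have hu' : 0 ≤ u := hu
  refine (bdry_bound s ε u he hu').trans ?_
  rcases hu'.eq_or_lt with h | h
  · rw [← h, Real.zero_rpow (by linarith : s + 1 ≠ 0)]; simp
  obtain ⟨h1, h2, h3⟩ := one_sub_cos_bounds u
  have e : u ^ 2 * u ^ (s - 1) = u ^ (s + 1) := by
    rw [← Real.rpow_natCast, ← Real.rpow_add h]; congr 1; push_cast; ring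
  have : (1 - Real.cos u) * u ^ (s - 1) ≤ u ^ 2 / 2 * u ^ (s - 1) := by gcongr
  linarith

lemma bdry_top (s ε : ℝ) (hs1 : s < 1) (he : 0 ≤ ε) :
    Tendsto (fun u : ℝ => (1 - Real.cos u) * Real.exp (-(ε * u)) * u ^ (s - 1)) atTop (𝓝 0) := by
  have hlim : Tendsto (fun u : ℝ => 2 * u ^ (s - 1)) atTop (𝓝 0) := by
    have := (tendsto_rpow_neg_atTop (by linarith : 0 < 1 - s)).const_mul 2
    rw [mul_zero] at this
    convert this using 4
    ring
  refine squeeze_zero_norm' ?_ hlim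
  filter_upwards [eventually_ge_atTop 0] with u hu
  refine (bdry_bound s ε u he hu).trans ?_
  obtain ⟨h1, h2, h3⟩ := one_sub_cos_bounds u
  gcongr

lemma int_cos_exp (s ε : ℝ) (hs0 : 0 < s) (hs1 : s < 1) (he : 0 ≤ ε) :
    IntegrableOn (fun u : ℝ => (1 - Real.cos u) * Real.exp (-(ε * u)) * u ^ (s - 2)) (Set.Ioi 0) := by
  refine (int_cos s hs0 hs1).mono' (Measurable.aestronglyMeasurable (by fun_prop)) ?_
  filter_upwards [ae_restrict_mem measurableSet_Ioi] with u hu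
  have := bdry_bound (s - 1) ε u he (le_of_lt hu)
  rwa [show s - 1 - 1 = s - 2 by ring] at this

lemma cos_exp_bound (s ε u : ℝ) (hu : 0 < u) :
    ‖(1 - Real.cos u) * Real.exp (-(ε * u)) * u ^ (s - 1)‖ ≤ 2 * (u ^ (s - 1) * Real.exp (-(ε * u))) := by
  obtain ⟨h1, h2, h3⟩ := one_sub_cos_bounds u
  rw [Real.norm_of_nonneg (by positivity), mul_comm (u ^ (s - 1)), ← mul_assoc]
  gcongr

lemma int_cos_exp' (s ε : ℝ) (hs0 : 0 < s) (he : 0 < ε) :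
    IntegrableOn (fun u : ℝ => (1 - Real.cos u) * Real.exp (-(ε * u)) * u ^ (s - 1)) (Set.Ioi 0) := by
  refine ((int_rpow_exp s ε hs0 he).const_mul 2).mono' (Measurable.aestronglyMeasurable (by fun_prop)) ?_
  filter_upwards [ae_restrict_mem measurableSet_Ioi] with u hu
  exact cos_exp_bound s ε u hu

lemma parts_eps (s ε : ℝ) (hs0 : 0 < s) (hs1 : s < 1) (he : 0 < ε) :
    (1 - s) * (∫ u in Set.Ioi (0:ℝ), (1 - Real.cos u) * Real.exp (-(ε * u)) * u ^ (s - 2)) =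
    (∫ t in Set.Ioi (0:ℝ), Real.sin t * Real.exp (-(ε * t)) * t ^ (s - 1))
      - ε * ∫ u in Set.Ioi (0:ℝ), (1 - Real.cos u) * Real.exp (-(ε * u)) * u ^ (s - 1) := by
  have i1 := int_sin s ε hs0 he
  have i2 := (int_cos_exp' s ε hs0 he).const_mul ε
  have i3 := (int_cos_exp s ε hs0 hs1 he.le).const_mul (1 - s)
  have := integral_Ioi_of_hasDerivAt_of_tendsto (bdry_zero s ε hs0 he.le) (fun u hu => bdry_deriv s ε u hu)
    ((i1.sub i2).sub i3) (bdry_top s ε hs1 he.le)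
  have i12 : IntegrableOn (fun x : ℝ => Real.sin x * Real.exp (-(ε * x)) * x ^ (s - 1) - ε * ((1 - Real.cos x) * Real.exp (-(ε * x)) * x ^ (s - 1))) (Set.Ioi 0) := i1.sub i2
  rw [integral_sub i12 i3] at this
  rw [integral_sub i1 i2, MeasureTheory.integral_const_mul, MeasureTheory.integral_const_mul] at this
  simp only [Real.cos_zero, sub_self, zero_mul] at this
  linarith

lemma cos_value (s : ℝ) (hs0 : 0 < s) (hs1 : s < 1) :
    (1 - s) * (∫ u in Set.Ioi (0:ℝ), (1 - Real.cos u) * u ^ (s - 2)) = Real.Gamma s * Real.sin (π * s / 2) := by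
  have hL : Tendsto (fun ε : ℝ => (1 - s) * ∫ u in Set.Ioi (0:ℝ), (1 - Real.cos u) * Real.exp (-(ε * u)) * u ^ (s - 2))
      (𝓝[>] 0) (𝓝 ((1 - s) * (∫ u in Set.Ioi (0:ℝ), (1 - Real.cos u) * u ^ (s - 2)))) := by
    refine Tendsto.const_mul _ ?_
    refine MeasureTheory.tendsto_integral_filter_of_dominated_convergence _ ?_ ?_ (int_cos s hs0 hs1) ?_
    · exact Eventually.of_forall fun ε => Measurable.aestronglyMeasurable (by fun_prop)
    · filter_upwards [self_mem_nhdsWithin] with ε he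
      filter_upwards [ae_restrict_mem measurableSet_Ioi] with u hu
      have := bdry_bound (s - 1) ε u (le_of_lt he) (le_of_lt hu)
      rwa [show s - 1 - 1 = s - 2 by ring] at this
    · refine Eventually.of_forall fun u => ?_
      have : Continuous (fun ε : ℝ => (1 - Real.cos u) * Real.exp (-(ε * u)) * u ^ (s - 2)) := by fun_prop
      exact (this.tendsto' 0 _ (by simp)).mono_left nhdsWithin_le_nhds
  have hE : Tendsto (fun ε : ℝ => ε * ∫ u in Set.Ioi (0:ℝ), (1 - Real.cos u) * Real.exp (-(ε * u)) * u ^ (s - 1))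
      (𝓝[>] 0) (𝓝 0) := by
    have hlim : Tendsto (fun ε : ℝ => 2 * Real.Gamma s * ε ^ (1 - s)) (𝓝[>] 0) (𝓝 0) := by
      have : ContinuousAt (fun ε : ℝ => 2 * Real.Gamma s * ε ^ (1 - s)) 0 :=
        (Real.continuousAt_rpow_const 0 (1 - s) (Or.inr (by linarith))).const_mul _
      have h := this.tendsto
      rw [Real.zero_rpow (by linarith), mul_zero] at h
      exact h.mono_left nhdsWithin_le_nhds
    refine squeeze_zero_norm' ?_ hlim
    filter_upwards [self_mem_nhdsWithin] with ε he
    have he' : 0 < ε := he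
    have hb : ‖∫ u in Set.Ioi (0:ℝ), (1 - Real.cos u) * Real.exp (-(ε * u)) * u ^ (s - 1)‖ ≤
        ∫ u in Set.Ioi (0:ℝ), 2 * (u ^ (s - 1) * Real.exp (-(ε * u))) := by
      refine norm_integral_le_of_norm_le ((int_rpow_exp s ε hs0 he').const_mul 2) ?_
      filter_upwards [ae_restrict_mem measurableSet_Ioi] with u hu
      exact cos_exp_bound s ε u hu
    rw [MeasureTheory.integral_const_mul, Real.integral_rpow_mul_exp_neg_mul_Ioi hs0 he'] at hb
    rw [norm_mul, Real.norm_of_nonneg he'.le]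
    calc _ ≤ ε * (2 * ((1 / ε) ^ s * Real.Gamma s)) := by gcongr
      _ = 2 * Real.Gamma s * ε ^ (1 - s) := by
        rw [Real.rpow_sub he', Real.rpow_one, one_div, Real.inv_rpow he'.le]
        ring
  have hR := (abel_lim s hs0).sub hE
  rw [sub_zero] at hR
  refine tendsto_nhds_unique hL (hR.congr' ?_)
  filter_upwards [self_mem_nhdsWithin] with ε he
  exact (parts_eps s ε hs0 hs1 he).symm

lemma ii_sin (s T : ℝ) (hs0 : 0 < s) : IntervalIntegrable (fun u : ℝ => Real.sin u * u ^ (s - 1)) volume 0 T :=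
  (intervalIntegral.intervalIntegrable_rpow' (by linarith)).continuousOn_mul Real.continuous_sin.continuousOn

lemma parts_fin (s T : ℝ) (hs0 : 0 < s) (hs1 : s < 1) (hT : 0 ≤ T) :
    ∫ u in (0:ℝ)..T, Real.sin u * u ^ (s - 1) =
      (1 - Real.cos T) * T ^ (s - 1) + (1 - s) * ∫ u in (0:ℝ)..T, (1 - Real.cos u) * u ^ (s - 2) := by
  have hc0 := bdry_zero s 0 hs0 le_rfl
  have hd := fun u hu => bdry_deriv s 0 u hu
  simp only [zero_mul, neg_zero, Real.exp_zero, mul_one, sub_zero] at hc0 hd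
  have i1 := ii_sin s T hs0
  have i2 : IntervalIntegrable (fun u : ℝ => (1 - s) * ((1 - Real.cos u) * u ^ (s - 2))) volume 0 T := by
    rw [intervalIntegrable_iff_integrableOn_Ioc_of_le hT]
    exact ((int_cos s hs0 hs1).mono_set Set.Ioc_subset_Ioi_self).const_mul _
  have := integral_eq_sub_of_hasDerivAt_of_le hT (f := fun u : ℝ => (1 - Real.cos u) * u ^ (s - 1)) ?_
    (fun u hu => hd u hu.1) (i1.sub i2)
  · rw [intervalIntegral.integral_sub i1 i2, intervalIntegral.integral_const_mul] at this
    simp only [Real.cos_zero, sub_self, zero_mul] at this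
    linarith
  · intro u hu
    rcases hu.1.eq_or_lt with h | h
    · subst h; exact hc0.mono Set.Icc_subset_Ici_self
    · exact (hd u h).continuousAt.continuousWithinAt

lemma G_lim (s : ℝ) (hs0 : 0 < s) (hs1 : s < 1) :
    Tendsto (fun T : ℝ => ∫ u in (0:ℝ)..T, Real.sin u * u ^ (s - 1)) atTop (𝓝 (Real.Gamma s * Real.sin (π * s / 2))) := by
  have h1 := bdry_top s 0 hs1 le_rfl
  simp only [zero_mul, neg_zero, Real.exp_zero, mul_one] at h1
  have h2 := (intervalIntegral_tendsto_integral_Ioi 0 (int_cos s hs0 hs1) tendsto_id).const_mul (1 - s)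
  rw [cos_value s hs0 hs1] at h2
  have := h1.add h2
  rw [zero_add] at this
  refine this.congr' ?_
  filter_upwards [eventually_ge_atTop 0] with T hT
  exact (parts_fin s T hs0 hs1 hT).symm

lemma G_bdd (s : ℝ) (hs0 : 0 < s) (hs1 : s < 1) :
    ∃ C : ℝ, ∀ T : ℝ, 1 ≤ T → |∫ u in (0:ℝ)..T, Real.sin u * u ^ (s - 1)| ≤ C := by
  refine ⟨2 + (1 - s) * ∫ u in Set.Ioi (0:ℝ), (1 - Real.cos u) * u ^ (s - 2), fun T hT => ?_⟩
  have hT0 : 0 < T := by linarith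
  rw [parts_fin s T hs0 hs1 hT0.le]
  obtain ⟨h1, h2, h3⟩ := one_sub_cos_bounds T
  have hp : T ^ (s - 1) ≤ 1 := Real.rpow_le_one_of_one_le_of_nonpos hT (by linarith)
  have hp0 : 0 ≤ T ^ (s - 1) := by positivity
  have hnn : ∀ u ∈ Set.Ioi (0:ℝ), 0 ≤ (1 - Real.cos u) * u ^ (s - 2) := fun u hu =>
    mul_nonneg (one_sub_cos_bounds u).1 (Real.rpow_nonneg (le_of_lt hu) _)
  have hI : ∫ u in (0:ℝ)..T, (1 - Real.cos u) * u ^ (s - 2) ≤ ∫ u in Set.Ioi (0:ℝ), (1 - Real.cos u) * u ^ (s - 2) := by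
    rw [intervalIntegral.integral_of_le hT0.le]
    refine setIntegral_mono_set (int_cos s hs0 hs1) ?_ Set.Ioc_subset_Ioi_self.eventuallyLE
    filter_upwards [ae_restrict_mem measurableSet_Ioi] with u hu using hnn u hu
  have hI0 : 0 ≤ ∫ u in (0:ℝ)..T, (1 - Real.cos u) * u ^ (s - 2) := by
    rw [intervalIntegral.integral_of_le hT0.le]
    exact setIntegral_nonneg measurableSet_Ioc fun u hu => hnn u hu.1
  have hs : 0 ≤ 1 - s := by linarith
  rw [abs_of_nonneg (by positivity)]
  have : (1 - Real.cos T) * T ^ (s - 1) ≤ 2 * 1 := by gcongr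
  have : (1 - s) * ∫ u in (0:ℝ)..T, (1 - Real.cos u) * u ^ (s - 2) ≤ (1 - s) * ∫ u in Set.Ioi (0:ℝ), (1 - Real.cos u) * u ^ (s - 2) := by
    gcongr
  linarith

lemma term_int (s T : ℝ) (n : ℕ) (hT : 0 ≤ T) :
    ∫ x in (0:ℝ)..T, Real.sin ((2 * n + 1) * x) / (2 * n + 1) * x ^ (s - 1) =
      (2 * (n:ℝ) + 1) ^ (-1 - s) * ∫ u in (0:ℝ)..((2 * n + 1) * T), Real.sin u * u ^ (s - 1) := by
  set c : ℝ := 2 * (n:ℝ) + 1 with hc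
  have hc0 : 0 < c := by positivity
  have h := intervalIntegral.integral_comp_mul_left (a := 0) (b := T) (fun u : ℝ => Real.sin u * u ^ (s - 1)) hc0.ne'
  rw [mul_zero, smul_eq_mul, eq_comm, inv_mul_eq_iff_eq_mul₀ hc0.ne'] at h
  rw [h, ← mul_assoc, ← intervalIntegral.integral_const_mul]
  refine intervalIntegral.integral_congr fun x hx => ?_
  rw [Set.uIcc_of_le hT] at hx
  rw [Real.mul_rpow hc0.le hx.1, Real.rpow_sub hc0, Real.rpow_sub hc0, Real.rpow_neg hc0.le, Real.rpow_one]
  have : c ^ s ≠ 0 := (Real.rpow_pos_of_pos hc0 s).ne'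
  field_simp

lemma sum_odd (s : ℝ) (hs0 : 0 < s) : Summable (fun n : ℕ => (2 * (n:ℝ) + 1) ^ (-1 - s)) := by
  have h := Real.summable_nat_rpow.2 (by linarith : -1 - s < -1)
  have i2 : Function.Injective (fun n : ℕ => 2 * n + 1) := fun a b h => by simpa using h
  have := h.comp_injective i2
  simpa [Function.comp_def] using this

lemma swap (s : ℝ) (hs0 : 0 < s) (f : ℝ → ℝ)
    (hf : ∀ x : ℝ, 0 < x →
      Tendsto (fun N : ℕ => ∑ n ∈ Finset.range N, Real.sin ((2 * n + 1) * x) / (2 * n + 1))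
        atTop (𝓝 (f x))) (T : ℝ) (hT : 0 ≤ T) :
    Tendsto (fun N : ℕ => ∑ n ∈ Finset.range N, (2 * (n:ℝ) + 1) ^ (-1 - s) * ∫ u in (0:ℝ)..((2 * n + 1) * T), Real.sin u * u ^ (s - 1))
      atTop (𝓝 (∫ x in (0:ℝ)..T, f x * x ^ (s - 1))) := by
  have hr : IntervalIntegrable (fun x : ℝ => x ^ (s - 1)) volume 0 T := intervalIntegral.intervalIntegrable_rpow' (by linarith)
  have key : Tendsto (fun N : ℕ => ∫ x in (0:ℝ)..T, (∑ n ∈ Finset.range N, Real.sin ((2 * n + 1) * x) / (2 * n + 1)) * x ^ (s - 1))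
      atTop (𝓝 (∫ x in (0:ℝ)..T, f x * x ^ (s - 1))) := by
    refine intervalIntegral.tendsto_integral_filter_of_dominated_convergence (fun x => 3 * x ^ (s - 1)) ?_ ?_ (hr.const_mul 3) ?_
    · exact Eventually.of_forall fun N => Measurable.aestronglyMeasurable (by fun_prop)
    · refine Eventually.of_forall fun N => Eventually.of_forall fun x hx => ?_
      rw [Set.uIoc_of_le hT] at hx
      have hp : 0 ≤ x ^ (s - 1) := Real.rpow_nonneg hx.1.le _
      rw [norm_mul, Real.norm_of_nonneg hp]
      gcongr
      exact partial_bound x N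
    · refine Eventually.of_forall fun x hx => ?_
      rw [Set.uIoc_of_le hT] at hx
      exact (hf x hx.1).mul_const _
  refine key.congr fun N => ?_
  simp_rw [Finset.sum_mul]
  rw [intervalIntegral.integral_finsetSum]
  · exact Finset.sum_congr rfl fun n _ => term_int s T n hT
  · intro n _
    exact hr.continuousOn_mul (Continuous.continuousOn (by fun_prop))

/-- For `0 < s < 1`, with `f(x) = Σ_{n=0}^∞ sin((2n+1)x)/(2n+1)`, the improper integral
`∫_0^∞ f(x) x^{s-1} dx` exists as the limit of `∫_0^T f(x) x^{s-1} dx` as `T → ∞`, and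
equals `Γ(s) sin(πs/2) (1 - 2^{-s-1}) ζ(s+1)`. -/
theorem hardy_integral (s : ℝ) (hs0 : 0 < s) (hs1 : s < 1) (f : ℝ → ℝ)
    (hf : ∀ x : ℝ, 0 < x →
      Tendsto (fun N : ℕ => ∑ n ∈ Finset.range N, Real.sin ((2 * n + 1) * x) / (2 * n + 1))
        atTop (𝓝 (f x))) :
    Tendsto (fun T : ℝ => ((∫ x in (0 : ℝ)..T, f x * x ^ (s - 1) : ℝ) : ℂ)) atTop
      (𝓝 (Complex.Gamma s * Complex.sin (π * s / 2) * (1 - (2 : ℂ) ^ (-(s : ℂ) - 1)) *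
        riemannZeta (s + 1))) := by
  obtain ⟨C, hC⟩ := G_bdd s hs0 hs1
  have hS := sum_odd s hs0
  have hbd : ∀ T : ℝ, 1 ≤ T → ∀ n : ℕ, ‖(2 * (n:ℝ) + 1) ^ (-1 - s) * ∫ u in (0:ℝ)..((2 * n + 1) * T), Real.sin u * u ^ (s - 1)‖
      ≤ (2 * (n:ℝ) + 1) ^ (-1 - s) * C := by
    intro T hT n
    have hp : 0 ≤ (2 * (n:ℝ) + 1) ^ (-1 - s) := by positivity
    rw [norm_mul, Real.norm_of_nonneg hp]
    gcongr
    refine hC _ ?_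
    have : (0:ℝ) ≤ n := by positivity
    nlinarith
  have h1 : Tendsto (fun T : ℝ => ∑' n : ℕ, (2 * (n:ℝ) + 1) ^ (-1 - s) * ∫ u in (0:ℝ)..((2 * n + 1) * T), Real.sin u * u ^ (s - 1))
      atTop (𝓝 (∑' n : ℕ, (2 * (n:ℝ) + 1) ^ (-1 - s) * (Real.Gamma s * Real.sin (π * s / 2)))) := by
    refine tendsto_tsum_of_dominated_convergence (hS.mul_right C) ?_ ?_
    · intro n
      refine Tendsto.const_mul _ ?_
      exact (G_lim s hs0 hs1).comp (tendsto_id.const_mul_atTop (by positivity : (0:ℝ) < 2 * (n:ℝ) + 1))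
    · filter_upwards [eventually_ge_atTop 1] with T hT using hbd T hT
  have h2 : Tendsto (fun T : ℝ => ∫ x in (0 : ℝ)..T, f x * x ^ (s - 1)) atTop
      (𝓝 (∑' n : ℕ, (2 * (n:ℝ) + 1) ^ (-1 - s) * (Real.Gamma s * Real.sin (π * s / 2)))) := by
    refine h1.congr' ?_
    filter_upwards [eventually_ge_atTop 1] with T hT
    have hsum := Summable.of_norm_bounded (hS.mul_right C) (hbd T hT)
    exact tendsto_nhds_unique hsum.hasSum.tendsto_sum_nat (swap s hs0 f hf T (by linarith))
  have h3 := (Complex.continuous_ofReal.tendsto _).comp h2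
  rw [tsum_mul_right, Complex.ofReal_mul, odd_sum s hs0] at h3
  have h4 : Complex.Gamma s * Complex.sin (π * s / 2) * (1 - (2 : ℂ) ^ (-(s : ℂ) - 1)) * riemannZeta (s + 1)
      = (1 - (2 : ℂ) ^ (-(s : ℂ) - 1)) * riemannZeta (s + 1) * ((Real.Gamma s * Real.sin (π * s / 2) : ℝ) : ℂ) := by
    rw [Complex.Gamma_ofReal]
    push_cast
    ring
  rw [h4]
  exact h3
end

section
/- For every complex number s with Re(s) > 1, one has ∫_0^∞ H(x) x^{s-1} dx = Γ(s) ζ(s) L(s). -/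
open Complex Real MeasureTheory

/-- The harmonic sum `H(x) = Σ_{n=1}^∞ Σ_{m=0}^∞ (-1)^m e^{-n(2m+1)x}`. -/
noncomputable def harmonicH (x : ℝ) : ℝ :=
  ∑' n : ℕ, ∑' m : ℕ, (-1 : ℝ) ^ m * Real.exp (-((n : ℝ) + 1) * (2 * m + 1) * x)

lemma beta_eq_tsum (s : ℂ) (hs : 1 < s.re) :
    dirichletBeta s = ∑' m : ℕ, (-1 : ℂ) ^ m / ((2 * m + 1 : ℝ) : ℂ) ^ s := by
  rw [dirichletBeta, DirichletCharacter.LFunction_eq_LSeries _ hs, LSeries]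
  have hinj : Function.Injective (fun m : ℕ => 2 * m + 1) := fun a b h => by
    simp only at h; omega
  rw [← hinj.tsum_eq]
  · refine tsum_congr fun m => ?_
    rw [LSeries.term_of_ne_zero (by omega)]
    have h : ZMod.χ₄ ((2 * m + 1 : ℕ) : ZMod 4) = (-1) ^ m := by
      rw [ZMod.χ₄_eq_neg_one_pow (by omega)]
      congr 1; omega
    simp only [MulChar.ringHomComp_apply, h]
    push_cast
    simp
  · intro n hn
    rcases Nat.even_or_odd n with he | ⟨k, rfl⟩
    · exfalso
      apply hn
      rcases eq_or_ne n 0 with rfl | h0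
      · simp
      rw [LSeries.term_of_ne_zero h0]
      have : ZMod.χ₄ (n : ZMod 4) = 0 := by
        rw [ZMod.χ₄_nat_eq_if_mod_four]
        simp [Nat.even_iff.mp he]
      simp [MulChar.ringHomComp_apply, this]
    · exact ⟨k, rfl⟩

lemma summable_zeta_part (σ : ℝ) (hs : 1 < σ) :
    Summable fun n : ℕ => 1 / ((n : ℝ) + 1) ^ σ := by
  have := (summable_nat_add_iff 1).mpr (Real.summable_one_div_nat_rpow.mpr hs)
  simpa using this

lemma summable_beta_part (σ : ℝ) (hs : 1 < σ) :
    Summable fun n : ℕ => 1 / (2 * (n : ℝ) + 1) ^ σ := by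
  refine Summable.of_nonneg_of_le (fun n => by positivity) (fun n => ?_) (summable_zeta_part σ hs)
  have : (n : ℝ) + 1 ≤ 2 * n + 1 := by linarith [(Nat.cast_nonneg n : (0 : ℝ) ≤ n)]
  gcongr

lemma summable_exp_part (x : ℝ) (hx : 0 < x) :
    Summable fun i : ℕ × ℕ =>
      (-1 : ℝ) ^ i.2 * Real.exp (-((i.1 : ℝ) + 1) * (2 * i.2 + 1) * x) := by
  have h1 : Summable fun n : ℕ => Real.exp (n * -x) :=
    Real.summable_exp_nat_mul_iff.mpr (by linarith)
  have h2 := h1.mul_of_nonneg h1 (fun n => (Real.exp_pos _).le) (fun n => (Real.exp_pos _).le)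
  refine Summable.of_norm_bounded h2 fun i => ?_
  rw [norm_mul, norm_pow, norm_neg, norm_one, one_pow, one_mul, Real.norm_eq_abs, Real.abs_exp,
    ← Real.exp_add]
  apply Real.exp_le_exp.mpr
  have ha : (0 : ℝ) ≤ i.1 := Nat.cast_nonneg _
  have hb : (0 : ℝ) ≤ i.2 := Nat.cast_nonneg _
  have hab := mul_nonneg ha hb
  have : (i.1 + i.2 : ℝ) * x ≤ (((i.1 : ℝ) + 1) * (2 * i.2 + 1)) * x := by
    apply mul_le_mul_of_nonneg_right _ hx.le
    nlinarith
  linarith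

/-- For `Re(s) > 1`, `∫_0^∞ H(x) x^{s-1} dx = Γ(s) ζ(s) L(s)`. -/
theorem harmonic_mellin (s : ℂ) (hs : 1 < s.re) :
    ∫ x in Set.Ioi (0 : ℝ), (harmonicH x : ℂ) * (x : ℂ) ^ (s - 1) =
      Complex.Gamma s * riemannZeta s * dirichletBeta s := by
  have key := hasSum_mellin (ι := ℕ × ℕ) (a := fun i => (-1) ^ i.2)
    (p := fun i => ((i.1 : ℝ) + 1) * (2 * i.2 + 1)) (F := fun x => (harmonicH x : ℂ)) (s := s)
    (fun i => Or.inr (by positivity)) (by linarith) ?_ ?_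
  · have hL : ∫ x in Set.Ioi (0 : ℝ), (harmonicH x : ℂ) * (x : ℂ) ^ (s - 1) =
        mellin (fun x => (harmonicH x : ℂ)) s := by
      simp only [mellin, smul_eq_mul, mul_comm]
    rw [hL, ← key.tsum_eq, beta_eq_tsum s hs, zeta_eq_tsum_one_div_nat_add_one_cpow hs, mul_assoc,
      tsum_mul_tsum_of_summable_norm, ← tsum_mul_left]
    · refine tsum_congr fun i => ?_
      rw [ofReal_mul, mul_cpow_ofReal_nonneg (by positivity) (by positivity)]
      push_cast
      ring
    · refine (summable_zeta_part _ hs).congr fun n => ?_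
      have := Complex.norm_cpow_eq_rpow_re_of_pos (x := (n : ℝ) + 1) (by positivity) s
      push_cast at this
      rw [norm_div, norm_one, this]
    · refine (summable_beta_part _ hs).congr fun n => ?_
      rw [norm_div, Complex.norm_cpow_eq_rpow_re_of_pos (by positivity)]
      simp
  · intro t ht
    have h := summable_exp_part t ht
    have h2 := h.hasSum
    rw [h.tsum_prod] at h2
    have h3 := Complex.hasSum_ofReal.mpr h2
    convert h3 using 1
    · funext i
      push_cast
      ring_nf
    · rfl
  · refine ((summable_zeta_part _ hs).mul_of_nonneg (summable_beta_part _ hs)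
      (fun n => by positivity) (fun n => by positivity)).congr fun i => ?_
    rw [Real.mul_rpow (by positivity) (by positivity)]
    simp [mul_comm]
end

section
/- For every real x > 0, one has H(x) = π/(4x) - 1/4 + (π/x) H(π²/x). -/
open Real

open MeasureTheory Filter Asymptotics FourierTransform in
/-- The Beta integral after the logistic substitution. -/
lemma integral_exp_mul_sigmoid (s : ℂ) (h0 : 0 < s.re) (h1 : s.re < 1) :
    ∫ u : ℝ, Complex.exp (u * s) * ((1 - Real.sigmoid u : ℝ) : ℂ) =
      π / Complex.sin (π * s) := by
  have hB := Complex.Gamma_mul_Gamma_eq_betaIntegral (s := s) (t := 1 - s) h0 (by simpa using h1)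
  rw [Complex.Gamma_mul_Gamma_one_sub, add_sub_cancel, Complex.Gamma_one, one_mul] at hB
  rw [hB, Complex.betaIntegral, intervalIntegral.integral_of_le zero_le_one,
    integral_Ioc_eq_integral_Ioo, ← Real.range_sigmoid, ← Set.image_univ,
    integral_image_eq_integral_abs_deriv_smul MeasurableSet.univ
      (fun x _ => (Real.hasDerivAt_sigmoid x).hasDerivWithinAt)
      Real.sigmoid_injective.injOn, setIntegral_univ]
  congr 1 with u
  have hp := Real.sigmoid_pos u
  have hq : 0 < 1 - Real.sigmoid u := by linarith [Real.sigmoid_lt_one u]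
  have hl : Real.log (1 - Real.sigmoid u) = Real.log (Real.sigmoid u) - u := by
    rw [← Real.sigmoid_neg, ← Real.sigmoid_mul_rexp_neg, Real.log_mul hp.ne' (Real.exp_pos _).ne',
      Real.log_exp]; ring
  rw [abs_of_pos (mul_pos hp hq), Complex.real_smul]
  have e1 : ((1 : ℂ) - (Real.sigmoid u : ℂ)) = ((1 - Real.sigmoid u : ℝ) : ℂ) := by push_cast; ring
  rw [e1, Complex.cpow_def_of_ne_zero (by exact_mod_cast hp.ne'),
    Complex.cpow_def_of_ne_zero (by exact_mod_cast hq.ne'),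
    ← Complex.ofReal_log hp.le, ← Complex.ofReal_log hq.le, hl]
  have e2 : ((Real.sigmoid u * (1 - Real.sigmoid u) : ℝ) : ℂ)
      = Complex.exp (Real.log (Real.sigmoid u) : ℝ) * ((1 - Real.sigmoid u : ℝ) : ℂ) := by
    rw [← Complex.ofReal_exp, Real.exp_log hp]; push_cast; ring
  rw [e2]
  calc _ = Complex.exp ((Real.log (Real.sigmoid u) : ℝ) +
        ((Real.log (Real.sigmoid u) : ℝ) * (s - 1) +
          ((Real.log (Real.sigmoid u) - u : ℝ) : ℂ) * (1 - s - 1)))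
        * ((1 - Real.sigmoid u : ℝ) : ℂ) := by
        congr 2; push_cast; ring
    _ = _ := by rw [Complex.exp_add, Complex.exp_add]; ring

open MeasureTheory FourierTransform in
lemma fourier_sech (x : ℝ) (hx : 0 < x) (w : ℝ) :
    𝓕 (fun t : ℝ => (((Real.cosh (x * t))⁻¹ : ℝ) : ℂ)) w =
      (((π / x) * (Real.cosh (π ^ 2 / x * w))⁻¹ : ℝ) : ℂ) := by
  rw [Real.fourier_real_eq_integral_exp_smul]
  have hx' : (x : ℂ) ≠ 0 := by exact_mod_cast hx.ne'
  have hB := integral_exp_mul_sigmoid (1 / 2 - π * w / x * Complex.I)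
    (by simp [← Complex.ofReal_mul, ← Complex.ofReal_div])
    (by simp [← Complex.ofReal_mul, ← Complex.ofReal_div]; norm_num)
  have hC := Measure.integral_comp_mul_left (fun u : ℝ =>
    Complex.exp (u * (1 / 2 - π * w / x * Complex.I)) * ((1 - Real.sigmoid u : ℝ) : ℂ)) (2 * x)
  rw [hB] at hC
  have e : ∀ t : ℝ, Complex.exp (↑(-2 * π * t * w) * Complex.I) •
      (((Real.cosh (x * t))⁻¹ : ℝ) : ℂ) = 2 * (Complex.exp ((2 * x * t : ℝ) *
        (1 / 2 - π * w / x * Complex.I)) * ((1 - Real.sigmoid (2 * x * t) : ℝ) : ℂ)) := by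
    intro t
    have a1 : ((2 * x * t : ℝ) : ℂ) * (1 / 2 - π * w / x * Complex.I) =
        ((x * t : ℝ) : ℂ) + (↑(-2 * π * t * w) * Complex.I) := by
      push_cast; field_simp; ring
    have a2 : (Real.cosh (x * t))⁻¹ =
        2 * Real.exp (x * t) * (1 - Real.sigmoid (2 * x * t)) := by
      rw [← Real.sigmoid_neg, Real.sigmoid_def, Real.cosh_eq, neg_neg,
        show 2 * x * t = x * t + x * t by ring, Real.exp_add, Real.exp_neg]
      have := Real.exp_pos (x * t)
      field_simp
      ring
    rw [a1, Complex.exp_add, a2, smul_eq_mul, ← Complex.ofReal_exp]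
    push_cast; ring
  simp_rw [e]
  rw [integral_const_mul, hC]
  have a3 : (π : ℂ) * (1 / 2 - π * w / x * Complex.I) =
      π / 2 - ((π ^ 2 / x * w : ℝ) : ℂ) * Complex.I := by
    push_cast; field_simp
  rw [a3, Complex.sin_pi_div_two_sub, Complex.cos_mul_I, ← Complex.ofReal_cosh,
    abs_of_pos (by positivity), Complex.real_smul]
  push_cast
  have : Complex.cosh (π ^ 2 / x * w) ≠ 0 := by
    have := (Real.cosh_pos (π ^ 2 / x * w)).ne'
    exact_mod_cast this
  field_simp

open Filter Asymptotics in
lemma sech_decay (c x : ℝ) (hx : 0 < x) :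
    (fun t : ℝ => ((c * (Real.cosh (x * t))⁻¹ : ℝ) : ℂ)) =O[cocompact ℝ]
      (fun t => |t| ^ (-2 : ℝ)) := by
  refine IsBigO.of_bound (|c| * (2 / x ^ 2)) ?_
  have : ({0}ᶜ : Set ℝ) ∈ cocompact ℝ := isCompact_singleton.compl_mem_cocompact
  filter_upwards [this] with t ht
  have ht : t ≠ 0 := ht
  have h1 : (x * t) ^ 2 / 2 ≤ Real.cosh (x * t) := by
    have h2 : |x * t / 2| ≤ Real.sinh |x * t / 2| := Real.self_le_sinh_iff.2 (abs_nonneg _)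
    have h3 : Real.cosh (x * t) = 1 + 2 * Real.sinh |x * t / 2| ^ 2 := by
      have := Real.cosh_two_mul |x * t / 2|
      rw [Real.cosh_sq, ← Real.cosh_abs, abs_mul, abs_abs, ← abs_mul, Real.cosh_abs] at this
      rw [show x * t = 2 * (x * t / 2) by ring, this]
      ring_nf
    have h4 := pow_le_pow_left₀ (abs_nonneg _) h2 2
    rw [sq_abs] at h4
    rw [h3]; nlinarith
  rw [Complex.norm_real, norm_mul, Real.norm_eq_abs, Real.norm_eq_abs, Real.norm_eq_abs,
    abs_of_pos (inv_pos.2 (Real.cosh_pos _)), abs_of_nonneg (Real.rpow_nonneg (abs_nonneg t) _), mul_assoc]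
  have h5 : |t| ^ (-2 : ℝ) = (t ^ 2)⁻¹ := by
    rw [Real.rpow_neg (abs_nonneg _), Real.rpow_two, sq_abs]
  rw [h5]
  refine mul_le_mul_of_nonneg_left ?_ (abs_nonneg _)
  have := inv_anti₀ (by positivity) h1
  refine this.trans (le_of_eq ?_)
  field_simp

open Filter Asymptotics in
lemma summable_sech (x : ℝ) (hx : 0 < x) :
    Summable (fun n : ℤ => (Real.cosh (x * n))⁻¹) := by
  have h := summable_of_isBigO (Real.summable_abs_int_rpow one_lt_two)
    ((sech_decay 1 x hx).comp_tendsto Int.tendsto_coe_cofinite)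
  have h2 := (Complex.summable_ofReal (f := fun n : ℤ => 1 * (Real.cosh (x * n))⁻¹)).1 h
  simpa using h2

lemma harmonicH_eq (x : ℝ) (hx : 0 < x) :
    ∑' n : ℤ, (Real.cosh (x * n))⁻¹ = 1 + 4 * harmonicH x := by
  rw [tsum_int_eq_zero_add_two_mul_tsum_pnat (fun n => by simp) (summable_sech x hx),
    tsum_pnat_eq_tsum_succ (f := fun n : ℕ => (Real.cosh (x * ((n : ℤ) : ℝ)))⁻¹)]
  have : harmonicH x = ∑' n : ℕ, 2⁻¹ * (Real.cosh (x * (((n + 1 : ℕ) : ℤ) : ℝ)))⁻¹ := by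
    unfold harmonicH
    congr 1 with n
    set y := x * (((n + 1 : ℕ) : ℤ) : ℝ) with hy
    have hy0 : 0 < y := by rw [hy]; push_cast; positivity
    have e : ∀ m : ℕ, (-1 : ℝ) ^ m * Real.exp (-((n : ℝ) + 1) * (2 * m + 1) * x) =
        Real.exp (-y) * (-Real.exp (-2 * y)) ^ m := by
      intro m
      rw [neg_pow (Real.exp (-2 * y)), ← Real.exp_nat_mul, mul_left_comm, ← Real.exp_add]
      congr 2; rw [hy]; push_cast; ring
    simp_rw [e]
    rw [tsum_mul_left, tsum_geometric_of_abs_lt_one]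
    · rw [Real.cosh_eq, show -2 * y = -y + -y by ring, Real.exp_add, Real.exp_neg]
      have := Real.exp_pos y
      rw [sub_neg_eq_add]
      have h2 : 1 + Real.exp y ^ 2 ≠ 0 := by positivity
      have h3 : (1 + (Real.exp y)⁻¹ * (Real.exp y)⁻¹) =
          (1 + Real.exp y ^ 2) / Real.exp y ^ 2 := by field_simp; ring
      have h4 : (Real.exp y + (Real.exp y)⁻¹) / 2 =
          (1 + Real.exp y ^ 2) / (2 * Real.exp y) := by field_simp; ring
      rw [h3, h4]
      field_simp
    · rw [abs_neg, abs_of_pos (Real.exp_pos _), Real.exp_lt_one_iff]; linarith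
  rw [this, tsum_mul_left]
  simp
  ring

/-- For every real `x > 0`, `H(x) = π/(4x) - 1/4 + (π/x) H(π²/x)`. -/
theorem harmonicH_transformation (x : ℝ) (hx : 0 < x) :
    harmonicH x = π / (4 * x) - 1 / 4 + (π / x) * harmonicH (π ^ 2 / x) := by
  have hx2 : 0 < π ^ 2 / x := by positivity
  have hF := funext (fourier_sech x hx)
  have P := Real.tsum_eq_tsum_fourier_of_rpow_decay
    (f := fun t : ℝ => (((Real.cosh (x * t))⁻¹ : ℝ) : ℂ))
    (by
      refine Complex.continuous_ofReal.comp (Continuous.inv₀ (by fun_prop) ?_)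
      exact fun t => (Real.cosh_pos _).ne')
    one_lt_two (by simpa using sech_decay 1 x hx)
    (by rw [hF]; exact sech_decay _ _ hx2) 0
  rw [hF] at P
  simp only [zero_add, QuotientAddGroup.mk_zero, fourier_eval_zero, mul_one] at P
  rw [← Complex.ofReal_tsum, ← Complex.ofReal_tsum, Complex.ofReal_inj, tsum_mul_left,
    harmonicH_eq x hx, harmonicH_eq _ hx2] at P
  have : π / (4 * x) = π / x / 4 := by field_simp
  rw [this]; linarith
end

section
/- For every complex number s with Re(s) > 0 and s ≠ 1, one has Γ(s) π^{-s} ζ(s) L(s) = 1/(4 s (s-1)) + ∫_π^∞ H(x) ((x/π)^s + (x/π)^{1-s}) x^{-1} dx. -/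
open Complex Real MeasureTheory

lemma aux_sech_beta (ξ : ℝ) :
    ∫ y : ℝ, Complex.exp (((-ξ * y : ℝ) : ℂ) * I) * ((1 / (2 * Real.cosh (y / 2)) : ℝ) : ℂ)
      = ((π / Real.cosh (π * ξ) : ℝ) : ℂ) := by
  have hu : (0:ℝ) < (1 / 2 - ξ * I : ℂ).re := by simp
  have hv : (0:ℝ) < (1 / 2 + ξ * I : ℂ).re := by simp
  have h1 := Complex.Gamma_mul_Gamma_eq_betaIntegral hu hv
  have h2 := Complex.Gamma_mul_Gamma_one_sub (1 / 2 - ξ * I)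
  have e1 : (1 - (1 / 2 - ξ * I) : ℂ) = 1 / 2 + ξ * I := by ring
  have e2 : ((1 / 2 - ξ * I) + (1 / 2 + ξ * I) : ℂ) = 1 := by ring
  rw [e1, h1, e2, Complex.Gamma_one, one_mul] at h2
  have e3 : Complex.sin (π * (1 / 2 - ξ * I)) = ((Real.cosh (π * ξ) : ℝ) : ℂ) := by
    have : (π * (1 / 2 - ξ * I) : ℂ) = π / 2 - ((π * ξ : ℝ) : ℂ) * I := by push_cast; ring
    rw [this, Complex.sin_pi_div_two_sub, Complex.cos_mul_I, Complex.ofReal_cosh]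
  rw [e3] at h2
  rw [Complex.ofReal_div, ← h2, Complex.betaIntegral, intervalIntegral.integral_of_le zero_le_one,
    integral_Ioc_eq_integral_Ioo, ← Real.range_sigmoid, ← Set.image_univ,
    integral_image_eq_integral_abs_deriv_smul MeasurableSet.univ
      (fun x _ => (Real.hasDerivAt_sigmoid x).hasDerivWithinAt)
      (Real.sigmoid_injective.injOn), setIntegral_univ]
  congr 1
  ext y
  have hp : 0 < Real.sigmoid y := Real.sigmoid_pos y
  have hq : 0 < 1 - Real.sigmoid y := by linarith [Real.sigmoid_lt_one y]
  rw [abs_of_pos (mul_pos hp hq)]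
  set a := Real.log (Real.sigmoid y) with ha
  have hσ : Real.sigmoid y = Real.exp a := (Real.exp_log hp).symm
  have hσ2 : 1 - Real.sigmoid y = Real.exp (a - y) := by
    rw [Real.exp_sub, ← hσ, Real.sigmoid_def, Real.exp_neg]
    have := Real.exp_pos y
    field_simp
    ring
  have hc : (1 / (2 * Real.cosh (y / 2)) : ℝ) = Real.exp (a - y / 2) := by
    rw [Real.exp_sub, ← hσ, Real.sigmoid_def, Real.cosh_eq, Real.exp_neg, Real.exp_neg]
    have h := Real.exp_pos (y/2)
    have : Real.exp y = Real.exp (y/2) * Real.exp (y/2) := by rw [← Real.exp_add]; ring_nf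
    rw [this]
    field_simp
  have hσ2c : (1 - (Real.sigmoid y : ℂ)) = ((Real.exp (a - y) : ℝ) : ℂ) := by
    rw [← hσ2]; push_cast; ring
  have cp : ∀ (r : ℝ) (z : ℂ), ((Real.exp r : ℝ) : ℂ) ^ z = Complex.exp (r * z) := by
    intro r z
    rw [Complex.cpow_def_of_ne_zero (by exact_mod_cast (Real.exp_pos r).ne'),
      ← Complex.ofReal_log (Real.exp_pos r).le, Real.log_exp]
  rw [hc, hσ2, hσ2c, hσ, cp, cp, Complex.real_smul]
  push_cast
  simp only [← Complex.exp_add]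
  congr 1
  ring

lemma aux_fourier_sech {t : ℝ} (ht : 0 < t) (w : ℝ) :
    FourierTransform.fourier (fun x : ℝ => ((1 / Real.cosh (π * t * x) : ℝ) : ℂ)) w
      = ((1 / t * (1 / Real.cosh (π * (w / t))) : ℝ) : ℂ) := by
  have h := aux_sech_beta (w / t)
  rw [Real.fourier_real_eq_integral_exp_smul]
  have h2 := Measure.integral_comp_mul_left (fun y : ℝ =>
    Complex.exp (((-(w/t) * y : ℝ) : ℂ) * I) * ((1 / (2 * Real.cosh (y / 2)) : ℝ) : ℂ)) (2 * π * t)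
  rw [h] at h2
  have hpi := Real.pi_pos
  have : ∀ v : ℝ, Complex.exp (((-2 * π * v * w : ℝ) : ℂ) * I) • ((1 / Real.cosh (π * t * v) : ℝ) : ℂ)
     = 2 * (Complex.exp (((-(w/t) * (2 * π * t * v) : ℝ) : ℂ) * I) * ((1 / (2 * Real.cosh ((2 * π * t * v) / 2)) : ℝ) : ℂ)) := by
    intro v
    have e1 : (-2 * π * v * w : ℝ) = -(w/t) * (2 * π * t * v) := by field_simp
    have e2 : (2 * π * t * v) / 2 = π * t * v := by ring
    rw [e1, e2, smul_eq_mul]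
    have := Real.cosh_pos (π * t * v)
    push_cast
    field_simp
  simp_rw [this]
  rw [integral_const_mul, h2, abs_of_pos (by positivity), Complex.real_smul]
  have := Real.cosh_pos (π * (w/t))
  push_cast
  have hpc : (π : ℂ) ≠ 0 := by exact_mod_cast hpi.ne'
  have htc : (t : ℂ) ≠ 0 := by exact_mod_cast ht.ne'
  field_simp

lemma aux_sech_decay {c : ℝ} (hc : 0 < c) :
    (fun x : ℝ => ((1 / Real.cosh (c * x) : ℝ) : ℂ)) =O[Filter.cocompact ℝ] (fun x => |x| ^ (-(2:ℝ))) := by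
  refine Asymptotics.IsBigO.of_bound (4 / c ^ 2) ?_
  have : ∀ᶠ x : ℝ in Filter.cocompact ℝ, x ≠ 0 := by
    have := (isCompact_singleton (x := (0:ℝ))).compl_mem_cocompact
    filter_upwards [this] with x hx using hx
  filter_upwards [this] with x hx
  have h1 : (c * x) ^ 2 / 4 ≤ Real.cosh (c * x) := by
    rw [← Real.cosh_abs, ← sq_abs]
    have h := Real.quadratic_le_exp_of_nonneg (abs_nonneg (c * x))
    have h3 := Real.exp_pos (-|c * x|)
    rw [Real.cosh_eq]
    have := abs_nonneg (c * x)
    nlinarith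
  have hp := Real.cosh_pos (c * x)
  rw [Complex.norm_real, Real.norm_of_nonneg (by positivity), Real.norm_of_nonneg (by positivity),
    Real.rpow_neg (abs_nonneg x), Real.rpow_two, sq_abs]
  have : 0 < x ^ 2 := by positivity
  rw [div_le_iff₀ hp]
  calc (1:ℝ) = 4 / c ^ 2 * (x ^ 2)⁻¹ * ((c * x) ^ 2 / 4) := by field_simp
    _ ≤ _ := by gcongr

lemma aux_poisson {t : ℝ} (ht : 0 < t) :
    ∑' n : ℤ, 1 / Real.cosh (π * t * n) = 1 / t * ∑' n : ℤ, 1 / Real.cosh (π * (1 / t) * n) := by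
  have hpi := Real.pi_pos
  have hF : FourierTransform.fourier (fun x : ℝ => ((1 / Real.cosh (π * t * x) : ℝ) : ℂ)) =
    fun w => ((1 / t : ℝ) : ℂ) * ((1 / Real.cosh (π * (1 / t) * w) : ℝ) : ℂ) := by
    ext w
    rw [aux_fourier_sech ht, ← Complex.ofReal_mul]
    have : π * (w / t) = π * (1 / t) * w := by ring
    rw [this]
  have := Real.tsum_eq_tsum_fourier_of_rpow_decay
    (f := fun x : ℝ => ((1 / Real.cosh (π * t * x) : ℝ) : ℂ)) ?_ one_lt_two
    (aux_sech_decay (by positivity)) ?_ 0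
  · rw [hF] at this
    simp only [zero_add, QuotientAddGroup.mk_zero, fourier_eval_zero, mul_one, tsum_mul_left] at this
    exact_mod_cast this
  · refine Complex.continuous_ofReal.comp (Continuous.div continuous_const (by fun_prop) fun x => (Real.cosh_pos _).ne')
  · rw [hF]
    exact (aux_sech_decay (by positivity)).const_mul_left _

lemma aux_summable_int {t : ℝ} (ht : 0 < t) :
    Summable fun n : ℤ => 1 / Real.cosh (π * t * n) := by
  have h := (aux_sech_decay (c := π * t) (by positivity)).comp_tendsto Int.tendsto_coe_cofinite
  have h2 := summable_of_isBigO (Real.summable_abs_int_rpow one_lt_two) h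
  have h3 := h2.norm
  refine h3.congr fun n => ?_
  have := Real.cosh_pos (π * t * n)
  simp only [Function.comp]
  rw [Complex.norm_real, Real.norm_of_nonneg (by positivity)]

lemma aux_inner {y : ℝ} (hy : 0 < y) :
    ∑' m : ℕ, (-1 : ℝ) ^ m * Real.exp (-y * (2 * m + 1)) = 1 / (2 * Real.cosh y) := by
  have hlt : Real.exp (-(2 * y)) < 1 := Real.exp_lt_one_iff.mpr (by linarith)
  have hpos := Real.exp_pos (-(2 * y))
  have : ∀ m : ℕ, (-1 : ℝ) ^ m * Real.exp (-y * (2 * m + 1)) =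
      Real.exp (-y) * (-Real.exp (-(2 * y))) ^ m := by
    intro m
    rw [neg_pow (Real.exp _), ← Real.exp_nat_mul, mul_left_comm, ← Real.exp_add]
    ring_nf
  simp_rw [this]
  rw [tsum_mul_left, tsum_geometric_of_norm_lt_one (by rw [norm_neg, Real.norm_of_nonneg hpos.le]; exact hlt),
    Real.cosh_eq, Real.exp_neg, Real.exp_neg, two_mul, Real.exp_add]
  have := Real.exp_pos y
  rw [sub_neg_eq_add]
  field_simp

lemma aux_harmonicH_eq {x : ℝ} (hx : 0 < x) :
    harmonicH x = ∑' n : ℕ, 1 / (2 * Real.cosh ((n + 1) * x)) := by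
  unfold harmonicH
  congr 1
  ext n
  rw [← aux_inner (y := (n + 1) * x) (by positivity)]
  congr 1
  ext m
  ring_nf

lemma aux_theta {t : ℝ} (ht : 0 < t) :
    ∑' n : ℤ, 1 / Real.cosh (π * t * n) = 1 + 4 * harmonicH (π * t) := by
  have hs := aux_summable_int ht
  rw [tsum_int_eq_zero_add_two_mul_tsum_pnat (fun n => by simp) hs, aux_harmonicH_eq (by positivity),
    tsum_pnat_eq_tsum_succ (f := fun n : ℕ => 1 / Real.cosh (π * t * ((n : ℤ) : ℝ)))]
  have : ∀ n : ℕ, 1 / (2 * Real.cosh ((n + 1) * (π * t))) = 1 / 2 * (1 / Real.cosh (π * t * (((n + 1 : ℕ) : ℤ) : ℝ))) := by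
    intro n
    push_cast
    rw [mul_comm (n + 1 : ℝ)]
    field_simp
  simp_rw [this, tsum_mul_left]
  simp
  ring

lemma aux_FE {t : ℝ} (ht : 0 < t) :
    1 + 4 * harmonicH (π * (1 / t)) = t * (1 + 4 * harmonicH (π * t)) := by
  rw [← aux_theta ht, ← aux_theta (t := 1 / t) (by positivity), aux_poisson ht]
  field_simp

lemma aux_summable_prod {t : ℝ} (ht : 0 < t) :
    Summable fun p : ℕ × ℕ => (-1 : ℝ) ^ p.2 * Real.exp (-π * (((p.1 : ℝ) + 1) * (2 * p.2 + 1)) * t) := by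
  have hpi := Real.pi_pos
  have hlt : Real.exp (-(π * t)) < 1 := Real.exp_lt_one_iff.mpr (by nlinarith)
  have hg := summable_geometric_of_lt_one (Real.exp_pos _).le hlt
  have := summable_mul_of_summable_norm hg.norm hg.norm
  refine Summable.of_norm_bounded this fun p => ?_
  rw [norm_mul, norm_pow, norm_neg, norm_one, one_pow, one_mul, Real.norm_of_nonneg (Real.exp_pos _).le,
    ← Real.exp_nat_mul, ← Real.exp_nat_mul, ← Real.exp_add, Real.exp_le_exp]
  have : ((p.1 : ℝ) + p.2) ≤ ((p.1 : ℝ) + 1) * (2 * p.2 + 1) := by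
    have : (0 : ℝ) ≤ p.1 * p.2 := by positivity
    have : (0 : ℝ) ≤ p.2 := by positivity
    linarith
  have hpt : 0 < π * t := by positivity
  nlinarith

lemma aux_hasSum_prod {t : ℝ} (ht : 0 < t) :
    HasSum (fun p : ℕ × ℕ => (-1 : ℝ) ^ p.2 * Real.exp (-π * (((p.1 : ℝ) + 1) * (2 * p.2 + 1)) * t))
      (harmonicH (π * t)) := by
  have h := aux_summable_prod ht
  rw [h.hasSum_iff, h.tsum_prod]
  unfold harmonicH
  congr 1; ext n; congr 1; ext m
  ring_nf

lemma aux_summable_sech {x : ℝ} (hx : 0 < x) :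
    Summable fun n : ℕ => 1 / (2 * Real.cosh ((n + 1) * x)) := by
  have h := (aux_summable_int (t := x / π) (by positivity))
  have h2 := (h.comp_injective (i := fun n : ℕ => ((n : ℤ) + 1)) (fun a b h => by simpa using h)).mul_left (1 / 2)
  refine h2.congr fun n => ?_
  simp only [Function.comp]
  have : π * (x / π) = x := by field_simp
  push_cast
  rw [this, mul_comm x]
  field_simp

lemma aux_antitone : AntitoneOn harmonicH (Set.Ioi 0) := by
  intro a ha b hb hab
  rw [aux_harmonicH_eq ha, aux_harmonicH_eq hb]
  refine (aux_summable_sech hb).tsum_le_tsum (fun n => ?_) (aux_summable_sech ha)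
  have := Real.cosh_pos ((n + 1) * a)
  have haP : 0 < a := ha
  have hbP : 0 < b := hb
  gcongr 1 / (2 * ?_)
  rw [Real.cosh_le_cosh, abs_of_pos (by positivity), abs_of_pos (by positivity)]
  gcongr

lemma aux_nonneg {x : ℝ} (hx : 0 < x) : 0 ≤ harmonicH x := by
  rw [aux_harmonicH_eq hx]
  refine tsum_nonneg fun n => ?_
  have := Real.cosh_pos ((n + 1) * x)
  positivity

lemma aux_locInt : LocallyIntegrableOn (fun t : ℝ => (harmonicH (π * t) : ℂ)) (Set.Ioi 0) := by
  rw [locallyIntegrableOn_iff isOpen_Ioi.isLocallyClosed]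
  intro k hk hkc
  refine Integrable.ofReal (f := fun t => harmonicH (π * t)) ?_
  refine AntitoneOn.integrableOn_isCompact hkc ?_
  intro a ha b hb hab
  have hpi := Real.pi_pos
  have haP : 0 < a := hk ha
  have hbP : 0 < b := hk hb
  exact aux_antitone (by simp; positivity) (by simp; positivity) (by gcongr)

lemma aux_bound {t : ℝ} (ht : 1 ≤ t) :
    harmonicH (π * t) ≤ Real.exp (-(π * t)) * (1 - Real.exp (-π))⁻¹ := by
  have hpi := Real.pi_pos
  have ht0 : 0 < t := by linarith
  have hlt : Real.exp (-π) < 1 := Real.exp_lt_one_iff.mpr (by linarith)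
  rw [aux_harmonicH_eq (by positivity), ← tsum_geometric_of_lt_one (Real.exp_pos _).le hlt, ← tsum_mul_left]
  refine (aux_summable_sech (by positivity)).tsum_le_tsum (fun n => ?_)
    ((summable_geometric_of_lt_one (Real.exp_pos _).le hlt).mul_left _)
  have hc : Real.exp ((n + 1) * (π * t)) ≤ 2 * Real.cosh ((n + 1) * (π * t)) := by
    rw [Real.cosh_eq]; linarith [Real.exp_pos (-((n + 1) * (π * t)))]
  calc 1 / (2 * Real.cosh ((n + 1) * (π * t))) ≤ 1 / Real.exp ((n + 1) * (π * t)) :=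
        one_div_le_one_div_of_le (Real.exp_pos _) hc
    _ = Real.exp (-((n + 1) * (π * t))) := by rw [Real.exp_neg, one_div]
    _ ≤ _ := by
      rw [← Real.exp_nat_mul, ← Real.exp_add, Real.exp_le_exp]
      have : (0 : ℝ) ≤ n * π * (t - 1) := by
        have : 0 ≤ t - 1 := by linarith
        positivity
      nlinarith

lemma aux_decay (r : ℝ) :
    (fun t : ℝ => (harmonicH (π * t) : ℂ)) =O[Filter.atTop] (fun t : ℝ => t ^ r) := by
  have h1 : (fun t : ℝ => (harmonicH (π * t) : ℂ)) =O[Filter.atTop] (fun t : ℝ => Real.exp (-π * t)) := by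
    refine Asymptotics.IsBigO.of_bound ((1 - Real.exp (-π))⁻¹) ?_
    filter_upwards [Filter.eventually_ge_atTop 1] with t ht
    rw [Complex.norm_real, Real.norm_of_nonneg (aux_nonneg (by positivity)),
      Real.norm_of_nonneg (Real.exp_pos _).le, mul_comm (1 - _)⁻¹, neg_mul]
    exact aux_bound ht
  exact h1.trans (isLittleO_exp_neg_mul_rpow_atTop Real.pi_pos r).isBigO

lemma aux_summable_even {s : ℂ} (hs : 1 < s.re) :
    Summable fun n : ℕ => ‖1 / ((n : ℂ) + 1) ^ s‖ := by
  have h := (Complex.summable_one_div_nat_cpow.mpr hs).norm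
  have h2 := h.comp_injective (i := fun n : ℕ => n + 1) (fun a b h => by simpa using h)
  refine h2.congr fun n => ?_
  simp

lemma aux_summable_odd {s : ℂ} (hs : 1 < s.re) :
    Summable fun m : ℕ => ‖(-1 : ℂ) ^ m / (2 * (m : ℂ) + 1) ^ s‖ := by
  have h := (Complex.summable_one_div_nat_cpow.mpr hs).norm
  have h2 := h.comp_injective (i := fun n : ℕ => 2 * n + 1) (fun a b h => by simpa using h)
  refine h2.congr fun n => ?_
  simp

lemma aux_beta {s : ℂ} (hs : 1 < s.re) :
    dirichletBeta s = ∑' m : ℕ, (-1 : ℂ) ^ m / (2 * (m : ℂ) + 1) ^ s := by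
  rw [dirichletBeta, DirichletCharacter.LFunction_eq_LSeries _ hs, LSeries]
  have hev : ∀ k : ℕ, LSeries.term (fun n : ℕ => (ZMod.χ₄.ringHomComp (Int.castRingHom ℂ)) n) s (2 * k) = 0 := by
    intro k
    rw [LSeries.term_def]
    split_ifs with h
    · rfl
    · have : ZMod.χ₄ ((2 * k : ℕ) : ZMod 4) = 0 := by
        rw [ZMod.χ₄_nat_eq_if_mod_four]; simp
      rw [MulChar.ringHomComp_apply, this]; simp
  have hod : ∀ k : ℕ, LSeries.term (fun n : ℕ => (ZMod.χ₄.ringHomComp (Int.castRingHom ℂ)) n) s (2 * k + 1)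
      = (-1 : ℂ) ^ k / (2 * (k : ℂ) + 1) ^ s := by
    intro k
    rw [LSeries.term_def, if_neg (by omega), MulChar.ringHomComp_apply]
    have : ZMod.χ₄ ((2 * k + 1 : ℕ) : ZMod 4) = (-1) ^ k := by
      rw [ZMod.χ₄_eq_neg_one_pow (by omega)]
      congr 1; omega
    rw [this]
    push_cast
    simp
  rw [← tsum_even_add_odd]
  · simp_rw [hev, hod]; simp
  · simp_rw [hev]; exact summable_zero
  · simp_rw [hod]; exact (aux_summable_odd hs).of_norm

lemma aux_mellin {s : ℂ} (hs : 1 < s.re) :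
    mellin (fun t : ℝ => (harmonicH (π * t) : ℂ)) s =
      Complex.Gamma s * (π : ℂ) ^ (-s) * riemannZeta s * dirichletBeta s := by
  have hE := aux_summable_even hs
  have hO := aux_summable_odd hs
  have hfac : ∀ p : ℕ × ℕ, ((((p.1 : ℝ) + 1) * (2 * p.2 + 1) : ℝ) : ℂ) ^ s =
      ((p.1 : ℂ) + 1) ^ s * (2 * (p.2 : ℂ) + 1) ^ s := by
    intro p
    rw [Complex.ofReal_mul, Complex.mul_cpow_ofReal_nonneg (by positivity) (by positivity)]
    push_cast; rfl
  have h := hasSum_mellin_pi_mul (a := fun p : ℕ × ℕ => (-1 : ℂ) ^ p.2)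
    (q := fun p => ((p.1 : ℝ) + 1) * (2 * p.2 + 1)) (F := fun t : ℝ => (harmonicH (π * t) : ℂ)) (s := s)
    (fun p => Or.inr (by positivity)) (by linarith) ?_ ?_
  · rw [← h.tsum_eq, aux_beta hs, zeta_eq_tsum_one_div_nat_add_one_cpow hs,
      mul_assoc (Complex.Gamma s * _), tsum_mul_tsum_of_summable_norm hE hO, ← tsum_mul_left]
    congr 1
    ext p
    rw [hfac]
    have h1 : ((p.1 : ℂ) + 1) ^ s ≠ 0 := by
      rw [Complex.cpow_ne_zero_iff]; left; exact_mod_cast (by omega : p.1 + 1 ≠ 0)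
    have h2 : (2 * (p.2 : ℂ) + 1) ^ s ≠ 0 := by
      rw [Complex.cpow_ne_zero_iff]; left; exact_mod_cast (by omega : 2 * p.2 + 1 ≠ 0)
    field_simp
  · intro t ht
    have := (Complex.hasSum_ofReal).mpr (aux_hasSum_prod ht)
    refine this.congr_fun ?_
    intro p
    push_cast
    rfl
  · have := (summable_mul_of_summable_norm hE hO).norm
    refine this.congr fun p => ?_
    rw [← Complex.norm_cpow_eq_rpow_re_of_pos (by positivity), hfac]
    simp [mul_comm]

/-- The functional-equation pair attached to `1 + 4 H(π t)`. -/
noncomputable def auxFE : WeakFEPair ℂ where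
  f := fun t => 1 + 4 * (harmonicH (π * t) : ℂ)
  g := fun t => 1 + 4 * (harmonicH (π * t) : ℂ)
  k := 1
  ε := 1
  f₀ := 1
  g₀ := 1
  hf_int := (locallyIntegrableOn_const _).add (aux_locInt.smul (4 : ℂ))
  hg_int := (locallyIntegrableOn_const _).add (aux_locInt.smul (4 : ℂ))
  hk := one_pos
  hε := one_ne_zero
  h_feq := by
    intro x hx
    have := aux_FE hx
    rw [Real.rpow_one, one_mul, smul_eq_mul]
    exact_mod_cast this
  hf_top := fun r => by
    simpa using (aux_decay r).const_mul_left 4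
  hg_top := fun r => by
    simpa using (aux_decay r).const_mul_left 4

lemma aux_Lambda {s : ℂ} (hs : 1 < s.re) :
    auxFE.Λ s = 4 * (Complex.Gamma s * (π : ℂ) ^ (-s) * riemannZeta s * dirichletBeta s) := by
  rw [← (auxFE.hasMellin (s := s) hs).2, ← aux_mellin hs, ← smul_eq_mul, ← mellin_const_smul]
  congr 1
  ext t
  simp [auxFE]

lemma aux_chi_ne : (ZMod.χ₄.ringHomComp (Int.castRingHom ℂ)) ≠ 1 := by
  intro h
  have h2 : (ZMod.χ₄.ringHomComp (Int.castRingHom ℂ)) (3 : ZMod 4) = 1 := by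
    rw [h]
    exact MulChar.one_apply (by decide)
  rw [MulChar.ringHomComp_apply] at h2
  have : ZMod.χ₄ (3 : ZMod 4) = -1 := by decide
  rw [this] at h2
  norm_num at h2

lemma aux_continue (s : ℂ) (hs : 0 < s.re) (hs1 : s ≠ 1) :
    auxFE.Λ s = 4 * (Complex.Gamma s * (π : ℂ) ^ (-s) * riemannZeta s * dirichletBeta s) := by
  let Uc : Set ℂ := {1} ∪ Set.range (fun n : ℕ => (-(n : ℂ)))
  have hUc : Uc.Countable := (Set.countable_singleton _).union (Set.countable_range _)
  have hconn : IsPreconnected Ucᶜ :=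
    (hUc.isConnected_compl_of_one_lt_rank (by simp [Complex.rank_real_complex])).isPreconnected
  have hmem : ∀ z : ℂ, 0 < z.re → z ≠ 1 → z ∈ Ucᶜ := by
    intro z hz hz1 h
    rcases h with h | ⟨n, rfl⟩
    · exact hz1 h
    · simp at hz
      have : (0 : ℝ) ≤ n := by positivity
      linarith
  have hopen : IsOpen Ucᶜ := by
    rw [isOpen_compl_iff]
    refine isClosed_singleton.union ?_
    have : Set.range (fun n : ℕ => (-(n : ℂ))) = Set.range (fun n : ℕ => (((-(n : ℤ) : ℤ)) : ℂ)) := by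
      congr 1; ext n; simp
    rw [this]
    have h2 : Set.range (fun n : ℕ => (((-(n : ℤ) : ℤ)) : ℂ)) = (fun k : ℤ => (k : ℂ)) '' (Set.range fun n : ℕ => -(n : ℤ)) := by
      rw [← Set.range_comp]; rfl
    rw [h2]
    exact Complex.isClosedEmbedding_intCast.isClosedMap _ (isClosed_discrete _)
  have key := AnalyticOnNhd.eqOn_of_preconnected_of_eventuallyEq (𝕜 := ℂ) (f := auxFE.Λ)
    (g := fun s => 4 * (Complex.Gamma s * (π : ℂ) ^ (-s) * riemannZeta s * dirichletBeta s))
    (U := Ucᶜ) ?_ ?_ hconn (z₀ := 2) (hmem 2 (by simp) (by norm_num)) ?_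
  · exact key (hmem s hs hs1)
  · refine DifferentiableOn.analyticOnNhd (fun z hz => DifferentiableAt.differentiableWithinAt ?_) hopen
    refine auxFE.differentiableAt_Λ (Or.inl ?_) (Or.inl ?_)
    · rintro rfl
      exact hz (Or.inr ⟨0, by simp⟩)
    · rintro rfl
      exact hz (Or.inl (by simp [auxFE]))
  · refine DifferentiableOn.analyticOnNhd (fun z hz => DifferentiableAt.differentiableWithinAt ?_) hopen
    have d1 : DifferentiableAt ℂ Complex.Gamma z := Complex.differentiableAt_Gamma z
      (fun m hm => hz (Or.inr ⟨m, hm.symm⟩))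
    have d2 : DifferentiableAt ℂ riemannZeta z := differentiableAt_riemannZeta (fun h => hz (Or.inl h))
    have d3 : DifferentiableAt ℂ dirichletBeta z :=
      (DirichletCharacter.differentiable_LFunction aux_chi_ne) z
    have d4 : DifferentiableAt ℂ (fun s : ℂ => (π : ℂ) ^ (-s)) z :=
      (differentiableAt_id.neg).const_cpow (Or.inl (by exact_mod_cast Real.pi_pos.ne'))
    exact (((d1.mul d4).mul d2).mul d3).const_mul 4
  · have : {z : ℂ | 1 < z.re} ∈ nhds (2 : ℂ) :=
      (isOpen_lt continuous_const Complex.continuous_re).mem_nhds (by simp)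
    filter_upwards [this] with z hz using aux_Lambda hz

/-- Truncation of `4 H(π t)` to `t > 1`. -/
noncomputable def auxA : ℝ → ℂ := (Set.Ioi 1).indicator (fun t : ℝ => 4 * (harmonicH (π * t) : ℂ))

lemma auxA_conv (s : ℂ) : MellinConvergent auxA s := by
  obtain ⟨a, ha⟩ := exists_gt s.re
  obtain ⟨b, hb⟩ := exists_lt s.re
  refine mellinConvergent_of_isBigO_rpow (a := a) (b := b) ?_ ?_ ha ?_ hb
  · intro x hx
    obtain ⟨u, hu, huI⟩ := (aux_locInt.smul (4 : ℂ)) x hx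
    exact ⟨u, hu, huI.indicator measurableSet_Ioi⟩
  · refine ((aux_decay (-a)).const_mul_left 4).congr' ?_ Filter.EventuallyEq.rfl
    filter_upwards [Filter.eventually_gt_atTop 1] with x hx
    rw [auxA, Set.indicator_of_mem (Set.mem_Ioi.mpr hx)]
  · refine (Asymptotics.isBigO_zero _ _).congr' ?_ Filter.EventuallyEq.rfl
    have : Set.Iio (1 : ℝ) ∈ nhdsWithin (0 : ℝ) (Set.Ioi 0) :=
      mem_nhdsWithin_of_mem_nhds (Iio_mem_nhds one_pos)
    filter_upwards [this] with x hx
    rw [auxA, Set.indicator_of_notMem (by simpa using (le_of_lt hx))]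

lemma auxA_mellin (s : ℂ) :
    mellin auxA s = ∫ t in Set.Ioi (1 : ℝ), (t : ℂ) ^ (s - 1) * (4 * (harmonicH (π * t) : ℂ)) := by
  have : ∀ t : ℝ, (t : ℂ) ^ (s - 1) • auxA t =
      (Set.Ioi 1).indicator (fun t : ℝ => (t : ℂ) ^ (s - 1) * (4 * (harmonicH (π * t) : ℂ))) t := by
    intro t
    by_cases h : t ∈ Set.Ioi (1 : ℝ) <;> simp [auxA, h]
  rw [mellin]
  simp_rw [this]
  rw [setIntegral_indicator measurableSet_Ioi, Set.inter_eq_right.mpr (Set.Ioi_subset_Ioi zero_le_one)]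

lemma auxA_int (s : ℂ) :
    IntegrableOn (fun t : ℝ => (t : ℂ) ^ (s - 1) * (4 * (harmonicH (π * t) : ℂ))) (Set.Ioi 1) := by
  have h : IntegrableOn _ _ _ := auxA_conv s
  refine (h.mono_set (Set.Ioi_subset_Ioi zero_le_one)).congr_fun (fun t ht => ?_) measurableSet_Ioi
  simp only [auxA, Set.indicator_of_mem ht, smul_eq_mul]

lemma aux_modif {t : ℝ} (ht : 0 < t) :
    auxFE.f_modif t = auxA t + (t : ℂ) ^ (-1 : ℂ) • auxA t⁻¹ := by
  rw [WeakFEPair.f_modif, Pi.add_apply]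
  congr 1
  · rw [auxA]; congr 1; ext x; simp [auxFE]
  · by_cases h : t < 1
    · have h1 : t ∈ Set.Ioo (0 : ℝ) 1 := ⟨ht, h⟩
      have h2 : t⁻¹ ∈ Set.Ioi (1 : ℝ) := (one_lt_inv₀ ht).mpr h
      have hfe := aux_FE ht
      rw [one_div] at hfe
      have hfeC : (1 + 4 * (harmonicH (π * t⁻¹) : ℂ)) = t * (1 + 4 * (harmonicH (π * t) : ℂ)) := by
        exact_mod_cast hfe
      have htc : (t : ℂ) ≠ 0 := by exact_mod_cast ht.ne'
      rw [auxA, Set.indicator_of_mem h1, Set.indicator_of_mem h2, Complex.cpow_neg_one,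
        eq_sub_of_add_eq' hfeC]
      simp only [auxFE, Real.rpow_neg_one, smul_eq_mul]
      push_cast
      field_simp
    · have h1 : t ∉ Set.Ioo (0 : ℝ) 1 := fun hq => h hq.2
      have h2 : t⁻¹ ∉ Set.Ioi (1 : ℝ) := fun hq => h ((one_lt_inv₀ ht).mp hq)
      rw [auxA, Set.indicator_of_notMem h1, Set.indicator_of_notMem h2, smul_zero]

lemma aux_Lambda0 (s : ℂ) : auxFE.Λ₀ s = mellin auxA s + mellin auxA (1 - s) := by
  have e : mellin auxFE.f_modif s = mellin (fun t => auxA t + (t : ℂ) ^ (-1 : ℂ) • auxA t⁻¹) s :=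
    setIntegral_congr_fun measurableSet_Ioi fun t ht => by
      simp only [aux_modif ht]
  have hB : MellinConvergent (fun t : ℝ => (t : ℂ) ^ (-1 : ℂ) • auxA t⁻¹) s := by
    rw [MellinConvergent.cpow_smul (f := fun t => auxA t⁻¹)]
    have := (MellinConvergent.comp_rpow (f := auxA) (s := s + -1) (a := -1) (by norm_num)).mpr (auxA_conv _)
    simpa only [Real.rpow_neg_one] using this
  rw [WeakFEPair.Λ₀, e, (hasMellin_add (auxA_conv s) hB).2,
    mellin_cpow_smul (fun t => auxA t⁻¹), mellin_comp_inv]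
  congr 2
  ring

theorem A_analytic_continuation (s : ℂ) (hs : 0 < s.re) (hs1 : s ≠ 1) :
    Complex.Gamma s * (π : ℂ) ^ (-s) * riemannZeta s * dirichletBeta s =
      1 / (4 * s * (s - 1)) +
        ∫ x in Set.Ioi (π : ℝ), (harmonicH x : ℂ) *
          (((x / π : ℝ) : ℂ) ^ s + ((x / π : ℝ) : ℂ) ^ (1 - s)) * (x : ℂ)⁻¹ := by
  have hpi := Real.pi_pos
  have hpc : (π : ℂ) ≠ 0 := by exact_mod_cast hpi.ne'
  have h := aux_continue s hs hs1
  have hsub := integral_comp_mul_left_Ioi (fun x : ℝ => (harmonicH x : ℂ) *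
          (((x / π : ℝ) : ℂ) ^ s + ((x / π : ℝ) : ℂ) ^ (1 - s)) * (x : ℂ)⁻¹) 1 hpi
  rw [mul_one] at hsub
  have hint : auxFE.Λ₀ s = 4 * ∫ x in Set.Ioi (π : ℝ), (harmonicH x : ℂ) *
          (((x / π : ℝ) : ℂ) ^ s + ((x / π : ℝ) : ℂ) ^ (1 - s)) * (x : ℂ)⁻¹ := by
    have h2 : (∫ x in Set.Ioi (π : ℝ), (harmonicH x : ℂ) *
          (((x / π : ℝ) : ℂ) ^ s + ((x / π : ℝ) : ℂ) ^ (1 - s)) * (x : ℂ)⁻¹) = π * (π⁻¹ • ∫ x in Set.Ioi (π : ℝ), (harmonicH x : ℂ) *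
          (((x / π : ℝ) : ℂ) ^ s + ((x / π : ℝ) : ℂ) ^ (1 - s)) * (x : ℂ)⁻¹) := by
      rw [Complex.real_smul, ← mul_assoc, Complex.ofReal_inv, mul_inv_cancel₀ hpc, one_mul]
    rw [h2, ← hsub, aux_Lambda0, auxA_mellin, auxA_mellin,
      ← integral_add (auxA_int s) (auxA_int (1 - s)), ← mul_assoc, ← integral_const_mul]
    refine setIntegral_congr_fun measurableSet_Ioi fun t ht => ?_
    have ht0 : 0 < t := lt_trans one_pos ht
    have htc : (t : ℂ) ≠ 0 := by exact_mod_cast ht0.ne'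
    have e : π * t / π = t := by field_simp
    simp only [e]
    rw [Complex.cpow_sub _ _ htc, Complex.cpow_sub _ _ htc, Complex.cpow_sub _ _ htc, Complex.cpow_one]
    push_cast
    have : (t : ℂ) ^ s ≠ 0 := by rw [Complex.cpow_ne_zero_iff]; exact Or.inl htc
    field_simp
  have hs0 : s ≠ 0 := by rintro rfl; simp at hs
  have hs1a : s - 1 ≠ 0 := sub_ne_zero.mpr hs1
  have hs1b : 1 - s ≠ 0 := sub_ne_zero.mpr hs1.symm
  have h3 : auxFE.Λ s = auxFE.Λ₀ s - 1 / s - 1 / (1 - s) := by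
    simp [WeakFEPair.Λ, auxFE]
  rw [h3, hint] at h
  have h4 : (1 : ℂ) / (4 * s * (s - 1)) = (- 1 / s - 1 / (1 - s)) / 4 := by
    field_simp
    ring
  rw [h4]
  linear_combination (-1 / 4 : ℂ) * h
end

section
/- Let α, β be positive reals with αβ = π, and let n be a real number with |n| < β/2. Then α (¼ sec(αn) + Σ_{k=1}^∞ χ(k) cos(αnk) / (e^{α²k} - 1)) = β (¼ + ½ Σ_{k=1}^∞ cosh(2βnk) / cosh(β²k)), both series being convergent. -/
open Real

/-- The unique nontrivial Dirichlet character modulo 4, as a real-valued function on ℕ: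
`χ(k) = 0` for `k` even, `1` for `k ≡ 1 (mod 4)`, `-1` for `k ≡ 3 (mod 4)`. -/
noncomputable def chi4 (k : ℕ) : ℝ := ((ZMod.χ₄ (k : ZMod 4) : ℤ) : ℝ)


lemma aux_hasSum_congr {ι : Type*} {f g : ι → ℂ} {a b : ℂ} (h : HasSum f a) (hf : ∀ i, g i = f i)
    (hab : b = a) : HasSum g b := by
  obtain rfl : g = f := funext hf
  rw [hab]; exact h

lemma aux_sech_integral (w : ℂ) (h1 : -(1/2) < w.re) (h2 : w.re < 1/2) :
    ∫ x : ℝ, Complex.exp (w * x) / (2 * Complex.cosh ((x : ℂ) / 2)) = π / Complex.cos (π * w) := by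
  have hu : 0 < (1/2 + w).re := by simp; linarith
  have hv : 0 < (1 - (1/2 + w)).re := by simp; linarith
  have hB := Complex.Gamma_mul_Gamma_eq_betaIntegral hu hv
  rw [Complex.Gamma_mul_Gamma_one_sub, add_sub_cancel, Complex.Gamma_one, one_mul] at hB
  have hc : Complex.sin (π * (1/2 + w)) = Complex.cos (π * w) := by
    rw [← Complex.sin_add_pi_div_two]; congr 1; ring
  rw [hc] at hB
  rw [hB, Complex.betaIntegral, intervalIntegral.integral_of_le zero_le_one,
    MeasureTheory.integral_Ioc_eq_integral_Ioo, ← Real.range_sigmoid, ← Set.image_univ,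
    MeasureTheory.integral_image_eq_integral_abs_deriv_smul MeasurableSet.univ
      (fun x _ => (Real.hasDerivAt_sigmoid x).hasDerivWithinAt)
      Real.sigmoid_injective.injOn, MeasureTheory.setIntegral_univ]
  congr 1
  ext x
  have hs0 := Real.sigmoid_pos x
  have hs1 := Real.sigmoid_lt_one x
  have e1 : 1 - Real.sigmoid x = Real.exp (-x) * Real.sigmoid x := by
    rw [← Real.sigmoid_neg, ← Real.sigmoid_mul_rexp_neg, mul_comm]
  rw [abs_of_pos (by apply mul_pos hs0; linarith), Complex.real_smul]
  have hsc : (Real.sigmoid x : ℂ) ≠ 0 := by exact_mod_cast hs0.ne'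
  have hE : ((Real.exp (-x) : ℝ) : ℂ) ≠ 0 := by exact_mod_cast (Real.exp_pos _).ne'
  have e2 : (1 : ℂ) - (Real.sigmoid x : ℂ) = ((Real.exp (-x) : ℝ) : ℂ) * (Real.sigmoid x : ℝ) := by
    exact_mod_cast congrArg (fun t : ℝ => (t : ℂ)) e1
  have e3 : ((Real.exp (-x) : ℝ) : ℂ) ^ (1 - (1/2 + w) - 1) = Complex.exp (x * (1/2 + w)) := by
    rw [Complex.cpow_def_of_ne_zero hE, ← Complex.ofReal_log (Real.exp_pos _).le, Real.log_exp]
    congr 1; push_cast; ring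
  push_cast
  rw [e2, Complex.mul_cpow_ofReal_nonneg (Real.exp_pos _).le hs0.le, e3]
  have e4 : (Real.sigmoid x : ℂ) ^ (1/2 + w - 1) * (Real.sigmoid x : ℂ) ^ (1 - (1/2 + w) - 1)
      = (Real.sigmoid x : ℂ)⁻¹ := by
    rw [← Complex.cpow_add _ _ hsc, ← Complex.cpow_neg_one]; congr 1; ring
  have e5 : (Real.sigmoid x : ℂ) = (1 + Complex.exp (-x))⁻¹ := by
    rw [Real.sigmoid_def]; push_cast; rfl
  have e6 : 2 * Complex.cosh ((x : ℂ) / 2) = Complex.exp (x/2) * (1 + Complex.exp (-x)) := by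
    rw [Complex.two_cosh, mul_add, ← Complex.exp_add]; congr 2 <;> ring_nf
  have e7 : Complex.exp (w * x) =
      Complex.exp (x/2) * (Complex.exp (-x) * Complex.exp (x * (1/2 + w))) := by
    rw [← Complex.exp_add, ← Complex.exp_add]; congr 1; ring
  calc _ = (Real.sigmoid x : ℂ) * (Complex.exp (-x) * Complex.exp (x * (1/2 + w))) := by
        rw [e6, e7, e5]
        have := Complex.exp_ne_zero ((x : ℂ)/2)
        rw [mul_div_mul_left _ _ this]
        ring
    _ = (Real.sigmoid x : ℂ) * (((Real.exp (-x) : ℝ) : ℂ) * (Real.sigmoid x : ℝ)) *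
        (Complex.exp (x * (1/2 + w)) * ((Real.sigmoid x : ℂ) ^ (1/2 + w - 1) *
          (Real.sigmoid x : ℂ) ^ (1 - (1/2 + w) - 1))) := by
        rw [e4]; push_cast; field_simp
    _ = _ := by ring

lemma aux_chi4 (k : ℕ) : (chi4 k : ℂ) = (Complex.I ^ k - (-Complex.I) ^ k) / (2 * Complex.I) := by
  have key : ∀ j : ℕ, (Complex.I ^ (k+4*j) - (-Complex.I) ^ (k+4*j)) = (Complex.I ^ k - (-Complex.I) ^ k) := by
    intro j
    simp [pow_add, pow_mul, Complex.I_pow_four, Even.neg_pow (show Even 4 by decide)]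
  clear key
  obtain ⟨q, r, hr, rfl⟩ : ∃ q r, r < 4 ∧ k = 4 * q + r :=
    ⟨k / 4, k % 4, Nat.mod_lt _ (by norm_num), (Nat.div_add_mod k 4).symm⟩
  have h4 : ((4 : ℕ) : ZMod 4) = 0 := by decide
  have : chi4 (4 * q + r) = chi4 r := by
    unfold chi4; push_cast
    have : (4 : ZMod 4) = 0 := by decide
    rw [this]; simp
  rw [this, pow_add, pow_add, pow_mul, pow_mul, Even.neg_pow (show Even 4 by decide), Complex.I_pow_four]
  simp only [one_pow, one_mul]
  unfold chi4
  interval_cases r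
  · simp
  · have : ZMod.χ₄ ((1 : ℕ) : ZMod 4) = 1 := by decide
    rw [this]; field_simp; push_cast; ring
  · have : ZMod.χ₄ ((2 : ℕ) : ZMod 4) = 0 := by decide
    rw [this]; simp
  · have : ZMod.χ₄ ((3 : ℕ) : ZMod 4) = -1 := by decide
    rw [this, Odd.neg_pow (by decide), Complex.I_pow_three]; field_simp; push_cast; ring

lemma aux_chi4_abs (k : ℕ) : ‖(chi4 k : ℂ)‖ ≤ 1 := by
  have h : ∀ x : ZMod 4, |ZMod.χ₄ x| ≤ 1 := by decide
  rw [Complex.norm_real]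
  unfold chi4
  rw [Real.norm_eq_abs, ← Int.cast_abs]
  exact_mod_cast h k

lemma aux_chi_sum (w : ℂ) (hw : ‖w‖ < 1) :
    HasSum (fun k : ℕ => (chi4 (k+1) : ℂ) * w ^ (k+1)) (w / (1 + w^2)) := by
  have h1 : ‖Complex.I * w‖ < 1 := by simpa
  have h2 : ‖-Complex.I * w‖ < 1 := by simpa
  have n1 : 1 - Complex.I * w ≠ 0 := by
    intro h; rw [sub_eq_zero] at h; rw [← h] at h1; simp at h1
  have n2 : 1 - -Complex.I * w ≠ 0 := by
    intro h; rw [sub_eq_zero] at h; rw [← h] at h2; simp at h2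
  have H := (((hasSum_geometric_of_norm_lt_one h1).mul_left (Complex.I * w)).sub
    ((hasSum_geometric_of_norm_lt_one h2).mul_left (-Complex.I * w))).div_const (2 * Complex.I)
  refine aux_hasSum_congr H ?_ ?_
  · intro k
    rw [aux_chi4, mul_pow, mul_pow, pow_succ, pow_succ, pow_succ]; ring
  · have : 1 + w^2 = (1 - Complex.I * w) * (1 - -Complex.I * w) := by
      ring_nf; simp
    have n2' : 1 + Complex.I * w ≠ 0 := by
      intro h; apply n2; rw [← h]; ring
    rw [this, show 1 - -Complex.I * w = 1 + Complex.I * w by ring]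
    have i1 : (1 - Complex.I * w)⁻¹ + (1 + Complex.I * w)⁻¹ =
        2 / ((1 - Complex.I * w) * (1 + Complex.I * w)) := by
      generalize Complex.I * w = x at *
      field_simp; ring
    have i2 : ∀ A B : ℂ, (Complex.I * w * A - -Complex.I * w * B) / (2 * Complex.I)
        = w / 2 * (A + B) := by
      intro A B; field_simp; ring
    rw [i2, i1]; ring

lemma aux_cos (z : ℂ) (hz : ‖Complex.exp (Complex.I * z)‖ < 1) :
    HasSum (fun k : ℕ => 2 * ((chi4 (k+1) : ℂ) * (Complex.exp (Complex.I * z)) ^ (k+1)))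
      (1 / Complex.cos z) := by
  refine aux_hasSum_congr ((aux_chi_sum _ hz).mul_left 2) (fun _ => rfl) ?_
  have h := Complex.exp_ne_zero (Complex.I * z)
  have : Complex.cos z = (1 + Complex.exp (Complex.I * z) ^ 2) / (2 * Complex.exp (Complex.I * z)) := by
    rw [Complex.cos, neg_mul, Complex.exp_neg, mul_comm z]; field_simp; ring
  rw [this, one_div_div]; ring

lemma aux_double (a θ : ℝ) (ha : 0 < a) :
    Summable (fun k : ℕ => (chi4 (k+1) : ℂ) * Complex.exp (Complex.I * θ * (k+1)) /
      (Complex.exp (a * (k+1)) - 1)) ∧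
    HasSum (fun m : ℕ => 1 / Complex.cos (θ + Complex.I * a * (m+1)))
      (2 * ∑' k : ℕ, (chi4 (k+1) : ℂ) * Complex.exp (Complex.I * θ * (k+1)) /
      (Complex.exp (a * (k+1)) - 1)) := by
  set F : ℕ × ℕ → ℂ := fun p => 2 * ((chi4 (p.2+1) : ℂ) *
    (Complex.exp (Complex.I * (θ + Complex.I * a * (p.1+1)))) ^ (p.2+1)) with hF
  have hnorm : ∀ m : ℕ, ‖Complex.exp (Complex.I * (θ + Complex.I * a * (m+1)))‖
      = Real.exp (-a) ^ (m+1) := by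
    intro m
    rw [Complex.norm_exp, ← Real.exp_nat_mul]
    congr 1
    simp; ring
  have hq0 := Real.exp_pos (-a)
  have hq1 : Real.exp (-a) < 1 := by rw [Real.exp_lt_one_iff]; linarith
  have hg := summable_geometric_of_lt_one hq0.le hq1
  have hFs : Summable F := by
    refine Summable.of_norm_bounded (g := fun p : ℕ × ℕ => 2 * (Real.exp (-a) ^ p.1 * Real.exp (-a) ^ p.2))
      ((hg.mul_of_nonneg hg (fun _ => by positivity) (fun _ => by positivity)).mul_left 2) ?_
    rintro ⟨m, k⟩
    simp only [hF, norm_mul, norm_pow, hnorm, Complex.norm_ofNat]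
    apply mul_le_mul_of_nonneg_left _ (by norm_num : (0:ℝ) ≤ 2)
    calc _ ≤ 1 * (Real.exp (-a) ^ (m+1)) ^ (k+1) := by gcongr; exact aux_chi4_abs _
      _ = Real.exp (-a) ^ ((m+1) * (k+1)) := by rw [one_mul, pow_mul]
      _ ≤ Real.exp (-a) ^ (m + k) := by
        apply pow_le_pow_of_le_one hq0.le hq1.le; nlinarith
      _ = _ := pow_add _ _ _
  have hrow : ∀ m : ℕ, HasSum (fun k => F (m, k)) (1 / Complex.cos (θ + Complex.I * a * (m+1))) := by
    intro m
    refine aux_hasSum_congr (aux_cos (θ + Complex.I * a * (m+1)) ?_) (fun _ => rfl) rfl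
    rw [hnorm]
    exact pow_lt_one₀ hq0.le hq1 (by simp)
  have hcol : ∀ k : ℕ, HasSum (fun m => F (m, k)) (2 * ((chi4 (k+1) : ℂ) * Complex.exp (Complex.I * θ * (k+1)) /
      (Complex.exp (a * (k+1)) - 1))) := by
    intro k
    have hq : ‖Complex.exp (-(a * (k+1)))‖ < 1 := by
      rw [Complex.norm_exp, Real.exp_lt_one_iff]; simp; positivity
    have H := (hasSum_geometric_of_norm_lt_one hq).mul_left (2 * ((chi4 (k+1) : ℂ) *
      Complex.exp (Complex.I * θ * (k+1)) * Complex.exp (-(a * (k+1)))))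
    refine aux_hasSum_congr H ?_ ?_
    · intro m
      simp only [hF]
      rw [← Complex.exp_nat_mul, ← Complex.exp_nat_mul, mul_assoc 2, mul_assoc (_ * _),
        ← Complex.exp_add, mul_assoc (chi4 (k+1) : ℂ), ← Complex.exp_add]
      congr 3
      push_cast
      linear_combination (↑a * (↑m + 1) * (k + 1)) * Complex.I_sq
    · have h0 := Complex.exp_ne_zero ((a : ℂ) * (k+1))
      have h1 : Complex.exp ((a : ℂ) * (k+1)) - 1 ≠ 0 := by
        intro h
        rw [sub_eq_zero] at h
        rw [Complex.exp_neg, h] at hq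
        simp at hq
      rw [Complex.exp_neg]
      have h2 : 1 - (Complex.exp ((a : ℂ) * (k+1)))⁻¹ ≠ 0 := by
        intro h
        apply h1
        field_simp at h
        simpa using h
      field_simp
  have hc := hFs.prod_symm.hasSum.prod_fiberwise (g := fun k : ℕ => _) hcol
  have hr := hFs.hasSum.prod_fiberwise hrow
  constructor
  · have := hc.summable
    rwa [summable_mul_left_iff (by norm_num)] at this
  · rw [← tsum_mul_left, hc.tsum_eq]
    convert hr using 1
    exact (Equiv.prodComm ℕ ℕ).tsum_eq F

lemma aux_decay_s13 (b c x : ℝ) (hc : |c| < b) :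
    Real.exp (c * x) / Real.cosh (b * x) ≤ 2 * Real.exp (-((b - |c|) * |x|)) := by
  have hb : 0 < b := lt_of_le_of_lt (abs_nonneg c) hc
  have h1 : Real.exp (b * |x|) / 2 ≤ Real.cosh (b * x) := by
    rw [← Real.cosh_abs (b * x), abs_mul, abs_of_pos hb, Real.cosh_eq]
    have := Real.exp_pos (-(b * |x|))
    linarith
  have h2 : Real.exp (c * x) ≤ Real.exp (|c| * |x|) := by
    apply Real.exp_le_exp.mpr
    rw [← abs_mul]; exact le_abs_self _
  rw [div_le_iff₀ (Real.cosh_pos _)]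
  calc _ ≤ Real.exp (|c| * |x|) := h2
    _ = 2 * Real.exp (-((b - |c|) * |x|)) * (Real.exp (b * |x|) / 2) := by
      have : Real.exp (|c| * |x|) = Real.exp (-((b - |c|) * |x|)) * Real.exp (b * |x|) := by
        rw [← Real.exp_add]; congr 1; ring
      rw [this]; ring
    _ ≤ _ := by gcongr

lemma aux_decay2 (b c x : ℝ) (hc : |c| < b) (hx : x ≠ 0) :
    Real.exp (c * x) / Real.cosh (b * x) ≤ 4 / (b - |c|) ^ 2 * |x| ^ (-2 : ℝ) := by
  refine (aux_decay_s13 b c x hc).trans ?_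
  have hd : 0 < b - |c| := by linarith
  have hx' : 0 < |x| := abs_pos.mpr hx
  have h := Real.quadratic_le_exp_of_nonneg (mul_nonneg hd.le hx'.le)
  have hp : 0 < (b - |c|) * |x| := by positivity
  rw [Real.rpow_neg hx'.le, Real.rpow_two, Real.exp_neg]
  have h3 : ((b - |c|) * |x|) ^ 2 / 2 ≤ Real.exp ((b - |c|) * |x|) := by linarith
  calc 2 * (Real.exp ((b - |c|) * |x|))⁻¹ ≤ 2 * (((b - |c|) * |x|) ^ 2 / 2)⁻¹ := by gcongr
    _ = _ := by field_simp; norm_num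

lemma aux_bigO (b c : ℝ) (hc : |c| < b) :
    (fun x : ℝ => Complex.exp (c * x) / Complex.cosh (b * x)) =O[Filter.cocompact ℝ]
      (fun x : ℝ => |x| ^ (-2 : ℝ)) := by
  refine Asymptotics.IsBigO.of_bound (4 / (b - |c|) ^ 2) ?_
  have : ({0} : Set ℝ)ᶜ ∈ Filter.cocompact ℝ := isCompact_singleton.compl_mem_cocompact
  filter_upwards [this] with x hx
  have e : Complex.exp (c * x) / Complex.cosh (b * x) =
      ((Real.exp (c * x) / Real.cosh (b * x) : ℝ) : ℂ) := by push_cast; rfl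
  rw [e, Complex.norm_real, Real.norm_of_nonneg (by have := Real.cosh_pos (b*x); positivity),
    Real.norm_of_nonneg (by positivity)]
  exact aux_decay2 b c x hc hx

lemma aux_fourier (b c ξ : ℝ) (hc : |c| < b) :
    FourierTransform.fourier (fun x : ℝ => Complex.exp (c * x) / Complex.cosh (b * x)) ξ =
      π / b * (1 / Complex.cos (π * c / (2 * b) - Complex.I * (π ^ 2 / b) * ξ)) := by
  have hb : 0 < b := lt_of_le_of_lt (abs_nonneg c) hc
  rw [Real.fourier_real_eq_integral_exp_smul]
  obtain ⟨hc1, hc2⟩ := abs_lt.mp hc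
  set w : ℂ := (c - 2 * π * Complex.I * ξ) / (2 * b) with hw
  have hre : w.re = c / (2 * b) := by
    have : w = ((c / (2 * b) : ℝ) : ℂ) + ((-(2 * π * ξ) / (2 * b) : ℝ) : ℂ) * Complex.I := by
      rw [hw]; push_cast; ring
    rw [this, Complex.add_re, Complex.ofReal_re, Complex.re_ofReal_mul, Complex.I_re, mul_zero,
      add_zero]
  have H := aux_sech_integral w
    (by rw [hre, lt_div_iff₀ (by positivity)]; linarith)
    (by rw [hre, div_lt_iff₀ (by positivity)]; linarith)
  have hbc : (b : ℂ) ≠ 0 := by exact_mod_cast hb.ne'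
  have S := MeasureTheory.Measure.integral_comp_mul_left
    (fun x : ℝ => Complex.exp (w * x) / (2 * Complex.cosh ((x : ℂ) / 2))) (2 * b)
  rw [H, abs_of_pos (by positivity), Complex.real_smul] at S
  calc _ = ∫ x : ℝ, 2 * (Complex.exp (w * ((2 * b * x : ℝ) : ℂ)) /
        (2 * Complex.cosh (((2 * b * x : ℝ) : ℂ) / 2))) := by
        congr 1
        ext x
        rw [smul_eq_mul, ← mul_div_assoc, ← Complex.exp_add, ← mul_div_assoc,
          mul_div_mul_left _ _ two_ne_zero]
        congr 2
        · rw [hw]; push_cast; field_simp; ring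
        · push_cast; ring
    _ = _ := by
        rw [MeasureTheory.integral_const_mul, S]
        rw [show (π : ℂ) * w = π * c / (2 * b) - Complex.I * (π ^ 2 / b) * ξ by
          rw [hw]; field_simp]
        push_cast; field_simp

lemma aux_poisson_s13 (a b c : ℝ) (hc : |c| < b) (hab : a * b = π ^ 2) :
    (∑' m : ℤ, Complex.exp (c * (m : ℝ)) / Complex.cosh (b * (m : ℝ))) =
     π / b * (1 / Complex.cos (π * c / (2 * b)) + 
      4 * ∑' k : ℕ, (chi4 (k+1) : ℂ) * Complex.cos (π * c / (2 * b) * (k+1)) /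
      (Complex.exp (a * (k+1)) - 1)) ∧
    Summable (fun k : ℕ => (chi4 (k+1) : ℂ) * Complex.cos (π * c / (2 * b) * (k+1)) /
      (Complex.exp (a * (k+1)) - 1)) := by
  have hb : 0 < b := lt_of_le_of_lt (abs_nonneg c) hc
  have hbc : (b : ℂ) ≠ 0 := by exact_mod_cast hb.ne'
  have ha : 0 < a := by
    have : 0 < a * b := by rw [hab]; positivity
    exact pos_of_mul_pos_left this hb.le
  have ha2 : (π : ℂ) ^ 2 / b = a := by
    rw [div_eq_iff hbc]; exact_mod_cast hab.symm
  set θ : ℝ := π * c / (2 * b) with hθ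
  have hθc : (π : ℂ) * c / (2 * b) = (θ : ℂ) := by rw [hθ]; push_cast; rfl
  obtain ⟨s1, t1⟩ := aux_double a θ ha
  obtain ⟨s2, t2⟩ := aux_double a (-θ) ha
  have hF : ∀ ξ : ℝ, FourierTransform.fourier
      (fun x : ℝ => Complex.exp (c * x) / Complex.cosh (b * x)) ξ =
      π / b * (1 / Complex.cos (θ - Complex.I * a * ξ)) := by
    intro ξ
    rw [aux_fourier b c ξ hc, ha2, hθc]
  have key : HasSum (fun m : ℤ => 1 / Complex.cos (θ - Complex.I * a * ((m : ℝ) : ℂ))) _ :=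
    HasSum.of_add_one_of_neg_add_one
      (aux_hasSum_congr t2 (by
        intro m
        rw [← Complex.cos_neg]; congr 2; push_cast; ring) rfl)
      (aux_hasSum_congr t1 (by
        intro m
        congr 2; push_cast; ring) rfl)
  have hcont : Continuous (fun x : ℝ => Complex.exp (c * x) / Complex.cosh (b * x)) := by
    refine Continuous.div (by fun_prop) (by fun_prop) ?_
    intro x
    have := (Real.cosh_pos (b * x)).ne'
    exact_mod_cast this
  have keyF : HasSum (fun m : ℤ => FourierTransform.fourier
      (fun x : ℝ => Complex.exp (c * x) / Complex.cosh (b * x)) (m : ℝ)) _ :=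
    aux_hasSum_congr (key.mul_left (π / b : ℂ)) (fun m => hF m) rfl
  have P := Real.tsum_eq_tsum_fourier_of_rpow_decay_of_summable hcont one_lt_two
    (aux_bigO b c hc) keyF.summable 0
  simp only [zero_add, QuotientAddGroup.mk_zero, fourier_eval_zero, mul_one] at P
  have hs : ∀ k : ℕ, (chi4 (k+1) : ℂ) * Complex.cos (θ * (k+1)) / (Complex.exp (a * (k+1)) - 1)
      = 1/2 * ((chi4 (k+1) : ℂ) * Complex.exp (Complex.I * θ * (k+1)) /
      (Complex.exp (a * (k+1)) - 1) + (chi4 (k+1) : ℂ) * Complex.exp (Complex.I * (-θ : ℝ) * (k+1)) /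
      (Complex.exp (a * (k+1)) - 1)) := by
    intro k
    rw [Complex.cos, show (θ : ℂ) * (k + 1) * Complex.I = Complex.I * θ * (k+1) by ring,
      show -((θ : ℂ) * (k + 1)) * Complex.I = Complex.I * (-θ : ℝ) * (k+1) by push_cast; ring]
    ring
  have hsum := aux_hasSum_congr ((s1.hasSum.add s2.hasSum).mul_left (1/2)) hs rfl
  rw [hθc]
  refine ⟨?_, hsum.summable⟩
  rw [P, keyF.tsum_eq, hsum.tsum_eq]
  congr 1
  simp only [Int.cast_zero, Complex.ofReal_zero, mul_zero, sub_zero]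
  ring

lemma aux_cosh_side (b c : ℝ) (hc : |c| < b) :
    Summable (fun k : ℕ => Real.cosh (c * (k + 1)) / Real.cosh (b * (k + 1))) ∧
    (∑' m : ℤ, Complex.exp (c * (m : ℝ)) / Complex.cosh (b * (m : ℝ))) =
      ((1 + 2 * ∑' k : ℕ, Real.cosh (c * (k + 1)) / Real.cosh (b * (k + 1)) : ℝ) : ℂ) := by
  have hS : Summable (fun m : ℤ => Complex.exp (c * (m : ℝ)) / Complex.cosh (b * (m : ℝ))) :=
    summable_of_isBigO (Real.summable_abs_int_rpow one_lt_two)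
      ((aux_bigO b c hc).comp_tendsto Int.tendsto_coe_cofinite)
  set f : ℤ → ℝ := fun m => Real.exp (c * m) / Real.cosh (b * m) with hf
  have e : (fun m : ℤ => Complex.exp (c * (m : ℝ)) / Complex.cosh (b * (m : ℝ))) =
      fun m => ((f m : ℝ) : ℂ) := by
    ext m; simp only [hf]; push_cast; rfl
  rw [e] at hS ⊢
  have hS' : Summable f := Complex.summable_ofReal.mp hS
  have h1 : Summable (fun k : ℕ => f ((k : ℤ) + 1)) :=
    hS'.comp_injective (i := fun k : ℕ => (k : ℤ) + 1) (fun a b h => by simpa using h)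
  have h2 : Summable (fun k : ℕ => f (-((k : ℤ) + 1))) :=
    hS'.comp_injective (i := fun k : ℕ => -((k : ℤ) + 1)) (fun a b h => by simpa using h)
  have hk : ∀ k : ℕ, Real.cosh (c * (k + 1)) / Real.cosh (b * (k + 1)) =
      1/2 * (f ((k : ℤ) + 1) + f (-((k : ℤ) + 1))) := by
    intro k
    simp only [hf]; push_cast
    rw [mul_neg, mul_neg, Real.cosh_neg, Real.cosh_eq (c * _)]; ring
  have h3 := (h1.hasSum.add h2.hasSum).mul_left (1/2)
  simp only [← hk] at h3
  refine ⟨h3.summable, ?_⟩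
  rw [← Complex.ofReal_tsum, h3.tsum_eq, tsum_of_add_one_of_neg_add_one h1 h2]
  congr 1
  have : f 0 = 1 := by simp [hf]
  rw [this]; ring

/-- Ramanujan's identity: for `α, β > 0` with `αβ = π` and `|n| < β/2`,
`α (¼ sec(αn) + Σ_{k=1}^∞ χ(k) cos(αnk)/(e^{α²k} - 1))
  = β (¼ + ½ Σ_{k=1}^∞ cosh(2βnk)/cosh(β²k))`, both series being convergent. -/
theorem ramanujan_identity (α β n : ℝ) (hα : 0 < α) (hβ : 0 < β) (hαβ : α * β = π)
    (hn : |n| < β / 2) :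
    Summable (fun k : ℕ => chi4 (k + 1) * Real.cos (α * n * (k + 1)) /
        (Real.exp (α ^ 2 * (k + 1)) - 1)) ∧
    Summable (fun k : ℕ => Real.cosh (2 * β * n * (k + 1)) / Real.cosh (β ^ 2 * (k + 1))) ∧
    α * (1 / 4 * (1 / Real.cos (α * n)) +
        ∑' k : ℕ, chi4 (k + 1) * Real.cos (α * n * (k + 1)) /
          (Real.exp (α ^ 2 * (k + 1)) - 1)) =
      β * (1 / 4 + 1 / 2 *
        ∑' k : ℕ, Real.cosh (2 * β * n * (k + 1)) / Real.cosh (β ^ 2 * (k + 1))) := by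
  have hβ2 : |2 * β * n| < β ^ 2 := by
    rw [abs_mul, abs_of_pos (by positivity : 0 < 2 * β)]; nlinarith
  have hab : α ^ 2 * β ^ 2 = π ^ 2 := by rw [← hαβ]; ring
  obtain ⟨hs, ht⟩ := aux_cosh_side (β ^ 2) (2 * β * n) hβ2
  obtain ⟨hp, hq⟩ := aux_poisson_s13 (α ^ 2) (β ^ 2) (2 * β * n) hβ2 hab
  have hθ : (π : ℂ) * ((2 * β * n : ℝ) : ℂ) / (2 * ((β ^ 2 : ℝ) : ℂ)) = ((α * n : ℝ) : ℂ) := by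
    rw [← hαβ]; push_cast
    have : (β : ℂ) ≠ 0 := by exact_mod_cast hβ.ne'
    field_simp
  rw [hθ] at hp hq
  have e : (fun k : ℕ => (chi4 (k+1) : ℂ) * Complex.cos (((α * n : ℝ) : ℂ) * (k+1)) /
      (Complex.exp (((α ^ 2 : ℝ) : ℂ) * (k+1)) - 1)) = fun k : ℕ =>
      ((chi4 (k + 1) * Real.cos (α * n * (k + 1)) / (Real.exp (α ^ 2 * (k + 1)) - 1) : ℝ) : ℂ) := by
    ext k; push_cast; rfl
  rw [e] at hp hq
  refine ⟨Complex.summable_ofReal.mp hq, hs, ?_⟩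
  rw [ht, ← Complex.ofReal_tsum, ← Complex.ofReal_cos] at hp
  have hp' : 1 + 2 * ∑' k : ℕ, Real.cosh (2 * β * n * (k + 1)) / Real.cosh (β ^ 2 * (k + 1)) =
      π / β ^ 2 * (1 / Real.cos (α * n) + 4 * ∑' k : ℕ, chi4 (k + 1) * Real.cos (α * n * (k + 1)) /
          (Real.exp (α ^ 2 * (k + 1)) - 1)) := by
    exact_mod_cast hp
  have hd : π / β ^ 2 = α / β := by rw [← hαβ]; field_simp
  rw [hd] at hp'
  have : β * (1 + 2 * ∑' k : ℕ, Real.cosh (2 * β * n * (k + 1)) / Real.cosh (β ^ 2 * (k + 1))) =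
      α * (1 / Real.cos (α * n) + 4 * ∑' k : ℕ, chi4 (k + 1) * Real.cos (α * n * (k + 1)) /
          (Real.exp (α ^ 2 * (k + 1)) - 1)) := by
    rw [hp', ← mul_assoc, mul_div_cancel₀ _ hβ.ne']
  linarith
end

section
/- For all real numbers a, b, u with 0 < a < b, one has ∫_0^∞ (cosh(at)/cosh(bt)) cos(ut) dt = (π/b) · cos(πa/(2b)) cosh(πu/(2b)) / (cos(πa/b) + cosh(πu/b)). -/
open Real MeasureTheory

lemma crt_cpow (x : ℝ) (w : ℂ) : ((Real.exp x : ℝ) : ℂ) ^ w = Complex.exp (x * w) := by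
  rw [Complex.cpow_def_of_ne_zero (by exact_mod_cast (Real.exp_pos x).ne'),
    ← Complex.ofReal_log (Real.exp_pos x).le, Real.log_exp]

lemma crt_sigmoid (x : ℝ) :
    Real.sigmoid (2 * x) = Real.exp (x - Real.log (2 * Real.cosh x)) := by
  have hc := Real.cosh_pos x
  rw [Real.exp_sub, Real.exp_log (by positivity), Real.sigmoid_def, Real.cosh_eq]
  have h1 : Real.exp (-(2 * x)) = Real.exp (-x) * Real.exp (-x) := by
    rw [← Real.exp_add]; ring_nf
  have h2 : Real.exp x * Real.exp (-x) = 1 := by rw [← Real.exp_add]; simp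
  have h3 := Real.exp_pos x
  have h4 := Real.exp_pos (-x)
  rw [h1]
  field_simp
  linear_combination (-Real.exp (-x)) * h2

lemma crt_sigmoid' (x : ℝ) :
    1 - Real.sigmoid (2 * x) = Real.exp (-x - Real.log (2 * Real.cosh x)) := by
  rw [← Real.sigmoid_neg]
  have := crt_sigmoid (-x)
  rw [Real.cosh_neg] at this
  rw [← this]; ring_nf

lemma crt_pt (b t : ℝ) (hb : 0 < b) (s : ℂ) :
    |2 * b * (Real.sigmoid (2 * (b * t)) * (1 - Real.sigmoid (2 * (b * t))))| •
      (((Real.sigmoid (2 * (b * t)) : ℝ) : ℂ) ^ (s - 1) *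
        (1 - ((Real.sigmoid (2 * (b * t)) : ℝ) : ℂ)) ^ ((1 - s) - 1)) =
      b * (Complex.exp ((2 * s - 1) * b * t) / ((Real.cosh (b * t) : ℝ) : ℂ)) := by
  have e : (1 - ((Real.sigmoid (2 * (b * t)) : ℝ) : ℂ)) =
      ((1 - Real.sigmoid (2 * (b * t)) : ℝ) : ℂ) := by push_cast; ring
  rw [e, crt_sigmoid', crt_sigmoid, crt_cpow, crt_cpow, ← Complex.exp_add, abs_of_pos (by positivity)]
  have hc := Real.cosh_pos (b * t)
  set c := Real.cosh (b * t) with hcdef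
  have hL : Complex.exp ((Real.log (2 * c) : ℝ) : ℂ) = 2 * c := by
    rw [← Complex.ofReal_exp, Real.exp_log (by positivity)]; push_cast; ring
  have h1 : Real.exp (b * t - Real.log (2 * c)) * Real.exp (-(b * t) - Real.log (2 * c)) =
      (4 * c ^ 2)⁻¹ := by
    rw [Real.exp_sub, Real.exp_sub, Real.exp_log (by positivity), div_mul_div_comm,
      ← Real.exp_add, add_neg_cancel, Real.exp_zero]
    field_simp; norm_num
  have h2 : ((b * t - Real.log (2 * c) : ℝ) : ℂ) * (s - 1) +
      ((-(b * t) - Real.log (2 * c) : ℝ) : ℂ) * (1 - s - 1) =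
      (2 * s - 1) * b * t + ((Real.log (2 * c) : ℝ) : ℂ) := by
    push_cast; ring
  have hc' : (c : ℂ) ≠ 0 := by exact_mod_cast hc.ne'
  rw [h1, h2, Complex.exp_add, hL, Complex.real_smul]
  push_cast
  field_simp
  ring

lemma crt_key (b : ℝ) (hb : 0 < b) (s : ℂ) (h0 : 0 < s.re) (h1 : s.re < 1) :
    Integrable (fun t : ℝ => Complex.exp ((2 * s - 1) * b * t) / ((Real.cosh (b * t) : ℝ) : ℂ)) ∧
    ∫ t : ℝ, Complex.exp ((2 * s - 1) * b * t) / ((Real.cosh (b * t) : ℝ) : ℂ) =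
      π / b / Complex.sin (π * s) := by
  have hbc : (b : ℂ) ≠ 0 := by exact_mod_cast hb.ne'
  have h1' : 0 < (1 - s).re := by simpa using h1
  set g : ℝ → ℂ := fun x => (x : ℂ) ^ (s - 1) * (1 - (x : ℂ)) ^ ((1 - s) - 1) with hg
  have hconv : IntervalIntegrable g volume 0 1 := Complex.betaIntegral_convergent h0 h1'
  have hval : ∫ x in (0 : ℝ)..1, g x = π / Complex.sin (π * s) := by
    have := Complex.Gamma_mul_Gamma_eq_betaIntegral h0 h1'
    rw [Complex.Gamma_mul_Gamma_one_sub, add_sub_cancel, Complex.Gamma_one, one_mul] at this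
    exact this.symm
  have hd : ∀ t ∈ (Set.univ : Set ℝ), HasDerivWithinAt (fun t => Real.sigmoid (2 * (b * t)))
      (2 * b * (Real.sigmoid (2 * (b * t)) * (1 - Real.sigmoid (2 * (b * t))))) Set.univ t := by
    intro t _
    apply HasDerivAt.hasDerivWithinAt
    have h := (hasDerivAt_sigmoid (2 * (b * t))).comp t
      (((hasDerivAt_id t).const_mul b).const_mul 2)
    refine h.congr_deriv ?_
    ring
  have hinj : Set.InjOn (fun t => Real.sigmoid (2 * (b * t))) Set.univ := by
    intro x _ y _ hxy
    have := Real.sigmoid_injective hxy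
    have h2 : b * x = b * y := by linarith
    exact mul_left_cancel₀ hb.ne' h2
  have himg : (fun t => Real.sigmoid (2 * (b * t))) '' Set.univ = Set.Ioo 0 1 := by
    rw [← Real.range_sigmoid, Set.image_univ]
    apply Set.Subset.antisymm
    · rintro _ ⟨t, rfl⟩; exact ⟨_, rfl⟩
    · rintro _ ⟨t, rfl⟩
      refine ⟨t / (2 * b), ?_⟩
      simp only
      congr 1
      field_simp
  have A := integrableOn_image_iff_integrableOn_abs_deriv_smul MeasurableSet.univ hd hinj g
  have B := integral_image_eq_integral_abs_deriv_smul MeasurableSet.univ hd hinj g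
  rw [himg] at A B
  simp only [hg, crt_pt b _ hb s] at A B
  rw [← hg] at A B
  constructor
  · rw [intervalIntegrable_iff_integrableOn_Ioo_of_le zero_le_one] at hconv
    have := (A.1 hconv)
    rw [integrableOn_univ] at this
    have := this.const_mul ((b : ℂ)⁻¹)
    refine this.congr (Filter.Eventually.of_forall fun t => ?_)
    simp only
    field_simp
  · rw [intervalIntegral.integral_of_le zero_le_one, integral_Ioc_eq_integral_Ioo] at hval
    have B' : ∫ x in Set.Ioo (0 : ℝ) 1, g x = _ := B
    rw [hval, setIntegral_univ, integral_const_mul] at B'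
    rw [eq_comm, div_right_comm, B']
    field_simp

/-- For `0 < a < b` and real `u`,
`∫_0^∞ (cosh(at)/cosh(bt)) cos(ut) dt
  = (π/b) cos(πa/(2b)) cosh(πu/(2b)) / (cos(πa/b) + cosh(πu/b))`. -/
theorem cosh_ratio_cosine_transform (a b u : ℝ) (ha : 0 < a) (hab : a < b) :
    ∫ t in Set.Ioi (0 : ℝ), Real.cosh (a * t) / Real.cosh (b * t) * Real.cos (u * t) =
      (π / b) * (Real.cos (π * a / (2 * b)) * Real.cosh (π * u / (2 * b))) /
        (Real.cos (π * a / b) + Real.cosh (π * u / b)) := by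
  have hb : 0 < b := ha.trans hab
  have hbc : (b : ℂ) ≠ 0 := by exact_mod_cast hb.ne'
  set s : ℂ := (((1 + a / b) / 2 : ℝ) : ℂ) + ((u / (2 * b) : ℝ) : ℂ) * Complex.I with hs
  have hre : s.re = (1 + a / b) / 2 := by
    rw [hs, Complex.add_re, Complex.re_ofReal_mul, Complex.ofReal_re, Complex.I_re]; ring
  have hlt : a / b < 1 := (div_lt_one hb).2 hab
  have hpos : 0 < a / b := by positivity
  obtain ⟨hI, hV⟩ := crt_key b hb s (by rw [hre]; linarith) (by rw [hre]; linarith)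
  set F : ℝ → ℝ := fun t => Real.exp (a * t) * Real.cos (u * t) / Real.cosh (b * t) with hF
  have hFre : ∀ t : ℝ, RCLike.re (Complex.exp ((2 * s - 1) * b * t) /
      ((Real.cosh (b * t) : ℝ) : ℂ)) = F t := by
    intro t
    have : (2 * s - 1) * b * t = ((a * t : ℝ) : ℂ) + ((u * t : ℝ) : ℂ) * Complex.I := by
      rw [hs]; push_cast; field_simp; ring
    rw [this, RCLike.re_eq_complex_re, Complex.div_ofReal_re, Complex.exp_re]
    simp [hF]
  have hFI : Integrable F := hI.re.congr (Filter.Eventually.of_forall hFre)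
  have hFV : ∫ t, F t = (π / b / Complex.sin (π * s)).re := by
    have h := integral_re hI
    rw [hV] at h
    rw [← RCLike.re_eq_complex_re, ← h]
    exact integral_congr_ae (Filter.Eventually.of_forall fun t => (hFre t).symm)
  have hG : ∀ t : ℝ, Real.cosh (a * |t|) / Real.cosh (b * |t|) * Real.cos (u * |t|) =
      (F t + F (-t)) / 2 := by
    intro t
    have e1 : Real.cosh (a * |t|) / Real.cosh (b * |t|) * Real.cos (u * |t|) =
        Real.cosh (a * t) / Real.cosh (b * t) * Real.cos (u * t) := by
      rcases abs_choice t with h | h <;> rw [h]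
      simp only [mul_neg, Real.cosh_neg, Real.cos_neg]
    rw [e1]
    simp only [hF, mul_neg, Real.cosh_neg, Real.cos_neg]
    rw [Real.cosh_eq (a * t)]
    ring
  have h2 := integral_comp_abs
    (f := fun t => Real.cosh (a * t) / Real.cosh (b * t) * Real.cos (u * t))
  simp only [hG] at h2
  rw [integral_div, integral_add hFI hFI.comp_neg, integral_neg_eq_self F volume, hFV] at h2
  have hsin : Complex.sin (π * s) =
      ((Real.cos (π * a / (2 * b)) * Real.cosh (π * u / (2 * b)) : ℝ) : ℂ) -
      ((Real.sin (π * a / (2 * b)) * Real.sinh (π * u / (2 * b)) : ℝ) : ℂ) * Complex.I := by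
    have : (π : ℂ) * s = (((π * a / (2 * b) : ℝ) : ℂ) + ((π * u / (2 * b) : ℝ) : ℂ) * Complex.I)
        + π / 2 := by
      rw [hs]; push_cast; field_simp; ring
    rw [this, Complex.sin_add_pi_div_two, Complex.cos_add_mul_I]
    push_cast
    ring
  have d1 : π * a / b = 2 * (π * a / (2 * b)) := by field_simp
  have d2 : π * u / b = 2 * (π * u / (2 * b)) := by field_simp
  have hx : 0 < Real.cos (π * a / (2 * b)) := by
    have e : π * a / (2 * b) = π / 2 * (a / b) := by field_simp
    have := Real.pi_pos
    apply Real.cos_pos_of_mem_Ioo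
    rw [e]
    constructor <;> nlinarith
  rw [d1, d2, Real.cos_two_mul, Real.cosh_two_mul]
  have q1 := Real.sin_sq_add_cos_sq (π * a / (2 * b))
  have q2 := Real.cosh_sq (π * u / (2 * b))
  have hy := Real.cosh_pos (π * u / (2 * b))
  rw [hsin] at h2
  generalize Real.cos (π * a / (2 * b)) = C at *
  generalize Real.sin (π * a / (2 * b)) = S at *
  generalize Real.cosh (π * u / (2 * b)) = H at *
  generalize Real.sinh (π * u / (2 * b)) = K at *
  have hN : 0 < (C * H) ^ 2 + (S * K) ^ 2 := by positivity
  have hden : 2 * C ^ 2 - 1 + (H ^ 2 + K ^ 2) = 2 * ((C * H) ^ 2 + (S * K) ^ 2) := by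
    have : S ^ 2 = 1 - C ^ 2 := by linarith
    rw [mul_pow, mul_pow, this, q2]; ring
  have hR : ((π : ℂ) / b / (((C * H : ℝ) : ℂ) - ((S * K : ℝ) : ℂ) * Complex.I)).re =
      π / b * (C * H) / ((C * H) ^ 2 + (S * K) ^ 2) := by
    rw [← Complex.ofReal_div, Complex.div_re]
    simp [Complex.normSq_apply, -Complex.ofReal_mul, -Complex.ofReal_div]
    ring
  rw [hR] at h2
  rw [hden]
  have : π / b * (C * H) / (2 * ((C * H) ^ 2 + (S * K) ^ 2)) =
    (π / b * (C * H) / ((C * H) ^ 2 + (S * K) ^ 2)) / 2 := by field_simp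
  rw [this]
  linarith
end

section
/- For every real x > 0, one has ¼ (1 - (Σ_{n∈ℤ} (-1)^n e^{-n²x})²) = Σ_{j=0}^∞ (-1)^j / (e^{(2j+1)x} + 1), where the sum on the left is over all integers n and both series converge absolutely. -/
open Real
namespace ThetaFour
open Finset Filter Topology

noncomputable def o (q : ℝ) (n : ℕ) : ℝ := ∏ i ∈ range n, (1 - q ^ (2 * i + 1))
noncomputable def p (q : ℝ) (n : ℕ) : ℝ := ∏ i ∈ range n, (1 + q ^ (2 * i + 1))
noncomputable def e (q : ℝ) (n : ℕ) : ℝ := ∏ i ∈ range n, (1 - q ^ (2 * i + 2))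
noncomputable def f (q : ℝ) (n : ℕ) : ℝ := ∏ i ∈ range n, (1 + q ^ (2 * i + 2))

lemma o_succ (q : ℝ) (n : ℕ) : o q (n+1) = o q n * (1 - q ^ (2 * n + 1)) := prod_range_succ _ _
lemma p_succ (q : ℝ) (n : ℕ) : p q (n+1) = p q n * (1 + q ^ (2 * n + 1)) := prod_range_succ _ _
lemma e_succ (q : ℝ) (n : ℕ) : e q (n+1) = e q n * (1 - q ^ (2 * n + 2)) := prod_range_succ _ _
lemma f_succ (q : ℝ) (n : ℕ) : f q (n+1) = f q n * (1 + q ^ (2 * n + 2)) := prod_range_succ _ _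

lemma om_pos {q : ℝ} (h0 : 0 < q) (h1 : q < 1) (n : ℕ) : 0 < 1 - q ^ (n + 1) :=
  sub_pos.2 (pow_lt_one₀ h0.le h1 (by omega))

lemma e_pos {q : ℝ} (h0 : 0 < q) (h1 : q < 1) (n : ℕ) : 0 < e q n :=
  prod_pos fun i _ => om_pos h0 h1 (2 * i + 1)

lemma f_pos {q : ℝ} (h0 : 0 < q) (n : ℕ) : 0 < f q n :=
  prod_pos fun i _ => by positivity

/-- A finite Euler identity. -/
lemma euler (q : ℝ) (n : ℕ) : o q n * p q n * f q n * e q n = e q (2 * n) := by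
  induction n with
  | zero => simp [o, p, e, f]
  | succ n ih =>
    rw [show 2 * (n + 1) = 2 * n + 1 + 1 by ring, e_succ q (2 * n + 1), e_succ q (2 * n), e_succ q n, ← ih, o_succ, p_succ, f_succ]
    ring

/-- Half-line summand weights. -/
noncomputable def w (t : ℕ → ℝ) (m : ℕ) : ℝ := if m = 0 then t 0 / 2 else t m

noncomputable def tG (q : ℝ) (m : ℕ) : ℝ := (-1) ^ m * q ^ (m ^ 2)
noncomputable def tL (q : ℝ) (m : ℕ) : ℝ := (-1) ^ m * q ^ m / (1 + q ^ (2 * m))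

noncomputable def H (t b : ℕ → ℝ) (n : ℕ) : ℝ := ∑ m ∈ range (n + 1), w t m * b (n - m) * b (n + m)

lemma gauss_partial {q : ℝ} (h0 : 0 < q) (h1 : q < 1) (M : ℕ) : ∀ k : ℕ,
    ∑ m ∈ range (M + 1), w (tG q) m * ((e q (M + k + 1 - m))⁻¹ * (e q (M + k + 1 + m))⁻¹
      - (1 - q ^ (2 * (M + k) + 1)) / ((1 + q ^ (2 * (M + k) + 1)) * (1 - q ^ (4 * (M + k) + 4)))
        * ((e q (M + k - m))⁻¹ * (e q (M + k + m))⁻¹))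
    = tG q M * (e q k)⁻¹ * (e q (2 * M + k))⁻¹ *
      (q ^ (2 * (M + k) + 1) / ((1 + q ^ (2 * (M + k) + 1)) * (1 - q ^ (4 * (M + k) + 4)))
       * (1 + q ^ (2 * M + 1)) / (1 - q ^ (2 * (2 * M + k) + 2))) := by
  induction M with
  | zero =>
    intro k
    have a1 := (om_pos h0 h1 (2 * k + 1)).ne'
    have a2 := (om_pos h0 h1 (4 * k + 3)).ne'
    have a3 : 1 + q ^ (2 * k + 1) ≠ 0 := by positivity
    have a4 := (e_pos h0 h1 k).ne'
    simp [w, tG, e_succ]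
    simp only [add_assoc, Nat.reduceAdd] at *
    have r1 : q ^ (2 * k + 2) = (q ^ k) ^ 2 * q ^ 2 := by ring
    have r2 : q ^ (4 * k + 4) = (q ^ k) ^ 4 * q ^ 4 := by ring
    have r3 : q ^ (2 * k + 1) = (q ^ k) ^ 2 * q := by ring
    rw [r1] at a1 ⊢
    rw [r2] at a2 ⊢
    rw [r3] at a3 ⊢
    generalize q ^ k = Y at *
    generalize e q k = E1 at *
    obtain ⟨A, hA⟩ : ∃ A, A = 1 - Y ^ 2 * q ^ 2 := ⟨_, rfl⟩
    obtain ⟨B, hB⟩ : ∃ A, A = 1 - Y ^ 4 * q ^ 4 := ⟨_, rfl⟩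
    obtain ⟨C, hC⟩ : ∃ A, A = 1 + Y ^ 2 * q := ⟨_, rfl⟩
    simp only [← hA, ← hB, ← hC] at a1 a2 a3 ⊢
    field_simp
    simp only [hA, hB, hC]
    ring
  | succ M ih =>
    intro k
    have := ih (k + 1)
    rw [sum_range_succ, show M + 1 + k = M + (k + 1) by ring, this]
    rw [show M + (k + 1) + 1 - (M + 1) = k + 1 by omega, show M + (k + 1) - (M + 1) = k by omega,
      show M + (k + 1) + 1 + (M + 1) = (2 * M + k + 1) + 1 + 1 by ring,
      show M + (k + 1) + (M + 1) = (2 * M + k + 1) + 1 by ring,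
      show 2 * M + (k + 1) = 2 * M + k + 1 by ring,
      show 2 * (M + 1) + k = 2 * M + k + 1 + 1 by ring]
    rw [e_succ q (2 * M + k + 1 + 1), e_succ q (2 * M + k + 1), e_succ q k]
    have a1 := (om_pos h0 h1 (2 * k + 1)).ne'
    have a2 := (om_pos h0 h1 (4 * (M + (k + 1)) + 3)).ne'
    have a3 : 1 + q ^ (2 * (M + (k + 1)) + 1) ≠ 0 := by positivity
    have a4 := (e_pos h0 h1 k).ne'
    have a5 := (e_pos h0 h1 (2 * M + k + 1)).ne'
    have a6 := (om_pos h0 h1 (2 * (2 * M + k + 1) + 1)).ne'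
    have a7 := (om_pos h0 h1 (2 * (2 * M + k + 1 + 1) + 1)).ne'
    have a8 : tG q (M + 1) = - tG q M * q ^ (2 * M + 1) := by unfold tG; ring
    have a9 : w (tG q) (M + 1) = tG q (M + 1) := by simp [w]
    rw [a9, a8]
    generalize e q k = E1 at *
    generalize e q (2 * M + k + 1) = E2 at *
    generalize tG q M = T
    simp only [add_assoc, Nat.reduceAdd] at *
    have r1 : q ^ (2 * k + 2) = (q ^ k) ^ 2 * q ^ 2 := by ring
    have r2 : q ^ (4 * (M + (k + 1)) + 4) = (q ^ M) ^ 4 * (q ^ k) ^ 4 * q ^ 8 := by ring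
    have r3 : q ^ (2 * (M + (k + 1)) + 1) = (q ^ M) ^ 2 * (q ^ k) ^ 2 * q ^ 3 := by ring
    have r4 : q ^ (2 * (2 * M + (k + 1)) + 2) = (q ^ M) ^ 4 * (q ^ k) ^ 2 * q ^ 4 := by ring
    have r5 : q ^ (2 * (2 * M + (k + 2)) + 2) = (q ^ M) ^ 4 * (q ^ k) ^ 2 * q ^ 6 := by ring
    have r6 : q ^ (2 * M + 1) = (q ^ M) ^ 2 * q := by ring
    have r7 : q ^ (2 * (M + 1) + 1) = (q ^ M) ^ 2 * q ^ 3 := by ring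
    clear ih this
    simp only [r1, r2, r3, r4, r5, r6, r7] at *
    generalize q ^ M = X at *
    generalize q ^ k = Y at *
    obtain ⟨A, hA⟩ : ∃ A, A = 1 - Y ^ 2 * q ^ 2 := ⟨_, rfl⟩
    obtain ⟨B, hB⟩ : ∃ A, A = 1 - X ^ 4 * Y ^ 4 * q ^ 8 := ⟨_, rfl⟩
    obtain ⟨C, hC⟩ : ∃ A, A = 1 + X ^ 2 * Y ^ 2 * q ^ 3 := ⟨_, rfl⟩
    obtain ⟨D, hD⟩ : ∃ A, A = 1 - X ^ 4 * Y ^ 2 * q ^ 4 := ⟨_, rfl⟩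
    obtain ⟨F, hF⟩ : ∃ A, A = 1 - X ^ 4 * Y ^ 2 * q ^ 6 := ⟨_, rfl⟩
    simp only [← hA, ← hB, ← hC, ← hD, ← hF] at a1 a2 a3 a6 a7 ⊢
    field_simp
    simp only [hA, hB, hC, hD, hF]
    ring

lemma H_gauss {q : ℝ} (h0 : 0 < q) (h1 : q < 1) (n : ℕ) :
    H (tG q) (fun k => (e q k)⁻¹) n = o q n ^ 2 / e q (2 * n) / 2 := by
  induction n with
  | zero => simp [H, w, tG, e, o]
  | succ n ih =>
    have key := gauss_partial h0 h1 n 0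
    simp only [mul_sub, sum_sub_distrib, add_zero] at key
    unfold H at *
    rw [sum_range_succ]
    simp only [mul_left_comm _ (_ / _) _, ← mul_sum] at key
    simp only [mul_assoc] at *
    rw [ih, sub_eq_iff_eq_add] at key
    rw [key, o_succ, show 2 * (n + 1) = 2 * n + 1 + 1 by ring, show n + 1 + (n + 1) = 2 * n + 1 + 1 by ring]
    have a2 := (om_pos h0 h1 (4 * n + 3)).ne'
    have a3 : 1 + q ^ (2 * n + 1) ≠ 0 := by positivity
    have a5 := (e_pos h0 h1 (2 * n)).ne'
    have a6 := (om_pos h0 h1 (2 * (2 * n) + 1)).ne'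
    have a7 := (om_pos h0 h1 (2 * (2 * n + 1) + 1)).ne'
    have a8 : tG q (n + 1) = - tG q n * q ^ (2 * n + 1) := by unfold tG; ring
    have a9 : w (tG q) (n + 1) = tG q (n + 1) := by simp [w]
    rw [a9, a8, e_succ, e_succ, Nat.sub_self]
    have : e q 0 = 1 := by simp [e]
    rw [this]
    generalize e q (2 * n) = E2 at *
    generalize tG q n = T
    generalize o q n = O
    have r2 : q ^ (4 * n + 4) = (q ^ n) ^ 4 * q ^ 4 := by ring
    have r3 : q ^ (2 * n + 1) = (q ^ n) ^ 2 * q := by ring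
    have r4 : q ^ (2 * (2 * n) + 2) = (q ^ n) ^ 4 * q ^ 2 := by ring
    have r5 : q ^ (2 * (2 * n + 1) + 2) = (q ^ n) ^ 4 * q ^ 4 := by ring
    simp only [add_assoc, Nat.reduceAdd] at *
    simp only [r2, r3, r4, r5] at *
    generalize q ^ n = X at *
    field_simp
    ring


/-- The rational factor. -/
noncomputable def al (q N : ℝ) : ℝ :=
  q * N * (1 + q ^ 3 * N ^ 2) / ((1 + q ^ 2 * N) ^ 2 * (1 + q * N) * (1 - q ^ 2 * N))

noncomputable def bL (q : ℝ) (k : ℕ) : ℝ := p q k / e q k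

lemma bL_succ (q : ℝ) (k : ℕ) :
    bL q (k + 1) = bL q k * ((1 + q ^ (2 * k + 1)) / (1 - q ^ (2 * k + 2))) := by
  rw [bL, p_succ, e_succ, bL, div_mul_div_comm]

lemma lam_partial {q : ℝ} (h0 : 0 < q) (h1 : q < 1) (M : ℕ) : ∀ k : ℕ,
    ∑ m ∈ range (M + 1), w (tL q) m * (bL q (M + k + 1 - m) * bL q (M + k + 1 + m)
      - (1 - q ^ (2 * (M + k) + 1)) ^ 2 / (1 + q ^ (2 * (M + k) + 2)) ^ 2
        * (bL q (M + k - m) * bL q (M + k + m)))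
    = tL q M * bL q k * bL q (2 * M + k) *
      (al q (q ^ (2 * (M + k))) * (1 + q ^ (2 * M + 1)) * (1 + q ^ (2 * (2 * M + k) + 1))
        * (1 + q ^ (2 * M)) / (q ^ (2 * M) * (1 - q ^ (2 * (2 * M + k) + 2)))) := by
  induction M with
  | zero =>
    intro k
    have a1 := (om_pos h0 h1 (2 * k + 1)).ne'
    have a2 : 1 + q ^ (2 * k + 2) ≠ 0 := by positivity
    have a3 : 1 + q ^ (2 * k + 1) ≠ 0 := by positivity
    simp [w, tL, bL_succ, al]
    simp only [add_assoc, Nat.reduceAdd] at *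
    have r1 : q ^ (2 * k + 2) = q ^ 2 * (q ^ k) ^ 2 := by ring
    have r3 : q ^ (2 * k + 1) = q * (q ^ k) ^ 2 := by ring
    have r4 : q ^ (2 * k) = (q ^ k) ^ 2 := by ring
    simp only [r1, r3, r4] at *
    generalize q ^ k = Y at *
    generalize bL q k = E1 at *
    obtain ⟨A, hA⟩ : ∃ A, A = 1 - q ^ 2 * Y ^ 2 := ⟨_, rfl⟩
    obtain ⟨B, hB⟩ : ∃ A, A = 1 + q ^ 2 * Y ^ 2 := ⟨_, rfl⟩
    obtain ⟨C, hC⟩ : ∃ A, A = 1 + q * Y ^ 2 := ⟨_, rfl⟩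
    simp only [← hA, ← hB, ← hC] at a1 a2 a3 ⊢
    field_simp
    simp only [hA, hB, hC]
    ring
  | succ M ih =>
    intro k
    have := ih (k + 1)
    rw [sum_range_succ, show M + 1 + k = M + (k + 1) by ring, this]
    rw [show M + (k + 1) + 1 - (M + 1) = k + 1 by omega, show M + (k + 1) - (M + 1) = k by omega,
      show M + (k + 1) + 1 + (M + 1) = (2 * M + k + 1) + 1 + 1 by ring,
      show M + (k + 1) + (M + 1) = (2 * M + k + 1) + 1 by ring,
      show 2 * M + (k + 1) = 2 * M + k + 1 by ring,
      show 2 * (M + 1) + k = 2 * M + k + 1 + 1 by ring]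
    rw [bL_succ q (2 * M + k + 1 + 1), bL_succ q (2 * M + k + 1), bL_succ q k]
    have a1 := (om_pos h0 h1 (2 * k + 1)).ne'
    have a2 : 1 + q ^ (2 * (M + (k + 1)) + 2) ≠ 0 := by positivity
    have a3 : 1 + q ^ (2 * (M + (k + 1)) + 1) ≠ 0 := by positivity
    have a4 := (om_pos h0 h1 (2 * (M + (k + 1)) + 1)).ne'
    have a6 := (om_pos h0 h1 (2 * (2 * M + k + 1) + 1)).ne'
    have a7 := (om_pos h0 h1 (2 * (2 * M + k + 1 + 1) + 1)).ne'
    have a10 : 1 + q ^ (2 * M) ≠ 0 := by positivity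
    have a11 : 1 + q ^ (2 * (M + 1)) ≠ 0 := by positivity
    have a12 : q ^ M ≠ 0 := by positivity
    have a13 := h0.ne'
    have a8 : tL q M = (-1) ^ M * q ^ M / (1 + q ^ (2 * M)) := rfl
    have a8' : tL q (M + 1) = - ((-1) ^ M * q ^ M) * q / (1 + q ^ (2 * (M + 1))) := by
      unfold tL; ring
    have a9 : w (tL q) (M + 1) = tL q (M + 1) := by simp [w]
    rw [a9, a8, a8', al]
    clear ih this a8 a8' a9
    generalize bL q k = E1 at *
    generalize bL q (2 * M + k + 1) = E2 at *
    generalize (-1 : ℝ) ^ M = T at *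
    simp only [add_assoc, Nat.reduceAdd] at *
    have r1 : q ^ (2 * k + 2) = (q ^ k) ^ 2 * q ^ 2 := by ring
    have r1' : q ^ (2 * k + 1) = (q ^ k) ^ 2 * q := by ring
    have r2 : q ^ (2 * (M + (k + 1)) + 2) = q ^ 2 * ((q ^ M) ^ 2 * (q ^ k) ^ 2 * q ^ 2) := by ring
    have r3 : q ^ (2 * (M + (k + 1)) + 1) = q * ((q ^ M) ^ 2 * (q ^ k) ^ 2 * q ^ 2) := by ring
    have r3' : q ^ (2 * (M + (k + 1))) = (q ^ M) ^ 2 * (q ^ k) ^ 2 * q ^ 2 := by ring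
    have r4 : q ^ (2 * (2 * M + (k + 1)) + 2) = (q ^ M) ^ 4 * (q ^ k) ^ 2 * q ^ 4 := by ring
    have r4' : q ^ (2 * (2 * M + (k + 1)) + 1) = (q ^ M) ^ 4 * (q ^ k) ^ 2 * q ^ 3 := by ring
    have r5 : q ^ (2 * (2 * M + (k + 2)) + 2) = (q ^ M) ^ 4 * (q ^ k) ^ 2 * q ^ 6 := by ring
    have r5' : q ^ (2 * (2 * M + (k + 2)) + 1) = (q ^ M) ^ 4 * (q ^ k) ^ 2 * q ^ 5 := by ring
    have r6 : q ^ (2 * M + 1) = (q ^ M) ^ 2 * q := by ring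
    have r7 : q ^ (2 * (M + 1) + 1) = (q ^ M) ^ 2 * q ^ 3 := by ring
    have r8 : q ^ (2 * (M + 1)) = (q ^ M) ^ 2 * q ^ 2 := by ring
    have r9 : q ^ (2 * M) = (q ^ M) ^ 2 := by ring
    simp only [r1, r1', r2, r3, r3', r4, r4', r5, r5', r6, r7, r8, r9] at *
    clear r1 r1' r2 r3 r3' r4 r4' r5 r5' r6 r7 r8 r9
    generalize q ^ M = X at *
    generalize q ^ k = Y at *
    obtain ⟨A, hA⟩ : ∃ A, A = 1 - Y ^ 2 * q ^ 2 := ⟨_, rfl⟩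
    obtain ⟨B, hB⟩ : ∃ A, A = 1 + q ^ 2 * (X ^ 2 * Y ^ 2 * q ^ 2) := ⟨_, rfl⟩
    obtain ⟨B', hB'⟩ : ∃ A, A = 1 - q ^ 2 * (X ^ 2 * Y ^ 2 * q ^ 2) := ⟨_, rfl⟩
    obtain ⟨C, hC⟩ : ∃ A, A = 1 + q * (X ^ 2 * Y ^ 2 * q ^ 2) := ⟨_, rfl⟩
    obtain ⟨D, hD⟩ : ∃ A, A = 1 - X ^ 4 * Y ^ 2 * q ^ 4 := ⟨_, rfl⟩
    obtain ⟨F, hF⟩ : ∃ A, A = 1 - X ^ 4 * Y ^ 2 * q ^ 6 := ⟨_, rfl⟩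
    obtain ⟨U, hU⟩ : ∃ A, A = 1 + X ^ 2 := ⟨_, rfl⟩
    obtain ⟨V, hV⟩ : ∃ A, A = 1 + X ^ 2 * q ^ 2 := ⟨_, rfl⟩
    simp only [← hA, ← hB, ← hB', ← hC, ← hD, ← hF, ← hU, ← hV] at a1 a2 a3 a4 a6 a7 a10 a11 ⊢
    field_simp
    simp only [hA, hB, hB', hC, hD, hF, hU, hV]
    ring

lemma H_lam {q : ℝ} (h0 : 0 < q) (h1 : q < 1) (n : ℕ) :
    H (tL q) (bL q) n = o q n ^ 2 / f q n ^ 2 / 4 := by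
  induction n with
  | zero => simp [H, w, tL, bL, e, o, f, p]; norm_num
  | succ n ih =>
    have key := lam_partial h0 h1 n 0
    simp only [mul_sub, sum_sub_distrib, add_zero] at key
    unfold H at *
    rw [sum_range_succ]
    simp only [mul_left_comm _ (_ / _) _, ← mul_sum] at key
    simp only [mul_assoc] at *
    rw [ih, sub_eq_iff_eq_add] at key
    rw [key, o_succ, f_succ, show n + 1 + (n + 1) = 2 * n + 1 + 1 by ring]
    have a2 : 1 + q ^ (2 * n + 2) ≠ 0 := by positivity
    have a3 : 1 + q ^ (2 * n + 1) ≠ 0 := by positivity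
    have a4 := (om_pos h0 h1 (2 * n + 1)).ne'
    have a6 := (om_pos h0 h1 (2 * (2 * n) + 1)).ne'
    have a7 := (om_pos h0 h1 (2 * (2 * n + 1) + 1)).ne'
    have a10 : 1 + q ^ (2 * n) ≠ 0 := by positivity
    have a11 : 1 + q ^ (2 * (n + 1)) ≠ 0 := by positivity
    have a12 : q ^ n ≠ 0 := by positivity
    have a13 := h0.ne'
    have a14 := (f_pos h0 n).ne'
    have a8 : tL q n = (-1) ^ n * q ^ n / (1 + q ^ (2 * n)) := rfl
    have a8' : tL q (n + 1) = - ((-1) ^ n * q ^ n) * q / (1 + q ^ (2 * (n + 1))) := by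
      unfold tL; ring
    have a9 : w (tL q) (n + 1) = tL q (n + 1) := by simp [w]
    rw [a9, a8, a8', bL_succ q (2 * n + 1), bL_succ q (2 * n), Nat.sub_self, al]
    clear ih key a8 a8' a9
    have : bL q 0 = 1 := by simp [bL, e, p]
    rw [this]
    generalize bL q (2 * n) = E2 at *
    generalize (-1 : ℝ) ^ n = T at *
    generalize o q n = O
    generalize f q n = Z at *
    have r1 : q ^ (2 * (n + 1)) = q ^ 2 * (q ^ n) ^ 2 := by ring
    have r2 : q ^ (2 * n + 2) = q ^ 2 * (q ^ n) ^ 2 := by ring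
    have r3 : q ^ (2 * n + 1) = q * (q ^ n) ^ 2 := by ring
    have r3' : q ^ (2 * n) = (q ^ n) ^ 2 := by ring
    have r4 : q ^ (2 * (2 * n) + 2) = (q ^ n) ^ 4 * q ^ 2 := by ring
    have r4' : q ^ (2 * (2 * n) + 1) = (q ^ n) ^ 4 * q := by ring
    have r5 : q ^ (2 * (2 * n + 1) + 2) = (q ^ n) ^ 4 * q ^ 4 := by ring
    have r5' : q ^ (2 * (2 * n + 1) + 1) = (q ^ n) ^ 4 * q ^ 3 := by ring
    simp only [add_assoc, Nat.reduceAdd] at *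
    simp only [r1, r2, r3, r3', r4, r4', r5, r5'] at *
    clear r1 r2 r3 r3' r4 r4' r5 r5'
    generalize q ^ n = X at *
    rw [show X ^ 2 * 1 - X ^ 2 * (X ^ 4 * q ^ 2) = X ^ 2 * (1 - X ^ 4 * q ^ 2) by ring]
    obtain ⟨B, hB⟩ : ∃ A, A = 1 + q ^ 2 * X ^ 2 := ⟨_, rfl⟩
    obtain ⟨B', hB'⟩ : ∃ A, A = 1 - q ^ 2 * X ^ 2 := ⟨_, rfl⟩
    obtain ⟨C, hC⟩ : ∃ A, A = 1 + q * X ^ 2 := ⟨_, rfl⟩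
    obtain ⟨D, hD⟩ : ∃ A, A = 1 - X ^ 4 * q ^ 2 := ⟨_, rfl⟩
    obtain ⟨F, hF⟩ : ∃ A, A = 1 - X ^ 4 * q ^ 4 := ⟨_, rfl⟩
    obtain ⟨U, hU⟩ : ∃ A, A = 1 + X ^ 2 := ⟨_, rfl⟩
    simp only [← hB, ← hB', ← hC, ← hD, ← hF, ← hU] at a2 a3 a4 a6 a7 a10 a11 ⊢
    field_simp
    simp only [hB, hB', hC, hD, hF, hU]
    ring


lemma H_tendsto {t b : ℕ → ℝ} {β : ℝ} (ht : Summable (w t)) (hb : Tendsto b atTop (𝓝 β)) :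
    Tendsto (H t b) atTop (𝓝 ((∑' m, w t m) * β ^ 2)) := by
  obtain ⟨C, hC⟩ := hb.norm.bddAbove_range
  have hC' : ∀ n, ‖b n‖ ≤ C := fun n => hC ⟨n, rfl⟩
  have hC0 : 0 ≤ C := (norm_nonneg _).trans (hC' 0)
  have e1 : ∀ n, H t b n = ∑' m, (if m ≤ n then w t m * b (n - m) * b (n + m) else 0) := by
    intro n
    rw [tsum_eq_sum (s := range (n + 1))]
    · exact sum_congr rfl fun m hm => by rw [if_pos (by simp at hm; omega)]
    · intro m hm
      rw [if_neg (by simp at hm; omega)]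
  rw [show H t b = _ from funext e1, ← tsum_mul_right]
  refine tendsto_tsum_of_dominated_convergence (bound := fun m => ‖w t m‖ * C ^ 2)
    (ht.norm.mul_right _) ?_ ?_
  · intro m
    have h : Tendsto (fun n => w t m * b (n - m) * b (n + m)) atTop (𝓝 (w t m * β * β)) :=
      ((hb.comp (tendsto_sub_atTop_nat m)).const_mul _).mul
        (hb.comp (tendsto_add_atTop_nat m))
    rw [show w t m * β ^ 2 = w t m * β * β by ring]
    refine h.congr' ?_
    filter_upwards [eventually_ge_atTop m] with n hn
    rw [if_pos hn]
  · refine Eventually.of_forall fun n m => ?_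
    split_ifs
    · rw [norm_mul, norm_mul, mul_assoc, sq]
      gcongr
      · exact hC' _
      · exact hC' _
    · rw [norm_zero]; positivity

lemma summable_pow_lin {q : ℝ} (h0 : 0 < q) (h1 : q < 1) (a : ℕ) :
    Summable (fun i : ℕ => q ^ (2 * i + a)) := by
  simp only [pow_add, pow_mul]
  exact (summable_geometric_of_lt_one (by positivity) (by nlinarith)).mul_right _

lemma lim_plus {q : ℝ} (h0 : 0 < q) (h1 : q < 1) (a : ℕ) :
    ∃ l ≠ 0, Tendsto (fun n => ∏ i ∈ range n, (1 + q ^ (2 * i + a))) atTop (𝓝 l) := by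
  have hs := summable_pow_lin h0 h1 a
  exact ⟨_, tprod_one_add_ne_zero_of_summable (fun i => by positivity) hs.norm,
    (multipliable_one_add_of_summable hs.norm).hasProd.tendsto_prod_nat⟩

lemma lim_minus {q : ℝ} (h0 : 0 < q) (h1 : q < 1) (a : ℕ) :
    ∃ l ≠ 0, Tendsto (fun n => ∏ i ∈ range n, (1 - q ^ (2 * i + (a + 1)))) atTop (𝓝 l) := by
  have hs := (summable_pow_lin h0 h1 (a + 1)).neg
  simp only [sub_eq_add_neg]
  exact ⟨_, tprod_one_add_ne_zero_of_summable
    (fun i => by rw [← sub_eq_add_neg]; exact (om_pos h0 h1 (2 * i + a)).ne') hs.norm,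
    (multipliable_one_add_of_summable hs.norm).hasProd.tendsto_prod_nat⟩

lemma w_summable {t : ℕ → ℝ} {q : ℝ} (h0 : 0 < q) (h1 : q < 1) (h : ∀ m, |t m| ≤ q ^ m) :
    Summable (w t) := by
  refine Summable.of_norm_bounded (summable_geometric_of_lt_one h0.le h1) fun m => ?_
  unfold w
  rw [Real.norm_eq_abs]
  split_ifs with hm
  · subst hm
    refine le_trans ?_ (h 0)
    rw [abs_div, abs_two]
    linarith [abs_nonneg (t 0)]
  · exact h m

lemma tG_le {q : ℝ} (h0 : 0 < q) (h1 : q < 1) (m : ℕ) : |tG q m| ≤ q ^ m := by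
  rw [tG, abs_mul, abs_pow, abs_neg, abs_one, one_pow, one_mul, abs_of_pos (by positivity)]
  exact pow_le_pow_of_le_one h0.le h1.le (Nat.le_self_pow (by norm_num) m)

lemma tL_le {q : ℝ} (h0 : 0 < q) (h1 : q < 1) (m : ℕ) : |tL q m| ≤ q ^ m := by
  rw [tL, abs_div, abs_mul, abs_pow, abs_neg, abs_one, one_pow, one_mul,
    abs_of_pos (by positivity), abs_of_pos (by positivity)]
  exact div_le_self (by positivity) (by linarith [pow_pos h0 (2 * m)])

lemma main {q : ℝ} (h0 : 0 < q) (h1 : q < 1) :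
    (2 * ∑' m, w (tG q) m) ^ 2 = 4 * ∑' m, w (tL q) m := by
  obtain ⟨O, hO0, hO⟩ := lim_minus h0 h1 0
  obtain ⟨E, hE0, hE⟩ := lim_minus h0 h1 1
  obtain ⟨P, hP0, hP⟩ := lim_plus h0 h1 1
  obtain ⟨F, hF0, hF⟩ := lim_plus h0 h1 2
  change Tendsto (o q) _ _ at hO
  change Tendsto (e q) _ _ at hE
  change Tendsto (p q) _ _ at hP
  change Tendsto (f q) _ _ at hF
  have h2 : Tendsto (fun n : ℕ => 2 * n) atTop atTop :=
    tendsto_id.const_mul_atTop' (by norm_num)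
  have hE2 := hE.comp h2
  have eu : O * P * F * E = E :=
    tendsto_nhds_unique ((((hO.mul hP).mul hF).mul hE).congr fun n => euler q n) hE2
  have G := tendsto_nhds_unique (H_tendsto (w_summable h0 h1 (tG_le h0 h1)) (hE.inv₀ hE0))
    ((((hO.pow 2).div hE2 hE0).div_const 2).congr fun n => (H_gauss h0 h1 n).symm)
  have L := tendsto_nhds_unique (H_tendsto (w_summable h0 h1 (tL_le h0 h1)) (hP.div hE hE0))
    ((((hO.pow 2).div (hF.pow 2) (pow_ne_zero 2 hF0)).div_const 4).congr
      fun n => (H_lam h0 h1 n).symm)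
  have eu' : O * P * F = 1 := by
    apply mul_right_cancel₀ hE0; rw [eu, one_mul]
  generalize ∑' m, w (tG q) m = SG at *
  generalize ∑' m, w (tL q) m = SL at *
  have G' : 2 * SG = O ^ 2 * E := by
    field_simp at G
    linarith
  have L' : 4 * SL * (P * F) ^ 2 = O ^ 2 * E ^ 2 := by
    field_simp at L
    linarith
  rw [G']
  have : P * F ≠ 0 := mul_ne_zero hP0 hF0
  apply mul_right_cancel₀ (pow_ne_zero 2 this)
  rw [L']
  calc (O ^ 2 * E) ^ 2 * (P * F) ^ 2 = O ^ 2 * E ^ 2 * (O * P * F) ^ 2 := by ring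
    _ = _ := by rw [eu']; ring

lemma tsum_w {t : ℕ → ℝ} (h : Summable (w t)) : ∑' m, w t m = t 0 / 2 + ∑' m, t (m + 1) := by
  rw [h.tsum_eq_zero_add]
  simp [w]

lemma geo_alt {y : ℝ} (h0 : 0 < y) (h1 : y < 1) :
    HasSum (fun j : ℕ => (-1) ^ j * y ^ j) (1 / (1 + y)) := by
  have := hasSum_geometric_of_abs_lt_one (r := -y) (by rw [abs_neg, abs_of_pos h0]; exact h1)
  simpa [neg_pow y] using this

/-- The double series. -/
noncomputable def dd (q : ℝ) (z : ℕ × ℕ) : ℝ :=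
  (-1) ^ (z.1 + 1) * (-1) ^ z.2 * q ^ ((z.1 + 1) * (2 * z.2 + 1))

lemma dd_summable {q : ℝ} (h0 : 0 < q) (h1 : q < 1) : Summable (dd q) := by
  have g := summable_geometric_of_lt_one h0.le h1
  refine Summable.of_norm_bounded (g.mul_of_nonneg g (fun _ => by positivity)
    (fun _ => by positivity)) fun z => ?_
  rw [dd, norm_mul, norm_mul, norm_pow, norm_pow, norm_neg, norm_one, one_pow, one_pow, one_mul,
    one_mul, Real.norm_eq_abs, abs_of_pos (by positivity), ← pow_add]
  exact pow_le_pow_of_le_one h0.le h1.le (by nlinarith [Nat.zero_le (z.1 * z.2)])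

lemma swap {q : ℝ} (h0 : 0 < q) (h1 : q < 1) :
    ∑' m, tL q (m + 1) = - ∑' j : ℕ, (-1) ^ j * (q ^ (2 * j + 1) / (1 + q ^ (2 * j + 1))) := by
  have hs := dd_summable h0 h1
  have c1 : ∀ m, ∑' j, dd q (m, j) = tL q (m + 1) := by
    intro m
    have := (geo_alt (y := q ^ (2 * (m + 1))) (by positivity)
      (pow_lt_one₀ h0.le h1 (by omega))).mul_left ((-1) ^ (m + 1) * q ^ (m + 1))
    rw [tL, ← mul_one_div, ← this.tsum_eq]
    refine tsum_congr fun j => ?_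
    simp only [dd]
    ring
  have c2 : ∀ j, ∑' m, dd q (m, j) = -((-1) ^ j * (q ^ (2 * j + 1) / (1 + q ^ (2 * j + 1)))) := by
    intro j
    have := (geo_alt (y := q ^ (2 * j + 1)) (by positivity)
      (pow_lt_one₀ h0.le h1 (by omega))).mul_left (-((-1) ^ j * q ^ (2 * j + 1)))
    rw [show -((-1) ^ j * (q ^ (2 * j + 1) / (1 + q ^ (2 * j + 1)))) =
      -((-1) ^ j * q ^ (2 * j + 1)) * (1 / (1 + q ^ (2 * j + 1))) by ring, ← this.tsum_eq]
    refine tsum_congr fun m => ?_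
    simp only [dd]
    ring
  rw [← tsum_neg, ← tsum_congr c1, ← tsum_congr c2]
  exact (Summable.tsum_comm (f := fun m j => dd q (m, j)) hs).symm

end ThetaFour

/-- For every real `x > 0`,
`¼ (1 - (Σ_{n∈ℤ} (-1)^n e^{-n²x})²) = Σ_{j=0}^∞ (-1)^j / (e^{(2j+1)x} + 1)`,
both series converging absolutely. -/
theorem theta_four_identity (x : ℝ) (hx : 0 < x) :
    Summable (fun n : ℤ => |(-1 : ℝ) ^ n * Real.exp (-(n : ℝ) ^ 2 * x)|) ∧
    Summable (fun j : ℕ => |(-1 : ℝ) ^ j / (Real.exp ((2 * j + 1) * x) + 1)|) ∧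
    1 / 4 * (1 - (∑' n : ℤ, (-1 : ℝ) ^ n * Real.exp (-(n : ℝ) ^ 2 * x)) ^ 2) =
      ∑' j : ℕ, (-1 : ℝ) ^ j / (Real.exp ((2 * j + 1) * x) + 1) := by
  obtain ⟨q, hq⟩ : ∃ q, q = Real.exp (-x) := ⟨_, rfl⟩
  have h0 : 0 < q := hq ▸ Real.exp_pos _
  have h1 : q < 1 := by rw [hq]; simpa using hx
  have t1 : ∀ n : ℕ, (-1 : ℝ) ^ (n : ℤ) * Real.exp (-((n : ℤ) : ℝ) ^ 2 * x)
      = ThetaFour.tG q n := by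
    intro n
    rw [ThetaFour.tG, hq, ← Real.exp_nat_mul, zpow_natCast]
    push_cast
    ring_nf
  have ev : Function.Even (fun n : ℤ => (-1 : ℝ) ^ n * Real.exp (-(n : ℝ) ^ 2 * x)) := by
    intro n
    simp [zpow_neg, ← inv_zpow, inv_neg]
  have t2 : ∀ j : ℕ, (-1 : ℝ) ^ j / (Real.exp ((2 * j + 1) * x) + 1)
      = (-1) ^ j * (q ^ (2 * j + 1) / (1 + q ^ (2 * j + 1))) := by
    intro j
    have : q ^ (2 * j + 1) = (Real.exp ((2 * j + 1) * x))⁻¹ := by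
      rw [hq, ← Real.exp_nat_mul, ← Real.exp_neg]
      push_cast
      ring_nf
    rw [this]
    have := Real.exp_pos ((2 * j + 1) * x)
    field_simp
  have sG : Summable (ThetaFour.tG q) :=
    Summable.of_norm_bounded (summable_geometric_of_lt_one h0.le h1) (ThetaFour.tG_le h0 h1)
  have s1 : Summable (fun n : ℤ => (-1 : ℝ) ^ n * Real.exp (-(n : ℝ) ^ 2 * x)) := by
    rw [summable_int_iff_summable_nat_and_neg]
    have : Summable (fun n : ℕ => (-1 : ℝ) ^ (n : ℤ) * Real.exp (-((n : ℤ) : ℝ) ^ 2 * x)) := by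
      simpa only [t1] using sG
    exact ⟨this, this.congr fun n => (ev n).symm⟩
  refine ⟨s1.abs, ?_, ?_⟩
  · simp only [t2]
    refine Summable.abs (Summable.of_norm_bounded (ThetaFour.summable_pow_lin h0 h1 1) fun j => ?_)
    rw [norm_mul, norm_pow, norm_neg, norm_one, one_pow, one_mul, Real.norm_eq_abs,
      abs_of_pos (by positivity)]
    exact div_le_self (by positivity) (by linarith [pow_pos h0 (2 * j + 1)])
  · have m := ThetaFour.main h0 h1
    rw [ThetaFour.tsum_w (ThetaFour.w_summable h0 h1 (ThetaFour.tG_le h0 h1)),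
      ThetaFour.tsum_w (ThetaFour.w_summable h0 h1 (ThetaFour.tL_le h0 h1)),
      ThetaFour.swap h0 h1] at m
    rw [tsum_int_eq_zero_add_two_mul_tsum_pnat ev s1]
    have := tsum_pnat_eq_tsum_succ (f := ThetaFour.tG q)
    have e2 : ∀ n : ℕ+, (-1 : ℝ) ^ (n : ℤ) * Real.exp (-((n : ℤ) : ℝ) ^ 2 * x)
      = ThetaFour.tG q n := fun n => t1 n
    simp only [e2, t2, this]
    have z1 : ThetaFour.tG q 0 = 1 := by simp [ThetaFour.tG]
    have z2 : ThetaFour.tL q 0 = 1 / 2 := by simp [ThetaFour.tL]; norm_num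
    rw [z1, z2] at m
    simp
    generalize ∑' n, ThetaFour.tG q (n + 1) = A at *
    generalize ∑' j : ℕ, (-1 : ℝ) ^ j * (q ^ (2 * j + 1) / (1 + q ^ (2 * j + 1))) = B at *
    nlinarith [m]
end
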